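/- arXiv:2312.11077 — 3 statements merged into one kernel-verified Lean document; each statement's English description precedes it below -/
import Mathlib

section
/- Let (R, 𝔪) be a two-dimensional regular local ring with infinite residue field, let (a, b) be an 𝔪-primary ideal of R of order n, and let 2 ≤ r ≤ n. Write 𝔪 = (x, y), a = a_1 x^{r-1} + a_2 x^{r-2}y + ⋯ + a_r y^{r-1} and b = b_1 x^{r-1} + ⋯ + b_r y^{r-1}. Let P be the parameter module generated by the columns of the r × (r+1) matrix whose first two columns are (a_1, …, a_r)^T and (b_1, …, b_r)^T and whose last r−1 columns form the bidiagonal matrix with y on the diagonal and −x directly below the diagonal. Then (a, b) ⊆ I(P) and λ(I(P)/(a, b)) = r(r−1)/2. -/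
open IsLocalRing

section Defs

variable {R : Type*} [CommRing R]

/-- `R` is a two-dimensional regular local ring: Noetherian local of Krull dimension 2
whose maximal ideal is generated by two elements. -/
def IsTwoDimRegularLocal (R : Type*) [CommRing R] [IsLocalRing R] : Prop :=
  IsNoetherianRing R ∧ ringKrullDim R = 2 ∧
    ∃ x y : R, maximalIdeal R = Ideal.span {x, y}

/-- `z` lies in the integral closure of the ideal `I`, i.e. it satisfies an equation
`z ^ n + c 1 * z ^ (n-1) + ⋯ + c n = 0` with `c i ∈ I ^ i`. -/
def MemIntClosure (I : Ideal R) (z : R) : Prop :=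
  ∃ n : ℕ, 0 < n ∧ ∃ c : ℕ → R, (∀ i ∈ Finset.Icc 1 n, c i ∈ I ^ i) ∧
    z ^ n + ∑ i ∈ Finset.Icc 1 n, c i * z ^ (n - i) = 0

/-- The ideal `I` is integrally closed. -/
def IdealIntClosed (I : Ideal R) : Prop := ∀ z, MemIntClosure I z → z ∈ I

/-- `I` is `𝔪`-primary. -/
def IsMPrimary [IsLocalRing R] (I : Ideal R) : Prop := I.radical = maximalIdeal R

/-- `ord I = n` : `n` is the largest power of the maximal ideal containing `I`. -/
def ordEQ [IsLocalRing R] (I : Ideal R) (n : ℕ) : Prop :=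
  I ≤ maximalIdeal R ^ n ∧ ¬ I ≤ maximalIdeal R ^ (n + 1)

/-- Determinant of the square matrix with columns `w 0, …, w (r-1)`. -/
def colDet {r : ℕ} (w : Fin r → Fin r → R) : R :=
  Matrix.det (Matrix.of fun i j => w j i)

/-- The ideal of maximal minors `I(M)` of a submodule `M ⊆ R^r`:  it is generated by all
determinants of `r × r` matrices whose columns lie in `M`. -/
def maxMinors {r : ℕ} (M : Submodule R (Fin r → R)) : Ideal R :=
  Ideal.span { d | ∃ w : Fin r → Fin r → R, (∀ j, w j ∈ M) ∧ d = colDet w }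

/-- The ideal `I_k(M)` of `k × k` minors of a matrix whose columns generate `M ⊆ R^r`. -/
def minorsIdeal (k : ℕ) {r : ℕ} (M : Submodule R (Fin r → R)) : Ideal R :=
  Ideal.span { d | ∃ (w : Fin k → Fin r → R) (ρ : Fin k → Fin r),
    Function.Injective ρ ∧ (∀ j, w j ∈ M) ∧
    d = Matrix.det (Matrix.of fun i j : Fin k => w j (ρ i)) }

/-- `v ∈ R^r` is integral over the submodule `M ⊆ R^r` : the determinant of every square
matrix with one column `v` and the remaining columns in `M` is integral over `I(M)`. -/
def IntegralOverMod {r : ℕ} (M : Submodule R (Fin r → R)) (v : Fin r → R) : Prop :=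
  ∀ (w : Fin r → Fin r → R) (j₀ : Fin r), w j₀ = v → (∀ j, j ≠ j₀ → w j ∈ M) →
    MemIntClosure (maxMinors M) (colDet w)

/-- The submodule `M ⊆ R^r` is integrally closed. -/
def ModIntClosed {r : ℕ} (M : Submodule R (Fin r → R)) : Prop :=
  ∀ v, IntegralOverMod M v → v ∈ M

/-- The length of an `R`-module, as the Krull dimension of its submodule lattice. -/
noncomputable def modLength (R : Type*) (M : Type*) [CommRing R] [AddCommGroup M]
    [Module R M] : WithBot ℕ∞ :=
  Order.krullDim (Submodule R M)

/-- `M ⊆ R^r` has finite colength; equivalently, `M` is a finitely generated torsion-free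
module of rank `r` with double dual `M** = R^r`. -/
def FinColength {r : ℕ} (M : Submodule R (Fin r → R)) : Prop :=
  IsFiniteLength R ((Fin r → R) ⧸ M)

/-- `M` has a nonzero free direct summand. -/
def HasFreeSummand {r : ℕ} (M : Submodule R (Fin r → R)) : Prop :=
  ∃ N P : Submodule R (Fin r → R), N ⊔ P = M ∧ N ⊓ P = ⊥ ∧ N ≠ ⊥ ∧ Module.Free R ↥N

/-- `M` is a direct sum of two nonzero submodules. -/
def DecomposableSub {r : ℕ} (M : Submodule R (Fin r → R)) : Prop :=
  ∃ N P : Submodule R (Fin r → R), N ⊔ P = M ∧ N ⊓ P = ⊥ ∧ N ≠ ⊥ ∧ P ≠ ⊥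

/-- `M` is nonzero and not a direct sum of two nonzero submodules. -/
def IndecomposableSub {r : ℕ} (M : Submodule R (Fin r → R)) : Prop :=
  M ≠ ⊥ ∧ ¬ DecomposableSub M

/-- `a` is a minimal generating set of the ideal `I`. -/
def MinGens {m : ℕ} (I : Ideal R) (a : Fin m → R) : Prop :=
  Ideal.span (Set.range a) = I ∧ ∀ j : Fin m, Ideal.span (a '' {j}ᶜ) ≠ I

/-- `a = c 0 * x^(r-1) + c 1 * x^(r-2) * y + ⋯ + c (r-1) * y^(r-1)`. -/
def Expresses (r : ℕ) (x y : R) (c : Fin r → R) (a : R) : Prop :=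
  a = ∑ i : Fin r, c i * x ^ (r - 1 - (i : ℕ)) * y ^ (i : ℕ)

/-- The `k`-th Koszul relation column between `x^(r-1), …, y^(r-1)`:
`y` in position `k` and `-x` in position `k+1`. -/
def stdRelCol (r : ℕ) (x y : R) (k : ℕ) : Fin r → R :=
  fun i => if (i : ℕ) = k then y else if (i : ℕ) = k + 1 then -x else 0

/-- The module generated by the coefficient columns `C j` together with the `r - 1`
Koszul relation columns between `x^(r-1), …, y^(r-1)`. -/
def MrSpan (r : ℕ) (x y : R) {m : ℕ} (C : Fin m → Fin r → R) :
    Submodule R (Fin r → R) :=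
  Submodule.span R (Set.range C ∪ { v | ∃ k, k < r - 1 ∧ v = stdRelCol r x y k })

/-- The data `(x, y, a, C)` presents the module `M_r(I)` : `𝔪 = (x,y)`, `a` is a minimal
generating set of `I` and column `C j` expresses `a j` in terms of `x^(r-1), …, y^(r-1)`. -/
def IsMrPresentation [IsLocalRing R] (r : ℕ) (I : Ideal R) {m : ℕ} (x y : R)
    (a : Fin m → R) (C : Fin m → Fin r → R) : Prop :=
  maximalIdeal R = Ideal.span {x, y} ∧ MinGens I a ∧ ∀ j, Expresses r x y (C j) (a j)

/-- `N` is a reduction of `M` : `N ≤ M` and every element of `M` is integral over `N`. -/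
def IsReductionMod {r : ℕ} (N M : Submodule R (Fin r → R)) : Prop :=
  N ≤ M ∧ ∀ v ∈ M, IntegralOverMod N v

/-- `N` is a minimal reduction of `M`. -/
def IsMinimalReductionMod {r : ℕ} (N M : Submodule R (Fin r → R)) : Prop :=
  IsReductionMod N M ∧ ∀ N' ≤ N, IsReductionMod N' M → N' = N

/-- The `j`-th signed maximal minor of an `r × (r+1)` matrix. -/
def signedMinor {r : ℕ} (A : Matrix (Fin r) (Fin (r + 1)) R) (j : Fin (r + 1)) : R :=
  (-1 : R) ^ (j : ℕ) * (A.submatrix id j.succAbove).det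

/-- `M ⊆ R^r` is extremal: integrally closed, without free direct summands, with
`λ(R/I(M)) = λ(R^r/M) + r(r-1)/2`. -/
def IsExtremal {r : ℕ} (M : Submodule R (Fin r → R)) : Prop :=
  FinColength M ∧ ModIntClosed M ∧ ¬ HasFreeSummand M ∧
    modLength R (R ⧸ maxMinors M) =
      modLength R ((Fin r → R) ⧸ M) + ((r * (r - 1) / 2 : ℕ) : WithBot ℕ∞)

/-- `a ∈ J`, `b ∈ K` is a joint reduction of the pair `(J, K)`. -/
def IsJointReduction (J K : Ideal R) (a b : R) : Prop :=
  a ∈ J ∧ b ∈ K ∧ ∃ n : ℕ,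
    (Ideal.span {a} * K + Ideal.span {b} * J) * (J * K) ^ n = (J * K) ^ (n + 1)

/-- `S` is the matrix `Sym^k(Q)` for `Q = [[a, c], [b, d]]` : with `X = aU + bV`,
`Y = cU + dV`, the `j`-th column of `S` records the coefficients of
`X^(k-j) Y^j` in terms of `U^k, U^(k-1)V, …, V^k`. -/
def IsSymOf (k : ℕ) (a b c d : R) (S : Matrix (Fin (k + 1)) (Fin (k + 1)) R) : Prop :=
  ∀ j : Fin (k + 1),
    ((MvPolynomial.C a * MvPolynomial.X 0 + MvPolynomial.C b * MvPolynomial.X 1) ^ (k - (j : ℕ)) *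
        (MvPolynomial.C c * MvPolynomial.X 0 + MvPolynomial.C d * MvPolynomial.X 1) ^ (j : ℕ)
      : MvPolynomial (Fin 2) R)
    = ∑ i : Fin (k + 1), MvPolynomial.C (S i j) *
        MvPolynomial.X 0 ^ (k - (i : ℕ)) * MvPolynomial.X 1 ^ (i : ℕ)

/-- The `r × s` bidiagonal matrix with `y` on the diagonal and `-x` directly below it. -/
def bidiag (r s : ℕ) (x y : R) : Matrix (Fin r) (Fin s) R :=
  Matrix.of fun i j =>
    if (i : ℕ) = (j : ℕ) then y else if (i : ℕ) = (j : ℕ) + 1 then -x else 0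

end Defs

section RegularLocal

variable {R : Type*} [CommRing R] [IsLocalRing R] [IsNoetherianRing R]

theorem not_maximalIdeal_le_radical_span_singleton (hdim : ringKrullDim R = 2) {z : R}
    (hz : z ∈ maximalIdeal R) : ¬ maximalIdeal R ≤ (Ideal.span {z}).radical := by
  intro h
  have hmin : maximalIdeal R ∈ (Ideal.span {z}).minimalPrimes := by
    refine ⟨⟨inferInstance, (Ideal.span_singleton_le_iff_mem _).2 hz⟩, fun q hq _ => ?_⟩
    exact h.trans (hq.1.radical_le_iff.2 hq.2)
  have h1 := Ideal.height_le_one_of_isPrincipal_of_mem_minimalPrimes _ _ hmin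
  have h2 := IsLocalRing.maximalIdeal_height_eq_ringKrullDim (R := R)
  rw [hdim] at h2
  have h3 : (maximalIdeal R).height = 2 := WithBot.coe_injective (h2.trans rfl)
  rw [h3] at h1
  exact absurd h1 (by decide)

theorem isPrime_span_singleton_of_maximalIdeal_eq (hdim : ringKrullDim R = 2) {z w : R}
    (hm : maximalIdeal R = Ideal.span {z, w}) : (Ideal.span {z}).IsPrime := by
  have hz : z ∈ maximalIdeal R := hm ▸ Ideal.subset_span (by simp)
  obtain ⟨q, hq, -⟩ := Ideal.exists_minimalPrimes_le
    ((Ideal.span_singleton_le_iff_mem (maximalIdeal R)).2 hz)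
  have hqp : q.IsPrime := hq.1.1
  have hzq : z ∈ q := hq.1.2 (Ideal.mem_span_singleton_self z)
  have hwq : w ∉ q := by
    intro hwq
    refine not_maximalIdeal_le_radical_span_singleton hdim hz ?_
    have hle : maximalIdeal R ≤ q := by
      rw [hm, Ideal.span_le]
      rintro _ (rfl | rfl)
      exacts [hzq, hwq]
    have hqm : q = maximalIdeal R := le_antisymm (le_maximalIdeal hqp.ne_top) hle
    rw [Ideal.radical_eq_sInf]
    refine le_sInf fun p hp => ?_
    rw [← hqm]
    refine hq.2 ⟨hp.2, hp.1⟩ ?_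
    exact hqm ▸ le_maximalIdeal hp.2.ne_top
  have hle : q ≤ Ideal.span {z} := by
    refine Submodule.le_of_le_smul_of_le_jacobson_bot (I := maximalIdeal R)
      (IsNoetherian.noetherian q) (maximalIdeal_le_jacobson ⊥) fun e he => ?_
    have hem : e ∈ Ideal.span {z, w} := hm ▸ le_maximalIdeal hqp.ne_top he
    obtain ⟨f, g, rfl⟩ := Ideal.mem_span_pair.1 hem
    have hgw : g * w ∈ q := by
      simpa using q.sub_mem he (q.mul_mem_left f hzq)
    have hg : g ∈ q := (hqp.mem_or_mem hgw).resolve_right hwq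
    refine Submodule.add_mem_sup (Ideal.mul_mem_left _ _ (Ideal.mem_span_singleton_self z)) ?_
    rw [mul_comm, smul_eq_mul]
    exact Ideal.mul_mem_mul (hm ▸ Ideal.subset_span (by simp)) hg
  rwa [← le_antisymm hle hq.1.2]

theorem not_dvd_of_maximalIdeal_eq (hdim : ringKrullDim R = 2) {z w : R}
    (hm : maximalIdeal R = Ideal.span {z, w}) : ¬ z ∣ w := by
  intro h
  refine not_maximalIdeal_le_radical_span_singleton hdim
    (hm ▸ Ideal.subset_span (by simp) : z ∈ maximalIdeal R) (le_trans ?_ Ideal.le_radical)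
  rw [hm, Ideal.span_le]
  rintro _ (rfl | rfl)
  exacts [Ideal.mem_span_singleton_self _, Ideal.mem_span_singleton.2 h]

theorem isDomain_of_maximalIdeal_eq_span_pair (hdim : ringKrullDim R = 2) {x y : R}
    (hm : maximalIdeal R = Ideal.span {x, y}) : IsDomain R := by
  have hpair (k : ℕ) : maximalIdeal R = Ideal.span {x + y ^ (k + 1), y} := by
    rw [hm]
    apply le_antisymm <;> rw [Ideal.span_le] <;> rintro _ (rfl | rfl)
    · exact Ideal.mem_span_pair.2 ⟨1, -y ^ k, by ring⟩
    · exact Ideal.subset_span (by simp)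
    · exact Ideal.mem_span_pair.2 ⟨1, y ^ k, by ring⟩
    · exact Ideal.subset_span (by simp)
  have hym : y ∈ maximalIdeal R := hm ▸ Ideal.subset_span (by simp)
  have hlt {k l : ℕ} (hkl : k < l) :
      Ideal.span {x + y ^ (k + 1)} ≠ Ideal.span {x + y ^ (l + 1)} := by
    intro h
    obtain ⟨d, rfl⟩ := Nat.exists_eq_add_of_lt hkl
    have h1 : x + y ^ (k + 1) ∣ x + y ^ (k + d + 1 + 1) :=
      Ideal.mem_span_singleton.1 (h ▸ Ideal.mem_span_singleton_self _)
    have h2 : x + y ^ (k + 1) ∣ y ^ (k + 1) * (1 - y ^ (d + 1)) := by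
      have := dvd_sub dvd_rfl h1
      convert this using 1
      ring
    have hu : IsUnit (1 - y ^ (d + 1)) := by
      have : y ^ (d + 1) ∈ maximalIdeal R := Ideal.pow_mem_of_mem _ hym _ (by omega)
      by_contra hnu
      have h1m := (maximalIdeal R).add_mem ((mem_maximalIdeal _).2 hnu) this
      rw [sub_add_cancel] at h1m
      exact (Ideal.ne_top_iff_one _).1 (maximalIdeal.isMaximal R).ne_top h1m
    have h3 : y ^ (k + 1) ∈ Ideal.span {x + y ^ (k + 1)} :=
      Ideal.mem_span_singleton.2 (hu.dvd_mul_right.1 h2)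
    have h4 := (isPrime_span_singleton_of_maximalIdeal_eq hdim (hpair k)).mem_of_pow_mem _ h3
    exact not_dvd_of_maximalIdeal_eq hdim (hpair k) (Ideal.mem_span_singleton.1 h4)
  have hinj : Function.Injective fun k : ℕ => Ideal.span {x + y ^ (k + 1)} := by
    intro k l h
    rcases lt_trichotomy k l with hkl | hkl | hkl
    exacts [absurd h (hlt hkl), hkl, absurd h.symm (hlt hkl)]
  obtain ⟨k, hk⟩ : ∃ k : ℕ, Ideal.span {x + y ^ (k + 1)} ∉ minimalPrimes R := by
    by_contra! h
    exact Set.infinite_of_injective_forall_mem hinj h (minimalPrimes.finite_of_isNoetherianRing R)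
  have hzp := isPrime_span_singleton_of_maximalIdeal_eq hdim (hpair k)
  have hzm : x + y ^ (k + 1) ∈ maximalIdeal R := (hpair k) ▸ Ideal.subset_span (by simp)
  set z := x + y ^ (k + 1)
  obtain ⟨q, hq, hqz⟩ := Ideal.exists_minimalPrimes_le (bot_le : ⊥ ≤ Ideal.span {z})
  have hqp : q.IsPrime := hq.1.1
  have hzq : z ∉ q := fun h =>
    hk (le_antisymm hqz ((Ideal.span_singleton_le_iff_mem _).2 h) ▸ hq)
  have hbot : q = ⊥ := by
    refine Submodule.eq_bot_of_le_smul_of_le_jacobson_bot (maximalIdeal R) q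
      (IsNoetherian.noetherian q) (fun e he => ?_) (maximalIdeal_le_jacobson ⊥)
    obtain ⟨f, rfl⟩ := Ideal.mem_span_singleton.1 (hqz he)
    exact Ideal.mul_mem_mul hzm ((hqp.mem_or_mem he).resolve_left hzq)
  subst hbot
  exact (IsDomain.of_bot_isPrime R)

end RegularLocal

section Colon
variable {R : Type*} [CommRing R] [IsDomain R]

theorem dvd_of_forall_mul_pow {x y : R} (hx : Prime x) (hxy : ¬ x ∣ y) {a : R} (ha : a ≠ 0)
    (N : ℕ) {B : R} (h : ∀ z ∈ Ideal.span {x, y} ^ N, a ∣ z * B) : a ∣ B := by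
  induction N generalizing B with
  | zero => simpa using h 1 (by simp)
  | succ N ih =>
    refine ih fun z hz => ?_
    obtain ⟨f, hf⟩ := h (x * z) (by
      rw [pow_succ']; exact Ideal.mul_mem_mul (Ideal.subset_span (by simp)) hz)
    obtain ⟨g, hg⟩ := h (y * z) (by
      rw [pow_succ']; exact Ideal.mul_mem_mul (Ideal.subset_span (by simp)) hz)
    have h1 : y * f = x * g := mul_left_cancel₀ ha (by linear_combination x * hg - y * hf)
    obtain ⟨e, rfl⟩ := (hx.dvd_or_dvd (⟨g, h1⟩ : x ∣ y * f)).resolve_left hxy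
    exact ⟨e, mul_left_cancel₀ hx.ne_zero (by linear_combination hf)⟩

theorem dvd_of_mul_eq_mul_of_pow_le {x y : R} (hx : Prime x) (hxy : ¬ x ∣ y) {a b A B : R}
    (ha : a ≠ 0) {N : ℕ} (hN : Ideal.span {x, y} ^ N ≤ Ideal.span {a, b})
    (h : A * a = B * b) : a ∣ B := by
  refine dvd_of_forall_mul_pow hx hxy ha N fun z hz => ?_
  obtain ⟨p, q, rfl⟩ := Ideal.mem_span_pair.1 (hN hz)
  exact ⟨p * B + q * A, by linear_combination -q * h⟩

/-- The determinant of a matrix expressing `a, b` through `x ^ (s + 1), y` is not annihilated by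
`x ^ s` modulo `(a, b)`. -/
theorem pow_mul_det_notMem_span_pair {x y : R} (hx : Prime x) (hy : Prime y) (hxy : ¬ x ∣ y)
    (hyx : ¬ y ∣ x) (hu : ∀ t, IsUnit (1 - x * t)) {a b p q p' q' : R} {N s : ℕ}
    (hN : Ideal.span {x, y} ^ N ≤ Ideal.span {a, b}) (ha0 : a ≠ 0)
    (ha : a = p * x ^ (s + 1) + q * y) (hb : b = p' * x ^ (s + 1) + q' * y) :
    x ^ s * (p * q' - q * p') ∉ Ideal.span {a, b} := by
  intro hmem
  obtain ⟨α, β, hαβ⟩ := Ideal.mem_span_pair.1 hmem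
  have h1 : (x ^ s * q' - x ^ (s + 1) * α) * a = (x ^ s * q + x ^ (s + 1) * β) * b := by
    subst ha hb
    linear_combination (-x ^ (s + 1)) * hαβ
  obtain ⟨w, hw⟩ := dvd_of_mul_eq_mul_of_pow_le hx hxy ha0 hN h1
  have hw' : x ^ s * q' - x ^ (s + 1) * α = b * w :=
    mul_right_cancel₀ ha0 (by linear_combination h1 + b * hw)
  have hJ : ∀ z ∈ Ideal.span {a, b}, x ^ (s + 1) ∣ z * (x ^ s - y * w) := by
    intro z hz
    obtain ⟨e, f, rfl⟩ := Ideal.mem_span_pair.1 hz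
    have hq : x ^ (s + 1) ∣ q * (x ^ s - y * w) :=
      ⟨p * w - β, by rw [ha] at hw; linear_combination hw⟩
    have hq' : x ^ (s + 1) ∣ q' * (x ^ s - y * w) :=
      ⟨p' * w + α, by rw [hb] at hw'; linear_combination hw'⟩
    have : (e * a + f * b) * (x ^ s - y * w) =
        x ^ (s + 1) * ((e * p + f * p') * (x ^ s - y * w)) +
        (e * y * (q * (x ^ s - y * w)) + f * y * (q' * (x ^ s - y * w))) := by
      subst ha hb; ring
    rw [this]
    exact dvd_add (dvd_mul_right _ _)
      (dvd_add (Dvd.dvd.mul_left hq _) (Dvd.dvd.mul_left hq' _))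
  have hyN : x ^ (s + 1) ∣ y ^ N * (x ^ s - y * w) :=
    hJ _ (hN (Ideal.pow_mem_pow (Ideal.subset_span (by simp)) N))
  obtain ⟨c, hc⟩ := hx.pow_dvd_of_dvd_mul_left (s + 1)
    (fun h => hxy (hx.dvd_of_dvd_pow h)) hyN
  have hys : y ∣ x ^ s * (1 - x * c) := ⟨w, by linear_combination hc⟩
  exact hyx (hy.dvd_of_dvd_pow ((hu c).dvd_mul_right.1 hys))

end Colon

section Staircase

variable {R : Type*} [CommRing R] {x y : R}

section Relations

variable {M : Type*} [AddCommGroup M] [Module R M] {c : ℕ → M}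

theorem pow_smul_eq_of_staircase (hstep : ∀ k, y • c (k + 1) = x • c k) (q k : ℕ) :
    y ^ q • c (k + q) = x ^ q • c k := by
  induction q generalizing k with
  | zero => simp
  | succ q ih =>
    rw [pow_succ, mul_smul, ← add_assoc, hstep, smul_comm, ih, ← mul_smul, ← pow_succ']

theorem pow_smul_eq_zero_of_lt_of_staircase (h0 : y • c 0 = 0)
    (hstep : ∀ k, y • c (k + 1) = x • c k) {q k : ℕ} (hk : k < q) : y ^ q • c k = 0 := by
  obtain ⟨d, rfl⟩ := Nat.exists_eq_add_of_lt hk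
  have := pow_smul_eq_of_staircase hstep k 0
  rw [zero_add] at this
  rw [show k + d + 1 = d + 1 + k by ring, pow_add, mul_smul, this, pow_succ, mul_smul,
    smul_comm y, h0, smul_zero, smul_zero]

theorem pow_smul_eq_zero_of_le_of_staircase {s : ℕ} (hs : ∀ k, s ≤ k → c k = 0)
    (hstep : ∀ k, y • c (k + 1) = x • c k) {p k : ℕ} (hk : s ≤ k + p) : x ^ p • c k = 0 := by
  rw [← pow_smul_eq_of_staircase hstep, hs _ hk, smul_zero]

theorem pow_mul_pow_smul_of_staircase {s : ℕ} (hs : ∀ k, s + 1 ≤ k → c k = 0) (h0 : y • c 0 = 0)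
    (hstep : ∀ k, y • c (k + 1) = x • c k) {p q : ℕ} (hpq : p + q = s) (k : ℕ) :
    (x ^ p * y ^ q) • c k = if k = q then x ^ s • c 0 else 0 := by
  rcases lt_or_ge k q with hk | hk
  · rw [if_neg hk.ne, mul_smul, pow_smul_eq_zero_of_lt_of_staircase h0 hstep hk, smul_zero]
  · obtain ⟨d, rfl⟩ := Nat.exists_eq_add_of_le' hk
    rw [mul_smul, pow_smul_eq_of_staircase hstep, ← mul_smul, ← pow_add, hpq]
    rcases Nat.eq_zero_or_pos d with rfl | hd
    · simp
    · rw [if_neg (by omega), pow_smul_eq_zero_of_le_of_staircase hs hstep (by omega)]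

theorem pow_mul_pow_smul_smul_of_staircase {s : ℕ} (hs : ∀ k, s + 1 ≤ k → c k = 0)
    (h0 : y • c 0 = 0) (hstep : ∀ k, y • c (k + 1) = x • c k) {p q : ℕ} (hpq : p + q = s)
    (k : ℕ) : (x ^ p * y ^ q) • x • c k = 0 := by
  rw [smul_comm, pow_mul_pow_smul_of_staircase hs h0 hstep hpq]
  split_ifs
  · rw [← mul_smul, ← pow_succ', pow_smul_eq_zero_of_le_of_staircase hs hstep (by omega)]
  · rw [smul_zero]

end Relations

theorem length_eq_of_linearIndependent_mod_maximalIdeal [IsLocalRing R] {s : ℕ} {M : Type*}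
    [AddCommGroup M] [Module R M] (c : Fin s → M) (hspan : ⊤ ≤ Submodule.span R (Set.range c))
    (hc : ∀ t : Fin s → R, ∑ k, t k • c k = 0 ↔ ∀ k, t k ∈ maximalIdeal R) :
    Module.length R M = s := by
  let f : (Fin s → R) →ₗ[R] M := Fintype.linearCombination R c
  let g : (Fin s → R) →ₗ[R] (Fin s → ResidueField R) :=
    LinearMap.pi fun k => (Algebra.linearMap R (ResidueField R)).comp (LinearMap.proj k)
  have hf : Function.Surjective f := by
    rw [← LinearMap.range_eq_top, Fintype.range_linearCombination]
    exact top_le_iff.1 hspan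
  have hg : Function.Surjective g := by
    intro v
    choose u hu using fun k => residue_surjective (R := R) (v k)
    exact ⟨u, funext fun k => hu k⟩
  have hker : LinearMap.ker f = LinearMap.ker g := by
    ext t
    have hgt : g t = 0 ↔ ∀ k, t k ∈ maximalIdeal R := by
      rw [funext_iff]
      exact forall_congr' fun k => residue_eq_zero_iff (t k)
    rw [LinearMap.mem_ker, LinearMap.mem_ker, hgt, ← hc t]
    rfl
  have hlen : Module.length R (ResidueField R) = 1 := by
    have : IsSimpleModule R (ResidueField R) :=
      isSimpleModule_iff_quot_maximal.2 ⟨maximalIdeal R, inferInstance, ⟨LinearEquiv.refl _ _⟩⟩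
    exact Module.length_eq_one R _
  rw [((f.quotKerEquivOfSurjective hf).symm ≪≫ₗ (Submodule.quotEquivOfEq _ _ hker) ≪≫ₗ
    (g.quotKerEquivOfSurjective hg)).length_eq, Module.length_pi, hlen]
  simp

theorem length_eq_of_staircase [IsLocalRing R] (hm : maximalIdeal R = Ideal.span {x, y}) (s : ℕ)
    {M : Type*} [AddCommGroup M] [Module R M] (c : ℕ → M)
    (hspan : Submodule.span R (Set.range c) = ⊤) (hs : ∀ k, s ≤ k → c k = 0)
    (h0 : y • c 0 = 0) (hstep : ∀ k, y • c (k + 1) = x • c k)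
    (hne : 0 < s → x ^ (s - 1) • c 0 ≠ 0) :
    Module.length R M = ((s + 1) * s / 2 : ℕ) := by
  induction s generalizing M with
  | zero =>
    have : Subsingleton M := by
      rw [← Submodule.subsingleton_iff R, ← subsingleton_iff_bot_eq_top, ← hspan, eq_comm,
        Submodule.span_eq_bot]
      rintro _ ⟨k, rfl⟩
      exact hs k (Nat.zero_le k)
    simp
  | succ s ih =>
    have hxm : x ∈ maximalIdeal R := hm ▸ Ideal.subset_span (by simp)
    have hym : y ∈ maximalIdeal R := hm ▸ Ideal.subset_span (by simp)
    let N : Submodule R M := Submodule.span R (Set.range fun k => x • c k)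
    have hxN (k : ℕ) : x • c k ∈ N := Submodule.subset_span ⟨k, rfl⟩
    have hyN (k : ℕ) : y • c k ∈ N := by
      cases k with
      | zero => rw [h0]; exact N.zero_mem
      | succ k => rw [hstep]; exact hxN k
    have hmN {t : R} (ht : t ∈ maximalIdeal R) (k : ℕ) : t • c k ∈ N := by
      rw [hm] at ht
      obtain ⟨e, f, rfl⟩ := Ideal.mem_span_pair.1 ht
      rw [add_smul, mul_smul, mul_smul]
      exact N.add_mem (N.smul_mem _ (hxN k)) (N.smul_mem _ (hyN k))
    have hN : Module.length R N = ((s + 1) * s / 2 : ℕ) := by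
      refine ih (fun k => ⟨x • c k, hxN k⟩) ?_ (fun k hk => ?_) ?_ (fun k => ?_) (fun hs0 => ?_)
      · apply Submodule.map_injective_of_injective N.injective_subtype
        rw [Submodule.map_span, ← Set.range_comp, Submodule.map_subtype_top]
        rfl
      · ext
        simpa [hs (k + 1) (by omega)] using (hstep k).symm
      · ext
        simp [smul_comm y x, h0]
      · ext
        simp [smul_comm y x, hstep]
      · intro h
        refine hne (by omega) ?_
        have h' : x ^ (s - 1) • x • c 0 = 0 := congrArg Subtype.val h
        rwa [← mul_smul, ← pow_succ, Nat.sub_add_cancel hs0] at h'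
    have hQ : Module.length R (M ⧸ N) = (s + 1 : ℕ) := by
      refine length_eq_of_linearIndependent_mod_maximalIdeal (fun k : Fin (s + 1) => N.mkQ (c k))
        ?_ fun t => ?_
      · rw [← LinearMap.range_eq_top.2 N.mkQ_surjective, ← Submodule.map_top, ← hspan,
          Submodule.map_span, Submodule.span_le]
        rintro _ ⟨_, ⟨k, rfl⟩, rfl⟩
        rcases lt_or_ge k (s + 1) with hk | hk
        · exact Submodule.subset_span ⟨⟨k, hk⟩, rfl⟩
        · simp [hs k hk]
      · have hmk : ∑ k : Fin (s + 1), t k • N.mkQ (c k) = N.mkQ (∑ k : Fin (s + 1), t k • c k) := by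
          simp
        rw [hmk, Submodule.mkQ_apply, Submodule.Quotient.mk_eq_zero]
        refine ⟨fun h q => ?_, fun h => N.sum_mem fun k _ => hmN (h k) k⟩
        have hpq : (s - q) + (q : ℕ) = s := by omega
        have hkill : (x ^ (s - q) * y ^ (q : ℕ)) • ∑ k : Fin (s + 1), t k • c k = 0 := by
          have hle : N ≤ LinearMap.ker (LinearMap.lsmul R M (x ^ (s - q) * y ^ (q : ℕ))) := by
            rw [Submodule.span_le]
            rintro _ ⟨k, rfl⟩
            exact pow_mul_pow_smul_smul_of_staircase hs h0 hstep hpq k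
          exact hle h
        rw [Finset.smul_sum] at hkill
        simp_rw [smul_comm _ (t _), pow_mul_pow_smul_of_staircase hs h0 hstep hpq,
          Fin.val_inj, smul_ite, smul_zero] at hkill
        rw [Finset.sum_ite_eq' Finset.univ q, if_pos (Finset.mem_univ q)] at hkill
        by_contra hnu
        have hu : IsUnit (t q) := not_not.1 hnu
        exact hne (Nat.succ_pos s) (hu.smul_eq_zero.1 hkill)
    rw [Module.length_eq_add_of_exact N.subtype N.mkQ N.injective_subtype N.mkQ_surjective
      (LinearMap.exact_subtype_mkQ N), hN, hQ, ← Nat.cast_add]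
    congr 1
    rw [show (s + 1 + 1) * (s + 1) = (s + 1) * s + (s + 1) * 2 by ring,
      Nat.add_mul_div_right _ _ two_pos]

end Staircase

section Minors

variable {R : Type*} [CommRing R]

theorem sum_mul_signedMinor_eq_zero {r : ℕ} (A : Matrix (Fin r) (Fin (r + 1)) R) (i : Fin r) :
    ∑ j, A i j * signedMinor A j = 0 := by
  let B : Matrix (Fin (r + 1)) (Fin (r + 1)) R := Matrix.of (Fin.cons (A i) A)
  have hB : B.det = 0 :=
    Matrix.det_zero_of_row_eq (Fin.succ_ne_zero i).symm (funext fun _ => rfl)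
  rw [Matrix.det_succ_row_zero] at hB
  rw [← hB]
  refine Finset.sum_congr rfl fun j _ => ?_
  have : B.submatrix Fin.succ j.succAbove = A.submatrix id j.succAbove := rfl
  have hBA : B 0 j = A i j := rfl
  rw [this, signedMinor, hBA]
  ring

theorem colDet_comp_mem_span_signedMinor {r : ℕ} (w : Fin (r + 1) → Fin r → R)
    (f : Fin r → Fin (r + 1)) :
    colDet (fun j => w (f j)) ∈
      Ideal.span (Set.range (signedMinor (Matrix.of fun i j => w j i))) := by
  by_cases hf : Function.Injective f
  · obtain ⟨j, hj⟩ : ∃ j, ∀ i, f i ≠ j := by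
      by_contra! h
      simpa using Fintype.card_le_of_surjective f h
    choose σ hσ using fun i => Fin.exists_succAbove_eq (hj i)
    have hσi : Function.Injective σ := fun i k h => hf (by rw [← hσ, ← hσ, h])
    let e : Equiv.Perm (Fin r) := Equiv.ofBijective σ (Finite.injective_iff_bijective.1 hσi)
    have hdet : colDet (fun j => w (f j)) = (Equiv.Perm.sign e : ℤ) * (-1) ^ (j : ℕ) *
        signedMinor (Matrix.of fun i j => w j i) j := by
      have : (Matrix.of fun i k => w (f k) i) =
          ((Matrix.of fun i j => w j i).submatrix id j.succAbove).submatrix id e := by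
        ext i k
        simp [e, hσ]
      rw [colDet, this, Matrix.det_permute', signedMinor, mul_assoc, ← mul_assoc _ _ (Matrix.det _),
        ← mul_pow]
      simp
    rw [hdet]
    exact Ideal.mul_mem_left _ _ (Ideal.subset_span ⟨j, rfl⟩)
  · simp only [Function.Injective, not_forall] at hf
    obtain ⟨i, k, hik, hne⟩ := hf
    rw [colDet, Matrix.det_zero_of_column_eq hne (by simp [hik])]
    exact Ideal.zero_mem _

theorem maxMinors_span_range {r : ℕ} (w : Fin (r + 1) → Fin r → R) :
    maxMinors (Submodule.span R (Set.range w)) =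
      Ideal.span (Set.range (signedMinor (Matrix.of fun i j => w j i))) := by
  apply le_antisymm
  · rw [maxMinors, Ideal.span_le]
    rintro _ ⟨v, hv, rfl⟩
    choose T hT using fun j => (Submodule.mem_span_range_iff_exists_fun R).1 (hv j)
    have hdet : colDet v = ∑ f : Fin r → Fin (r + 1),
        (∏ j, T j (f j)) * colDet (fun j => w (f j)) := by
      have hrow (u : Fin r → Fin r → R) : colDet u =
          (Matrix.detRowAlternating (R := R) (n := Fin r)).toMultilinearMap u :=
        Matrix.det_transpose (Matrix.of u)
      simp_rw [hrow, ← smul_eq_mul, ← MultilinearMap.map_smul_univ]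
      rw [← MultilinearMap.map_sum (g := fun j l => T j l • w l)]
      simp_rw [hT]
    rw [hdet]
    exact Ideal.sum_mem _ fun f _ =>
      Ideal.mul_mem_left _ _ (colDet_comp_mem_span_signedMinor w f)
  · rw [Ideal.span_le]
    rintro _ ⟨j, rfl⟩
    exact Ideal.mul_mem_left _ _ (Ideal.subset_span
      ⟨fun k => w (j.succAbove k), fun k => Submodule.subset_span ⟨_, rfl⟩, rfl⟩)

theorem stdRelCol_eq_single_sub_single {s : ℕ} (x y : R) (k : Fin s) :
    stdRelCol (s + 1) x y k =
      y • Pi.single k.castSucc (1 : R) - x • Pi.single k.succ (1 : R) := by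
  ext i
  simp only [stdRelCol, Pi.sub_apply, Pi.smul_apply, Pi.single_apply, Fin.ext_iff, smul_eq_mul,
    Fin.val_castSucc, Fin.val_succ]
  split_ifs <;> first | omega | simp

theorem det_cons_stdRelCol [IsDomain R] {s : ℕ} {x y : R} (hx : x ≠ 0) (v : Fin (s + 1) → R) :
    Matrix.det (Matrix.of (Fin.cons v fun k : Fin s => stdRelCol (s + 1) x y k)) =
      (-1) ^ s * ∑ i, v i * x ^ (s + 1 - 1 - (i : ℕ)) * y ^ (i : ℕ) := by
  let L : (Fin (s + 1) → R) →ₗ[R] R :=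
    (Matrix.detRowAlternating (R := R) (n := Fin (s + 1))).toMultilinearMap.toLinearMap
      (Fin.cons 0 fun k : Fin s => stdRelCol (s + 1) x y k) 0
  have hL (u : Fin (s + 1) → R) :
      L u = Matrix.det (Matrix.of (Fin.cons u fun k : Fin s => stdRelCol (s + 1) x y k)) := by
    simp only [L, MultilinearMap.toLinearMap_apply, Fin.update_cons_zero]
    rfl
  have hrel (k : Fin s) : L (stdRelCol (s + 1) x y k) = 0 := by
    rw [hL]
    exact Matrix.det_zero_of_row_eq (Fin.succ_ne_zero k).symm (by ext; simp)
  have hsingle (i : Fin (s + 1)) :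
      L (Pi.single i 1) = (-1) ^ s * (x ^ (s + 1 - 1 - (i : ℕ)) * y ^ (i : ℕ)) := by
    induction i using Fin.induction with
    | zero =>
      rw [hL, Matrix.det_of_isLowerTriangular, Fin.prod_univ_succ]
      · simp [stdRelCol, neg_pow x]
      · intro i j hij
        have hij' : (i : ℕ) < j := hij
        cases i using Fin.cases with
        | zero => exact Pi.single_eq_of_ne (Fin.ne_of_gt hij') 1
        | succ i =>
          rw [Fin.val_succ] at hij'
          change stdRelCol (s + 1) x y i j = 0
          rw [stdRelCol, if_neg (by omega), if_neg (by omega)]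
    | succ k ih =>
      have h := hrel k
      rw [stdRelCol_eq_single_sub_single, map_sub, map_smul, map_smul, ih, sub_eq_zero,
        smul_eq_mul, smul_eq_mul] at h
      apply mul_left_cancel₀ hx
      rw [← h]
      have : s + 1 - 1 - (k.castSucc : ℕ) = s + 1 - 1 - (k.succ : ℕ) + 1 := by
        simp only [Fin.val_castSucc, Fin.val_succ]; omega
      rw [this]
      simp only [Fin.val_castSucc, Fin.val_succ]
      ring
  rw [← hL, L.pi_apply_eq_sum_univ v, Finset.mul_sum]
  refine Finset.sum_congr rfl fun i _ => ?_
  have : (fun j => if i = j then (1 : R) else 0) = Pi.single i 1 := by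
    ext j; simp [Pi.single_apply, eq_comm]
  rw [this, hsingle, smul_eq_mul]
  ring

/-- The columns generating `MrSpan`, for two coefficient columns. -/
def MrColumns {s : ℕ} (x y : R) (av bv : Fin (s + 1) → R) : Fin (s + 2) → Fin (s + 1) → R :=
  Fin.cons av (Fin.cons bv fun k : Fin s => stdRelCol (s + 1) x y k)

theorem MrSpan_eq_span_range_MrColumns {s : ℕ} (x y : R) (av bv : Fin (s + 1) → R) :
    MrSpan (s + 1) x y ![av, bv] = Submodule.span R (Set.range (MrColumns x y av bv)) := by
  rw [MrSpan, MrColumns, Fin.range_cons, Fin.range_cons]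
  congr 1
  have hrel : { v | ∃ k, k < s + 1 - 1 ∧ v = stdRelCol (s + 1) x y k } =
      Set.range fun k : Fin s => stdRelCol (s + 1) x y k := by
    ext v
    simp [Fin.exists_iff, eq_comm (a := v)]
  rw [hrel, Matrix.range_cons, Matrix.range_cons, Matrix.range_empty, Set.union_empty,
    Set.union_assoc, Set.insert_eq, Set.insert_eq]

/-- The signed maximal minors of the matrix with columns `MrColumns`. -/
def MrMinor {s : ℕ} (x y : R) (av bv : Fin (s + 1) → R) : Fin (s + 2) → R :=
  signedMinor (Matrix.of fun i j => MrColumns x y av bv j i)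

theorem MrMinor_zero [IsDomain R] {s : ℕ} {x y : R} (hx : x ≠ 0) {av bv : Fin (s + 1) → R} {b : R}
    (hb : Expresses (s + 1) x y bv b) : MrMinor x y av bv 0 = (-1) ^ s * b := by
  rw [hb, ← det_cons_stdRelCol hx bv, ← Matrix.det_transpose, MrMinor, signedMinor]
  simp only [Fin.val_zero, pow_zero, one_mul]
  rfl

theorem MrMinor_one [IsDomain R] {s : ℕ} {x y : R} (hx : x ≠ 0) {av bv : Fin (s + 1) → R} {a : R}
    (ha : Expresses (s + 1) x y av a) : MrMinor x y av bv 1 = -((-1) ^ s * a) := by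
  rw [ha, ← det_cons_stdRelCol hx av, ← Matrix.det_transpose, MrMinor, signedMinor]
  simp only [Fin.val_one, pow_one, neg_one_mul]
  congr 2
  ext i j
  cases j using Fin.cases <;> rfl

/-- The signed maximal minor omitting the `k`-th Koszul relation column, and `0` if there is no
such column. -/
def MrRelMinor {s : ℕ} (x y : R) (av bv : Fin (s + 1) → R) (k : ℕ) : R :=
  if h : k < s then MrMinor x y av bv (Fin.succ (Fin.succ ⟨k, h⟩)) else 0

theorem sum_stdRelCol_mul_MrMinor {s : ℕ} (x y : R) (av bv : Fin (s + 1) → R) (i : Fin (s + 1)) :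
    av i * MrMinor x y av bv 0 + (bv i * MrMinor x y av bv 1 +
      ∑ k : Fin s, stdRelCol (s + 1) x y k i * MrRelMinor x y av bv k) = 0 := by
  rw [← sum_mul_signedMinor_eq_zero (Matrix.of fun i j => MrColumns x y av bv j i) i,
    Fin.sum_univ_succ, Fin.sum_univ_succ]
  congr 2
  refine Finset.sum_congr rfl fun k _ => ?_
  rw [MrRelMinor, dif_pos k.2]
  rfl

theorem MrRelMinor_eq_zero {s : ℕ} (x y : R) (av bv : Fin (s + 1) → R) {k : ℕ} (hk : s ≤ k) :
    MrRelMinor x y av bv k = 0 := dif_neg hk.not_gt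

theorem MrRelMinor_zero_relation {s : ℕ} (hs : 0 < s) (x y : R) (av bv : Fin (s + 1) → R) :
    av 0 * MrMinor x y av bv 0 + (bv 0 * MrMinor x y av bv 1 +
      y * MrRelMinor x y av bv 0) = 0 := by
  rw [← sum_stdRelCol_mul_MrMinor x y av bv 0]
  congr 2
  rw [Finset.sum_eq_single ⟨0, hs⟩]
  · simp [stdRelCol]
  · intro k _ hk
    have : (k : ℕ) ≠ 0 := fun h => hk (Fin.ext h)
    simp [stdRelCol, this.symm]
  · simp

theorem MrRelMinor_succ_relation {s : ℕ} (x y : R) (av bv : Fin (s + 1) → R) {k : ℕ} (hk : k < s) :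
    av (Fin.succ ⟨k, hk⟩) * MrMinor x y av bv 0 + (bv (Fin.succ ⟨k, hk⟩) * MrMinor x y av bv 1 +
      (y * MrRelMinor x y av bv (k + 1) - x * MrRelMinor x y av bv k)) = 0 := by
  rw [← sum_stdRelCol_mul_MrMinor x y av bv (Fin.succ ⟨k, hk⟩)]
  congr 2
  simp_rw [stdRelCol_eq_single_sub_single, Pi.sub_apply, Pi.smul_apply, smul_eq_mul, sub_mul,
    Finset.sum_sub_distrib]
  congr 1
  · by_cases hk' : k + 1 < s
    · rw [Finset.sum_eq_single ⟨k + 1, hk'⟩]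
      · simp
      · intro j _ hj
        have : k + 1 ≠ j := fun h => hj (Fin.ext h.symm)
        simp [Fin.ext_iff, this]
      · simp
    · rw [MrRelMinor_eq_zero _ _ _ _ (not_lt.1 hk'), mul_zero, eq_comm]
      refine Finset.sum_eq_zero fun j _ => ?_
      have : k + 1 ≠ j := by omega
      simp [Fin.ext_iff, this]
  · rw [Finset.sum_eq_single ⟨k, hk⟩]
    · simp
    · intro j _ hj
      have : k ≠ j := fun h => hj (Fin.ext h.symm)
      simp [Fin.ext_iff, this]
    · simp

theorem Expresses.exists_eq_mul_pow_add_mul {s : ℕ} {x y : R} {c : Fin (s + 1) → R} {a : R}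
    (h : Expresses (s + 1) x y c a) : ∃ q, a = c 0 * x ^ s + q * y := by
  refine ⟨∑ i : Fin s, c i.succ * x ^ (s - (i + 1)) * y ^ (i : ℕ), ?_⟩
  rw [h, Fin.sum_univ_succ, Finset.sum_mul]
  congr 1
  · simp
  · exact Finset.sum_congr rfl fun i _ => by simp [pow_succ, mul_assoc]

end Minors

/-- for an `𝔪`-primary ideal `(a, b)` of order `n ≥ r ≥ 2` and the parameter
module `P` built from coefficient columns of `a, b` and the Koszul relation columns,
`(a, b) ⊆ I(P)` and `λ(I(P)/(a, b)) = r(r−1)/2`. -/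
theorem statement7 (R : Type*) [CommRing R] [IsLocalRing R]
    (hreg : IsTwoDimRegularLocal R) [Infinite (IsLocalRing.ResidueField R)]
    (a b : R) (hab : IsMPrimary (Ideal.span {a, b}))
    (n r : ℕ) (hord : ordEQ (Ideal.span {a, b}) n) (hr : 2 ≤ r) (hrn : r ≤ n)
    (x y : R) (hm : maximalIdeal R = Ideal.span {x, y})
    (av bv : Fin r → R) (ha : Expresses r x y av a) (hb : Expresses r x y bv b) :
    Ideal.span {a, b} ≤ maxMinors (MrSpan r x y ![av, bv]) ∧
    modLength R (↥(maxMinors (MrSpan r x y ![av, bv])) ⧸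
        Submodule.comap (maxMinors (MrSpan r x y ![av, bv])).subtype
          (Ideal.span {a, b} : Submodule R R)) =
      ((r * (r - 1) / 2 : ℕ) : WithBot ℕ∞) := by
  obtain ⟨hnoeth, hdim, -⟩ := hreg
  have := hnoeth
  have hdom : IsDomain R := isDomain_of_maximalIdeal_eq_span_pair hdim hm
  have hm' : maximalIdeal R = Ideal.span {y, x} := by rw [hm, Set.pair_comm]
  have hxy : ¬ x ∣ y := not_dvd_of_maximalIdeal_eq hdim hm
  have hyx : ¬ y ∣ x := not_dvd_of_maximalIdeal_eq hdim hm'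
  have hx0 : x ≠ 0 := fun h => hyx (h ▸ dvd_zero y)
  have hy0 : y ≠ 0 := fun h => hxy (h ▸ dvd_zero x)
  have hxp : Prime x := (Ideal.span_singleton_prime hx0).1
    (isPrime_span_singleton_of_maximalIdeal_eq hdim hm)
  have hyp : Prime y := (Ideal.span_singleton_prime hy0).1
    (isPrime_span_singleton_of_maximalIdeal_eq hdim hm')
  have hxm : x ∈ maximalIdeal R := hm ▸ Ideal.subset_span (by simp)
  have hunit (t : R) : IsUnit (1 - x * t) :=
    isUnit_one_sub_self_of_mem_nonunits _ (Ideal.mul_mem_right t _ hxm)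
  have ha0 : a ≠ 0 := by
    rintro rfl
    have hspan : Ideal.span {(0 : R), b} = Ideal.span {b} := Ideal.span_insert_zero
    rw [IsMPrimary, hspan] at hab
    exact not_maximalIdeal_le_radical_span_singleton hdim
      (hab ▸ Ideal.le_radical (Ideal.mem_span_singleton_self b)) hab.ge
  obtain ⟨N, hN⟩ := (Ideal.span {a, b}).exists_radical_pow_le_of_fg (IsNoetherian.noetherian _)
  rw [hab, hm] at hN
  obtain ⟨t, rfl⟩ := Nat.exists_eq_add_of_le' hr
  have hI : maxMinors (MrSpan (t + 2) x y ![av, bv]) =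
      Ideal.span (Set.range (MrMinor x y av bv)) := by
    rw [MrSpan_eq_span_range_MrColumns, maxMinors_span_range]
    rfl
  rw [hI]
  have hμ0 : MrMinor x y av bv 0 = (-1) ^ (t + 1) * b := MrMinor_zero hx0 hb
  have hμ1 : MrMinor x y av bv 1 = -((-1) ^ (t + 1) * a) := MrMinor_one hx0 ha
  have hsq : ((-1 : R) ^ (t + 1)) * (-1) ^ (t + 1) = 1 := by rw [← mul_pow]; simp
  set J := Ideal.span {a, b} with hJ
  set I := Ideal.span (Set.range (MrMinor x y av bv))
  have haJ : a ∈ J := Ideal.subset_span (by simp)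
  have hbJ : b ∈ J := Ideal.subset_span (by simp)
  have hμ0J : MrMinor x y av bv 0 ∈ J := hμ0 ▸ J.mul_mem_left _ hbJ
  have hμ1J : MrMinor x y av bv 1 ∈ J := hμ1 ▸ J.neg_mem (J.mul_mem_left _ haJ)
  have hμI (j) : MrMinor x y av bv j ∈ I := Ideal.subset_span ⟨j, rfl⟩
  have hCI (k : ℕ) : MrRelMinor x y av bv k ∈ I := by
    rw [MrRelMinor]
    split_ifs
    exacts [hμI _, I.zero_mem]
  refine ⟨?_, ?_⟩
  · have haI : a = -(-1) ^ (t + 1) * MrMinor x y av bv 1 := by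
      rw [hμ1]
      linear_combination (-a) * hsq
    have hbI : b = (-1) ^ (t + 1) * MrMinor x y av bv 0 := by
      rw [hμ0]
      linear_combination (-b) * hsq
    rw [hJ, Ideal.span_le, Set.pair_subset_iff, SetLike.mem_coe, SetLike.mem_coe]
    refine ⟨?_, ?_⟩
    · rw [haI]
      exact I.mul_mem_left _ (hμI 1)
    · rw [hbI]
      exact I.mul_mem_left _ (hμI 0)
  let K : Submodule R I := Submodule.comap I.subtype (J : Submodule R R)
  let c : ℕ → I ⧸ K := fun k => K.mkQ ⟨MrRelMinor x y av bv k, hCI k⟩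
  have hK (z : I) : K.mkQ z = 0 ↔ (z : R) ∈ J := by
    rw [Submodule.mkQ_apply, Submodule.Quotient.mk_eq_zero]
    rfl
  have hlen : Module.length R (I ⧸ K) = ((t + 1 + 1) * (t + 1) / 2 : ℕ) := by
    refine length_eq_of_staircase hm (t + 1) c ?_ (fun k hk => ?_) ?_ (fun k => ?_) (fun _ h => ?_)
    · have hItop : Submodule.span R (Set.range fun j => (⟨_, hμI j⟩ : I)) = ⊤ := by
        apply Submodule.map_injective_of_injective I.injective_subtype
        rw [Submodule.map_span, ← Set.range_comp, Submodule.map_subtype_top]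
        rfl
      rw [eq_top_iff, ← LinearMap.range_eq_top.2 K.mkQ_surjective, ← Submodule.map_top, ← hItop,
        Submodule.map_span, Submodule.span_le]
      rintro _ ⟨_, ⟨j, rfl⟩, rfl⟩
      cases j using Fin.cases with
      | zero => simp only [(hK ⟨_, hμI 0⟩).2 hμ0J, SetLike.mem_coe, Submodule.zero_mem]
      | succ j =>
        cases j using Fin.cases with
        | zero => simp only [Fin.succ_zero_eq_one, (hK ⟨_, hμI 1⟩).2 hμ1J, SetLike.mem_coe,
            Submodule.zero_mem]
        | succ k =>
          refine Submodule.subset_span ⟨k, ?_⟩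
          simp only [c, MrRelMinor, dif_pos k.2]
    · exact (hK _).2 (by simp [MrRelMinor_eq_zero x y av bv hk])
    · rw [← map_smul, hK]
      have h := MrRelMinor_zero_relation (Nat.succ_pos t) x y av bv
      have : y * MrRelMinor x y av bv 0 =
          -(av 0 * MrMinor x y av bv 0) - bv 0 * MrMinor x y av bv 1 := by
        linear_combination h
      change y * MrRelMinor x y av bv 0 ∈ J
      rw [this]
      exact J.sub_mem (J.neg_mem (J.mul_mem_left _ hμ0J)) (J.mul_mem_left _ hμ1J)
    · rcases lt_or_ge k (t + 1) with hk | hk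
      · rw [← map_smul, ← map_smul, ← sub_eq_zero, ← map_sub, hK]
        have h := MrRelMinor_succ_relation x y av bv hk
        set i : Fin (t + 2) := Fin.succ ⟨k, hk⟩
        have : y * MrRelMinor x y av bv (k + 1) - x * MrRelMinor x y av bv k =
            -(av i * MrMinor x y av bv 0) - bv i * MrMinor x y av bv 1 := by
          linear_combination h
        change y * MrRelMinor x y av bv (k + 1) - x * MrRelMinor x y av bv k ∈ J
        rw [this]
        exact J.sub_mem (J.neg_mem (J.mul_mem_left _ hμ0J)) (J.mul_mem_left _ hμ1J)
      · have hc (l : ℕ) (hl : t + 1 ≤ l) : c l = 0 :=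
          (hK _).2 (by simp [MrRelMinor_eq_zero x y av bv hl])
        rw [hc k hk, hc (k + 1) (by omega), smul_zero, smul_zero]
    · rw [← map_smul, hK] at h
      change x ^ t * MrRelMinor x y av bv 0 ∈ J at h
      obtain ⟨q, hq⟩ := ha.exists_eq_mul_pow_add_mul
      obtain ⟨q', hq'⟩ := hb.exists_eq_mul_pow_add_mul
      have hrel := MrRelMinor_zero_relation (Nat.succ_pos t) x y av bv
      rw [hμ0, hμ1] at hrel
      have hC : av 0 * q' - q * bv 0 = -(-1) ^ (t + 1) * MrRelMinor x y av bv 0 := by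
        apply mul_left_cancel₀ hy0
        rw [hq, hq'] at hrel
        linear_combination (-1) ^ (t + 1) * hrel - y * (av 0 * q' - q * bv 0) * hsq
      refine pow_mul_det_notMem_span_pair hxp hyp hxy hyx hunit hN ha0 hq hq' ?_
      rw [hC, mul_left_comm]
      exact J.mul_mem_left _ h
  rw [modLength, ← Module.coe_length, hlen]
  rfl
end

section
/- Let (R, 𝔪) be a two-dimensional regular local ring with infinite residue field, let I be an integrally closed 𝔪-primary ideal with ord(I) = n ≥ r ≥ 2, and let M = M_r(I) ⊆ F = R^r. Then M is extremal; that is, M is integrally closed, has no free direct summands, and satisfies λ(R/I(M)) − λ(F/M) = r(r−1)/2. -/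
open IsLocalRing

section TwoDimRegular

variable {R : Type*} [CommRing R] [IsLocalRing R] [IsNoetherianRing R] {x y : R}

/-- In a Noetherian local ring with maximal ideal `(x, y)`, an element outside `(x)` is congruent
modulo `x` to a unit multiple of a power of `y`. -/
theorem exists_unit_mul_pow_add_of_notMem_span
    (hm : maximalIdeal R = Ideal.span {x, y}) {z : R} (hz : z ∉ Ideal.span {x}) :
    ∃ (u s : R) (j : ℕ), IsUnit u ∧ z = u * y ^ j + x * s := by
  by_contra! hcon
  have step : ∀ j : ℕ, ∃ b s, z = b * y ^ j + x * s := by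
    intro j
    induction j with
    | zero => exact ⟨z, 0, by simp⟩
    | succ j ih =>
      obtain ⟨b, s, h⟩ := ih
      have hb : b ∈ maximalIdeal R := fun hu ↦ hcon b s j hu h
      rw [hm, Ideal.mem_span_pair] at hb
      obtain ⟨p, q, rfl⟩ := hb
      exact ⟨q, s + p * y ^ j, by rw [h]; ring⟩
  have hy : y ∈ maximalIdeal R := hm ▸ Ideal.subset_span (by simp)
  have hinf := Ideal.iInf_pow_smul_eq_bot_of_isLocalRing (M := R ⧸ Ideal.span {x})
    (maximalIdeal R) (IsLocalRing.maximalIdeal.isMaximal R).ne_top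
  have hmem : Submodule.Quotient.mk z ∈
      (⨅ i : ℕ, maximalIdeal R ^ i • ⊤ : Submodule R (R ⧸ Ideal.span {x})) := by
    rw [Submodule.mem_iInf]
    intro j
    obtain ⟨b, s, h⟩ := step j
    have hzj : (Submodule.Quotient.mk z : R ⧸ Ideal.span {x}) =
        y ^ j • Submodule.Quotient.mk b := by
      rw [← Submodule.Quotient.mk_smul, Submodule.Quotient.eq, smul_eq_mul,
        Ideal.mem_span_singleton]
      exact ⟨s, by rw [h]; ring⟩
    rw [hzj]
    exact Submodule.smul_mem_smul (Ideal.pow_mem_pow hy j) trivial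
  rw [hinf, Submodule.mem_bot, Submodule.Quotient.mk_eq_zero] at hmem
  exact hz hmem

/-- In a two-dimensional regular local ring with maximal ideal `(x, y)`, the element `x` is a
nonzerodivisor and `y` is a nonzerodivisor modulo `x`. -/
theorem regular_sequence_of_maximalIdeal_eq_span_pair
    (hdim : ringKrullDim R = 2) (hm : maximalIdeal R = Ideal.span {x, y}) :
    (∀ a, x * a = 0 → a = 0) ∧ ∀ a, x ∣ y * a → x ∣ a := by
  have hx : x ∈ maximalIdeal R := hm ▸ Ideal.subset_span (by simp)
  obtain ⟨l, hl⟩ := Order.le_krullDim_iff.mp (show ((2 : ℕ) : WithBot ℕ∞) ≤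
    Order.krullDim (PrimeSpectrum R) from hdim.ge)
  have h01 : (l ⟨0, by omega⟩).asIdeal < (l ⟨1, by omega⟩).asIdeal :=
    l.strictMono (by simp [Fin.lt_def])
  have h12 : (l ⟨1, by omega⟩).asIdeal < (l ⟨2, by omega⟩).asIdeal :=
    l.strictMono (by simp [Fin.lt_def])
  generalize hP₀ : l ⟨0, by omega⟩ = P₀ at h01
  generalize hP₁ : l ⟨1, by omega⟩ = P₁ at h01 h12
  have h1m : P₁.asIdeal < maximalIdeal R :=
    h12.trans_le (le_maximalIdeal (l ⟨2, by omega⟩).isPrime.ne_top)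
  clear hP₀ hP₁ h12 hl l hdim
  obtain ⟨p₀, hp₀⟩ := P₀
  obtain ⟨p₁, hp₁⟩ := P₁
  simp only at h01 h1m
  have hmin : ∀ j : ℕ, y ^ j ∉ p₀ ⊔ Ideal.span {x} := by
    intro j hj
    have hmm : maximalIdeal R ∈ (Ideal.span (insert x (p₀ : Set R))).minimalPrimes := by
      refine ⟨⟨inferInstance, ?_⟩, ?_⟩
      · rw [Ideal.span_le, Set.insert_subset_iff]
        exact ⟨hx, h01.le.trans h1m.le⟩
      · rintro q ⟨hq, hle⟩ -
        rw [Ideal.span_insert, Ideal.span_eq, sup_comm] at hle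
        rw [hm, Ideal.span_le]
        rintro w (rfl | rfl)
        · exact hle (Ideal.mem_sup_right (Ideal.mem_span_singleton_self _))
        · exact hq.mem_of_pow_mem j (hle hj)
    have := Ideal.mem_minimalPrimes_span_of_mem_minimalPrimes_span_insert h1m x _ hmm
      (p₀ : Set R) h01.le
      (fun w hw ↦ Ideal.le_radical (Ideal.subset_span (Set.mem_insert_of_mem _ hw)))
    rw [Ideal.span_eq] at this
    exact h01.not_ge (this.2 ⟨hp₀, le_rfl⟩ h01.le)
  have hyj : ∀ j : ℕ, y ^ j ∉ Ideal.span {x} := fun j h ↦ hmin j (Ideal.mem_sup_right h)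
  have hmulcancel : ∀ {u a : R}, IsUnit u → ∀ {J : Ideal R}, u * a ∈ J → a ∈ J :=
    fun hu J h ↦ (J.unit_mul_mem_iff_mem hu).1 h
  have hp₀x : p₀ ≤ Ideal.span {x} := by
    intro z hz
    by_contra hzx
    obtain ⟨u, s, j, hu, rfl⟩ := exists_unit_mul_pow_add_of_notMem_span hm hzx
    refine hmin j (hmulcancel hu ?_)
    have := sub_mem (Ideal.mem_sup_left hz : _ ∈ p₀ ⊔ Ideal.span {x})
      (Ideal.mem_sup_right (Ideal.mul_mem_right s _ (Ideal.mem_span_singleton_self x)))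
    simpa using this
  have hxp₀ : x ∉ p₀ := by
    intro hxp
    obtain ⟨z, hz1, hz0⟩ := Set.exists_of_ssubset h01
    have hzx : z ∉ Ideal.span {x} := fun h ↦
      hz0 ((Ideal.span_singleton_le_iff_mem p₀).2 hxp h)
    obtain ⟨u, s, j, hu, rfl⟩ := exists_unit_mul_pow_add_of_notMem_span hm hzx
    have hx1 := h01.le hxp
    have h : u * y ^ j ∈ p₁ := by
      have := sub_mem hz1 (p₁.mul_mem_right s hx1)
      simpa using this
    have hy1 : y ∈ p₁ := hp₁.mem_of_pow_mem j (hmulcancel hu h)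
    refine h1m.not_ge ?_
    rw [hm, Ideal.span_le]
    rintro w (rfl | rfl) <;> assumption
  have hbot : p₀ = ⊥ := by
    refine Submodule.eq_bot_of_le_smul_of_le_jacobson_bot (Ideal.span {x}) p₀
      (IsNoetherian.noetherian p₀) ?_ ?_
    · intro z hz
      obtain ⟨s, rfl⟩ := Ideal.mem_span_singleton.1 (hp₀x hz)
      exact Submodule.smul_mem_smul (Ideal.mem_span_singleton_self x)
        ((hp₀.mem_or_mem hz).resolve_left hxp₀)
    · exact ((Ideal.span_singleton_le_iff_mem _).2 hx).trans (maximalIdeal_le_jacobson _)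
  subst hbot
  refine ⟨fun a ha ↦ ?_, fun a ha ↦ ?_⟩
  · exact (hp₀.mem_or_mem ((Submodule.mem_bot R).2 ha)).resolve_left hxp₀
  · by_contra hax
    rw [← Ideal.mem_span_singleton] at ha hax
    obtain ⟨u, s, j, hu, rfl⟩ := exists_unit_mul_pow_add_of_notMem_span hm hax
    refine hyj (j + 1) (hmulcancel hu ?_)
    have := sub_mem ha (Ideal.mul_mem_right (y * s) _ (Ideal.mem_span_singleton_self x))
    convert this using 1
    ring

end TwoDimRegular

section BinaryForms

variable {R : Type*} [CommRing R]

/-- The map `R^(k+1) → R` sending a coefficient vector `c` to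
`c 0 * x^k + c 1 * x^(k-1) * y + ⋯ + c k * y^k`. -/
def formEval (k : ℕ) (x y : R) : (Fin (k + 1) → R) →ₗ[R] R :=
  ∑ i : Fin (k + 1), (x ^ (k - (i : ℕ)) * y ^ (i : ℕ)) • LinearMap.proj i

theorem formEval_apply (k : ℕ) (x y : R) (c : Fin (k + 1) → R) :
    formEval k x y c = ∑ i : Fin (k + 1), c i * (x ^ (k - (i : ℕ)) * y ^ (i : ℕ)) := by
  simp [formEval, mul_comm]

theorem formEval_eq_of_expresses {k : ℕ} {x y a : R} {c : Fin (k + 1) → R}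
    (h : Expresses (k + 1) x y c a) : formEval k x y c = a := by
  rw [formEval_apply, h]
  simp [mul_assoc]

theorem pow_mul_eq_zero {x : R} (hx : ∀ a, x * a = 0 → a = 0) (j : ℕ) (a : R)
    (h : x ^ j * a = 0) : a = 0 := by
  induction j with
  | zero => simpa using h
  | succ j ih => exact ih (hx _ (by rwa [pow_succ', mul_assoc] at h))

theorem dvd_of_dvd_pow_mul_left {x y : R} (hy : ∀ a, x ∣ y * a → x ∣ a) (j : ℕ) (a : R)
    (h : x ∣ y ^ j * a) : x ∣ a := by
  induction j with
  | zero => simpa using h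
  | succ j ih => exact ih (hy _ (by rwa [pow_succ', mul_assoc] at h))

/-- The syzygies of `x^k, x^(k-1) y, …, y^k` come from the Koszul relation on `x, y`. -/
theorem exists_koszul_coeff {x y : R} (hx : ∀ a, x * a = 0 → a = 0)
    (hy : ∀ a, x ∣ y * a → x ∣ a) (k : ℕ) (c : ℕ → R)
    (h : ∑ i ∈ Finset.range (k + 1), c i * (x ^ (k - i) * y ^ i) = 0) :
    ∃ e : ℕ → R, e 0 = 0 ∧ e (k + 1) = 0 ∧ ∀ i ≤ k, c i = y * e (i + 1) - x * e i := by
  induction k generalizing c with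
  | zero => exact ⟨0, rfl, rfl, fun i hi ↦ by obtain rfl : i = 0 := by omega
                                              simpa using h⟩
  | succ k ih =>
    have hsum : ∀ c' : ℕ → R, ∑ i ∈ Finset.range (k + 1), c' i * (x ^ (k + 1 - i) * y ^ i) =
        x * ∑ i ∈ Finset.range (k + 1), c' i * (x ^ (k - i) * y ^ i) := by
      intro c'
      rw [Finset.mul_sum]
      refine Finset.sum_congr rfl fun i hi ↦ ?_
      rw [Nat.sub_add_comm (Nat.lt_succ_iff.1 (Finset.mem_range.1 hi)), pow_succ]
      ring
    rw [Finset.sum_range_succ, hsum] at h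
    obtain ⟨d, hd⟩ : x ∣ c (k + 1) := by
      refine dvd_of_dvd_pow_mul_left hy (k + 1) _ ⟨-∑ i ∈ Finset.range (k + 1), c i * (x ^ (k - i) * y ^ i), ?_⟩
      simp only [Nat.sub_self, pow_zero, one_mul] at h
      linear_combination h
    obtain ⟨e, he0, hek, he⟩ := ih (fun i ↦ if i = k then c k + d * y else c i) <| by
      apply hx
      rw [Finset.mul_sum, Finset.sum_range_succ] at h ⊢
      rw [Finset.sum_congr rfl (fun i hi ↦ by
        rw [if_neg (Finset.mem_range.1 hi).ne] : ∀ i ∈ Finset.range k,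
          x * ((if i = k then c k + d * y else c i) * (x ^ (k - i) * y ^ i)) =
          x * (c i * (x ^ (k - i) * y ^ i)))]
      simp only [Nat.sub_self, pow_zero, one_mul, if_true] at h ⊢
      rw [hd] at h
      linear_combination h
    refine ⟨fun i ↦ if i = k + 1 then -d else if i = k + 2 then 0 else e i, by simpa using he0,
      by simp, fun i hi ↦ ?_⟩
    rcases Nat.lt_or_ge i k with hik | hik
    · have := he i hik.le
      rw [if_neg hik.ne] at this
      simp only
      rw [if_neg (by omega), if_neg (by omega), if_neg (by omega), if_neg (by omega), this]
    · obtain rfl | rfl : i = k ∨ i = k + 1 := by omega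
      · have := he i le_rfl
        rw [if_pos rfl, hek] at this
        simp only
        simp only [if_true]
        rw [if_neg (by omega), if_neg (by omega)]
        linear_combination this
      · simp [hd]

theorem formEval_stdRelCol {x y : R} {k j : ℕ} (hj : j < k) :
    formEval k x y (stdRelCol (k + 1) x y j) = 0 := by
  have h : stdRelCol (k + 1) x y j =
      Pi.single ⟨j, by omega⟩ y - Pi.single ⟨j + 1, by omega⟩ x := by
    funext i
    simp only [stdRelCol, Pi.sub_apply, Pi.single_apply, Fin.ext_iff]
    split_ifs <;> first | omega | simp
  have hs : ∀ (i : Fin (k + 1)) (a : R),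
      formEval k x y (Pi.single i a) = a * (x ^ (k - (i : ℕ)) * y ^ (i : ℕ)) := by
    intro i a
    rw [formEval_apply, Finset.sum_eq_single i] <;> simp +contextual
  rw [h, map_sub, hs, hs]
  simp only
  rw [show k - j = k - (j + 1) + 1 by omega]
  ring

theorem exists_koszul_coeff_of_formEval_eq_zero {x y : R} (hx : ∀ a, x * a = 0 → a = 0)
    (hy : ∀ a, x ∣ y * a → x ∣ a) {k : ℕ} {v : Fin (k + 1) → R} (h : formEval k x y v = 0) :
    ∃ e : ℕ → R, e 0 = 0 ∧ e (k + 1) = 0 ∧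
      ∀ i : Fin (k + 1), v i = y * e (i + 1) - x * e i := by
  obtain ⟨e, h0, h1, h2⟩ := exists_koszul_coeff hx hy k
    (fun i ↦ if hi : i < k + 1 then v ⟨i, hi⟩ else 0) <| by
      rw [Finset.sum_range]
      simpa only [Fin.is_lt, dif_pos, Fin.eta, formEval_apply] using h
  refine ⟨e, h0, h1, fun i ↦ ?_⟩
  have := h2 i (Nat.lt_succ_iff.1 i.2)
  simpa only [Fin.is_lt, dif_pos, Fin.eta] using this

theorem mem_span_stdRelCol_of_formEval_eq_zero {x y : R} (hx : ∀ a, x * a = 0 → a = 0)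
    (hy : ∀ a, x ∣ y * a → x ∣ a) {k : ℕ} {v : Fin (k + 1) → R} (h : formEval k x y v = 0) :
    v ∈ Submodule.span R { w | ∃ j, j < k ∧ w = stdRelCol (k + 1) x y j } := by
  obtain ⟨e, h0, h1, h2⟩ := exists_koszul_coeff_of_formEval_eq_zero hx hy h
  have hv : v = ∑ j ∈ Finset.range k, e (j + 1) • stdRelCol (k + 1) x y j := by
    funext i
    have hs : ∀ j, stdRelCol (k + 1) x y j i =
        (if (i : ℕ) = j then y else 0) - if (i : ℕ) = j + 1 then x else 0 := by
      intro j
      simp only [stdRelCol]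
      split_ifs <;> first | omega | simp
    simp only [Finset.sum_apply, Pi.smul_apply, smul_eq_mul, hs, mul_sub, mul_ite, mul_zero,
      Finset.sum_sub_distrib, Finset.sum_ite_eq, Finset.mem_range]
    rw [h2 i]
    congr 1
    · split_ifs with hi
      · ring
      · rw [show (i : ℕ) + 1 = k + 1 by omega, h1, mul_zero]
    · rcases Nat.eq_zero_or_pos (i : ℕ) with hi | hi
      · rw [hi, h0, mul_zero]
        simp
      · rw [Finset.sum_eq_single ((i : ℕ) - 1)]
        · rw [if_pos (by omega), Nat.sub_add_cancel hi, mul_comm]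
        · exact fun j _ hj ↦ if_neg (by omega)
        · exact fun hj ↦ absurd (Finset.mem_range.2 (by omega)) hj
  rw [hv]
  exact Submodule.sum_mem _ fun j hj ↦ Submodule.smul_mem _ _
    (Submodule.subset_span ⟨j, Finset.mem_range.1 hj, rfl⟩)

theorem formEval_mem_pow {x y : R} (k : ℕ) (v : Fin (k + 1) → R) :
    formEval k x y v ∈ Ideal.span {x, y} ^ k := by
  rw [formEval_apply]
  refine Ideal.sum_mem _ fun i _ ↦ Ideal.mul_mem_left _ _ ?_
  have hp := pow_add (Ideal.span {x, y}) (k - (i : ℕ)) i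
  rw [Nat.sub_add_cancel (Nat.lt_succ_iff.1 i.2)] at hp
  rw [hp]
  exact Ideal.mul_mem_mul (Ideal.pow_mem_pow (Ideal.subset_span (by simp)) _)
    (Ideal.pow_mem_pow (Ideal.subset_span (by simp)) _)

theorem exists_formEval_eq_mul {J K : Ideal R} {x y : R} {k : ℕ}
    (hK : ∀ z ∈ K, ∃ v, formEval k x y v = z) {z : R} (hz : z ∈ J * K) :
    ∃ v, (∀ i, v i ∈ J) ∧ formEval k x y v = z := by
  induction hz using Submodule.mul_induction_on' with
  | mem_mul_mem p hp q hq =>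
    obtain ⟨v, rfl⟩ := hK q hq
    exact ⟨p • v, fun i ↦ J.mul_mem_right _ hp, by simp⟩
  | add p _ q _ hp hq =>
    obtain ⟨v, hv, rfl⟩ := hp
    obtain ⟨w, hw, rfl⟩ := hq
    exact ⟨v + w, fun i ↦ J.add_mem (hv i) (hw i), by simp⟩

theorem exists_formEval_eq {x y : R} (k : ℕ) :
    ∀ z ∈ Ideal.span {x, y} ^ k, ∃ v, formEval k x y v = z := by
  induction k with
  | zero => exact fun z _ ↦ ⟨fun _ ↦ z, by simp [formEval_apply]⟩
  | succ k ih =>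
    intro z hz
    rw [pow_succ'] at hz
    obtain ⟨v, hv, rfl⟩ := exists_formEval_eq_mul ih hz
    simp only [Ideal.mem_span_pair] at hv
    choose p q hpq using hv
    refine ⟨Fin.snoc (α := fun _ ↦ R) p 0 + Fin.cons (α := fun _ ↦ R) 0 q, ?_⟩
    have h1 : formEval (k + 1) x y (Fin.snoc (α := fun _ ↦ R) p 0) = x * formEval k x y p := by
      rw [formEval_apply, formEval_apply, Fin.sum_univ_castSucc, Finset.mul_sum]
      simp only [Fin.snoc_castSucc, Fin.snoc_last, zero_mul, add_zero]
      refine Finset.sum_congr rfl fun i _ ↦ ?_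
      rw [Fin.val_castSucc, Nat.sub_add_comm (Nat.lt_succ_iff.1 i.2), pow_succ]
      ring
    have h2 : formEval (k + 1) x y (Fin.cons (α := fun _ ↦ R) 0 q) = y * formEval k x y q := by
      rw [formEval_apply, formEval_apply, Fin.sum_univ_succ, Finset.mul_sum]
      simp only [Fin.cons_succ, Fin.cons_zero, zero_mul, zero_add]
      refine Finset.sum_congr rfl fun i _ ↦ ?_
      rw [Fin.val_succ, Nat.add_sub_add_right]
      ring
    have h3 : v = x • p + y • q := by
      funext i
      rw [← hpq i]
      simp [mul_comm]
    rw [map_add, h1, h2, h3]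
    simp

theorem range_formEval (k : ℕ) (x y : R) :
    LinearMap.range (formEval k x y) = Ideal.span {x, y} ^ k := by
  ext z
  refine ⟨?_, fun hz ↦ exists_formEval_eq k z hz⟩
  rintro ⟨v, rfl⟩
  exact formEval_mem_pow k v

theorem formEval_mem_pow_succ_iff {x y : R} (hx : ∀ a, x * a = 0 → a = 0)
    (hy : ∀ a, x ∣ y * a → x ∣ a) {k : ℕ} {v : Fin (k + 1) → R} :
    formEval k x y v ∈ Ideal.span {x, y} ^ (k + 1) ↔ ∀ i, v i ∈ Ideal.span {x, y} := by
  constructor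
  · intro h i
    rw [pow_succ'] at h
    obtain ⟨w, hw, hwv⟩ := exists_formEval_eq_mul (exists_formEval_eq k) h
    obtain ⟨e, -, -, he⟩ := exists_koszul_coeff_of_formEval_eq_zero hx hy
      (show formEval k x y (v - w) = 0 by rw [map_sub, hwv, sub_self])
    have hi := he i
    rw [Pi.sub_apply, sub_eq_iff_eq_add] at hi
    rw [hi]
    refine add_mem (sub_mem ?_ ?_) (hw i) <;>
      exact Ideal.mul_mem_right _ _ (Ideal.subset_span (by simp))
  · intro h
    rw [formEval_apply, pow_succ']
    refine Ideal.sum_mem _ fun i _ ↦ Ideal.mul_mem_mul (h i) ?_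
    have := formEval_mem_pow (x := x) (y := y) k (Pi.single i 1)
    rw [formEval_apply, Finset.sum_eq_single i] at this <;>
      simp_all +contextual [Pi.single_apply]

/-- `M_r(I)` is the preimage of `I` under the evaluation map. -/
theorem MrSpan_eq_comap {x y : R} (hx : ∀ a, x * a = 0 → a = 0)
    (hy : ∀ a, x ∣ y * a → x ∣ a) {k m : ℕ} {I : Ideal R} {a : Fin m → R}
    {C : Fin m → Fin (k + 1) → R} (ha : Ideal.span (Set.range a) = I)
    (hC : ∀ j, formEval k x y (C j) = a j) :
    MrSpan (k + 1) x y C = Submodule.comap (formEval k x y) I := by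
  apply le_antisymm
  · refine Submodule.span_le.2 ?_
    rintro v (⟨j, rfl⟩ | ⟨j, hj, rfl⟩)
    · simp only [SetLike.mem_coe, Submodule.mem_comap, hC, ← ha]
      exact Ideal.subset_span ⟨j, rfl⟩
    · simp only [SetLike.mem_coe, Submodule.mem_comap]
      rw [formEval_stdRelCol (by omega)]
      exact I.zero_mem
  · intro v hv
    rw [Submodule.mem_comap, ← ha] at hv
    obtain ⟨b, hb⟩ := (Ideal.mem_span_range_iff_exists_fun).1 hv
    have hker : formEval k x y (v - ∑ j, b j • C j) = 0 := by
      simp [hC, hb]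
    have h1 := mem_span_stdRelCol_of_formEval_eq_zero hx hy hker
    rw [← sub_add_cancel v (∑ j, b j • C j)]
    refine add_mem (Submodule.span_mono Set.subset_union_right h1) ?_
    exact Submodule.sum_mem _ fun j _ ↦ Submodule.smul_mem _ _
      (Submodule.subset_span (Or.inl ⟨j, rfl⟩))

end BinaryForms

section IntegralClosure

variable {R : Type*} [CommRing R]

theorem det_mem_pow_of_forall_mem {n : ℕ} {J : Ideal R} {A : Matrix (Fin n) (Fin n) R}
    (hA : ∀ i j, A i j ∈ J) : A.det ∈ J ^ n := by
  rw [Matrix.det_apply]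
  refine Ideal.sum_mem _ fun σ _ ↦ ?_
  rw [Units.smul_def, zsmul_eq_mul]
  refine Ideal.mul_mem_left _ _ ?_
  have := Ideal.prod_mem_prod (s := Finset.univ) (I := fun _ : Fin n ↦ J)
    (fun i _ ↦ hA (σ i) i)
  simpa using this

/-- The determinant trick: `z * J ⊆ I * J` with `J` finitely generated and containing a
nonzerodivisor implies that `z` is integral over `I`. -/
theorem memIntClosure_of_mul_mem [Nontrivial R] {I J : Ideal R} (hJ : J.FG) {z t : R} (ht : t ∈ J)
    (ht0 : ∀ a, a * t = 0 → a = 0) (h : ∀ w ∈ J, z * w ∈ I * J) : MemIntClosure I z := by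
  have : Module.Finite R J := Module.Finite.iff_fg.2 hJ
  obtain ⟨p, hp, -, hc, h0⟩ :=
    LinearMap.exists_monic_and_natDegree_eq_and_coeff_mem_pow_and_aeval_eq_zero
      R (LinearMap.lsmul R J z) I <| by
      rintro _ ⟨w, rfl⟩
      rw [Submodule.mem_smul_top_iff]
      exact h w w.2
  have hev : p.eval z = 0 := by
    have h1 : Polynomial.aeval (LinearMap.lsmul R J z) p =
        LinearMap.lsmul R J (p.eval z) := by
      rw [← Polynomial.coe_aeval_eq_eval]
      exact Polynomial.aeval_algHom_apply (Algebra.lsmul R R J) z p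
    rw [h1] at h0
    exact ht0 _ (congrArg Subtype.val (LinearMap.congr_fun h0 ⟨t, ht⟩))
  have hdeg : 0 < p.natDegree := by
    rw [Nat.pos_iff_ne_zero]
    intro hd
    rw [hp.natDegree_eq_zero.1 hd] at hev
    simp at hev
  refine ⟨p.natDegree, hdeg, fun i ↦ p.coeff (p.natDegree - i), fun i hi ↦ ?_, ?_⟩
  · have := hc (p.natDegree - i)
    rwa [Nat.sub_sub_self (Finset.mem_Icc.1 hi).2] at this
  · rw [Polynomial.eval_eq_sum_range, ← Finset.sum_range_reflect, Finset.sum_range_succ'] at hev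
    rw [← hev, add_comm]
    congr 1
    · rw [Finset.sum_bij (fun i _ ↦ i - 1) (t := Finset.range p.natDegree)]
      · intro i hi
        simp only [Finset.mem_Icc, Finset.mem_range] at hi ⊢
        omega
      · intro i hi j hj hij
        simp only [Finset.mem_Icc] at hi hj
        omega
      · intro i hi
        simp only [Finset.mem_range] at hi
        exact ⟨i + 1, by simp only [Finset.mem_Icc]; omega, by simp⟩
      · intro i hi
        simp only [Finset.mem_Icc] at hi
        rw [show p.natDegree + 1 - 1 - (i - 1 + 1) = p.natDegree - i by omega]
    · simp [hp.coeff_natDegree]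

variable {x y : R} {k : ℕ}

theorem formEval_basis_mul_colDet (w : Fin (k + 1) → Fin (k + 1) → R) (i : Fin (k + 1)) :
    (x ^ (k - (i : ℕ)) * y ^ (i : ℕ)) * colDet w =
      ∑ j, formEval k x y (w j) * (Matrix.of fun i j ↦ w j i).adjugate j i := by
  set W : Matrix (Fin (k + 1)) (Fin (k + 1)) R := Matrix.of fun i j ↦ w j i with hW
  let ρ : Fin (k + 1) → R := fun i ↦ x ^ (k - (i : ℕ)) * y ^ (i : ℕ)
  have h1 : (fun j ↦ formEval k x y (w j)) = Matrix.vecMul ρ W := by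
    funext j
    rw [formEval_apply]
    simp [Matrix.vecMul, dotProduct, hW, ρ, mul_comm]
  have h2 : Matrix.vecMul (Matrix.vecMul ρ W) W.adjugate = W.det • ρ := by
    rw [Matrix.vecMul_vecMul, Matrix.mul_adjugate, Matrix.vecMul_smul, Matrix.vecMul_one]
  have h3 := congrFun h2 i
  rw [← h1] at h3
  simp only [Matrix.vecMul, dotProduct, Pi.smul_apply, smul_eq_mul] at h3
  rw [h3, mul_comm]
  rfl

theorem colDet_cons_stdRelCol (hx : ∀ a, x * a = 0 → a = 0) (v : Fin (k + 1) → R) :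
    colDet (Fin.cons (α := fun _ ↦ Fin (k + 1) → R) v
      (fun j : Fin k ↦ stdRelCol (k + 1) x y j)) = (-1) ^ k * formEval k x y v := by
  have h := formEval_basis_mul_colDet (x := x) (y := y) (Fin.cons (α := fun _ ↦ Fin (k + 1) → R) v
      (fun j : Fin k ↦ stdRelCol (k + 1) x y j)) 0
  rw [Fin.sum_univ_succ] at h
  simp only [Fin.cons_succ, formEval_stdRelCol (Fin.is_lt _), Fin.cons_zero, zero_mul,
    Finset.sum_const_zero, add_zero, Fin.val_zero, Nat.sub_zero, pow_zero, mul_one,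
    Matrix.adjugate_fin_succ_eq_det_submatrix, one_mul] at h
  rw [Matrix.det_of_isUpperTriangular] at h
  · simp only [Matrix.submatrix_apply, Matrix.of_apply, Fin.zero_succAbove, Fin.cons_succ,
      stdRelCol, Fin.val_succ, Nat.succ_ne_self, if_true, if_false, Finset.prod_const,
      Finset.card_univ, Fintype.card_fin] at h
    rw [← sub_eq_zero]
    apply pow_mul_eq_zero hx k
    rw [mul_sub, h, neg_pow]
    ring
  · intro i j hij
    have hij' : (j : ℕ) < i := hij
    simp only [Matrix.submatrix_apply, Matrix.of_apply, Fin.zero_succAbove, Fin.cons_succ,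
      stdRelCol, Fin.val_succ]
    rw [if_neg (by omega), if_neg (by omega)]

/-- The ideal of maximal minors of `M_r(I)` is `I`. -/
theorem maxMinors_comap_formEval [Nontrivial R] (hx : ∀ a, x * a = 0 → a = 0)
    {I : Ideal R} (hI : IdealIntClosed I) (hle : I ≤ Ideal.span {x, y} ^ k)
    (hM : ∀ v, formEval k x y v ∈ I → ∀ i, v i ∈ Ideal.span {x, y}) :
    maxMinors (Submodule.comap (formEval k x y) I) = I := by
  apply le_antisymm
  · refine Ideal.span_le.2 ?_
    rintro d ⟨w, hw, rfl⟩
    have hadj : ∀ i j, (Matrix.of fun i j ↦ w j i).adjugate i j ∈ Ideal.span {x, y} ^ k := by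
      intro i j
      rw [Matrix.adjugate_fin_succ_eq_det_submatrix]
      exact Ideal.mul_mem_left _ _ (det_mem_pow_of_forall_mem fun _ _ ↦ hM _ (hw _) _)
    refine hI _ (memIntClosure_of_mul_mem (J := Ideal.span {x, y} ^ k) (t := x ^ k) ?_
      (Ideal.pow_mem_pow (Ideal.subset_span (by simp)) k)
      (fun a ha ↦ pow_mul_eq_zero hx k a (by rwa [mul_comm])) ?_)
    · exact Ideal.FG.pow (Submodule.fg_span (by simp))
    · intro z hz
      obtain ⟨c, rfl⟩ := exists_formEval_eq k z hz
      rw [formEval_apply, Finset.mul_sum]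
      refine Ideal.sum_mem _ fun i _ ↦ ?_
      rw [mul_left_comm, mul_comm (colDet w), formEval_basis_mul_colDet]
      exact Ideal.mul_mem_left _ _ (Ideal.sum_mem _ fun j _ ↦ Ideal.mul_mem_mul (hw j) (hadj _ _))
  · intro z hz
    obtain ⟨v, rfl⟩ := exists_formEval_eq k z (hle hz)
    have h := colDet_cons_stdRelCol (x := x) (y := y) hx v
    have hmem : colDet (Fin.cons (α := fun _ ↦ Fin (k + 1) → R) v
      (fun j : Fin k ↦ stdRelCol (k + 1) x y j)) ∈
        maxMinors (Submodule.comap (formEval k x y) I) := by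
      refine Ideal.subset_span ⟨_, ?_, rfl⟩
      refine Fin.cases ?_ fun j ↦ ?_
      · exact hz
      · simp only [Fin.cons_succ, Submodule.mem_comap]
        rw [formEval_stdRelCol j.2]
        exact I.zero_mem
    rw [h] at hmem
    exact (Ideal.unit_mul_mem_iff_mem _ (isUnit_one.neg.pow k)).1 hmem

theorem modIntClosed_comap_formEval (hx : ∀ a, x * a = 0 → a = 0)
    {I : Ideal R} (hI : IdealIntClosed I)
    (hmax : maxMinors (Submodule.comap (formEval k x y) I) = I) :
    ModIntClosed (Submodule.comap (formEval k x y) I) := by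
  intro v hv
  have h := hv (Fin.cons (α := fun _ ↦ Fin (k + 1) → R) v
    (fun j : Fin k ↦ stdRelCol (k + 1) x y j)) 0 rfl <| by
      refine Fin.cases (fun h ↦ absurd rfl h) fun j _ ↦ ?_
      simp only [Fin.cons_succ, Submodule.mem_comap]
      rw [formEval_stdRelCol j.2]
      exact I.zero_mem
  rw [hmax, colDet_cons_stdRelCol hx] at h
  exact (Ideal.unit_mul_mem_iff_mem _ (isUnit_one.neg.pow k)).1 (hI _ h)

end IntegralClosure

section FreeSummands

variable {R : Type*} [CommRing R]

/-- A submodule of `J F`, `J` proper, containing `s F` and `t F` for a regular sequence `s, t`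
has no free direct summand. -/
theorem not_hasFreeSummand_of_regular {r : ℕ} {J : Ideal R} (hJ : J ≠ ⊤) {s t : R}
    (hs : ∀ a, s * a = 0 → a = 0) (ht : ∀ a, s ∣ t * a → s ∣ a)
    {M : Submodule R (Fin r → R)} (hM : ∀ v ∈ M, ∀ i, v i ∈ J)
    (hsM : ∀ i, Pi.single i s ∈ M) (htM : ∀ i, Pi.single i t ∈ M) : ¬ HasFreeSummand M := by
  rintro ⟨N, P, hsup, hinf, hbot, hfree⟩
  have hR : Nontrivial R := by
    by_contra h
    rw [not_nontrivial_iff_subsingleton] at h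
    exact hJ (Subsingleton.elim _ _)
  have huniq : ∀ n ∈ N, ∀ p ∈ P, n + p ∈ N → p = 0 := by
    intro n hn p hp h
    have : p ∈ N ⊓ P := ⟨(N.add_mem_iff_right hn).1 h, hp⟩
    rwa [hinf] at this
  have hNt : Nontrivial N := Submodule.nontrivial_iff_ne_bot.2 hbot
  let b := Module.Free.chooseBasis R N
  obtain ⟨ι⟩ := b.index_nonempty
  let f := b.coord ι
  have hf : f (b ι) = 1 := by simp [f]
  have hdec : ∀ v ∈ M, ∃ n : N, ∃ p ∈ P, (n : Fin r → R) + p = v := by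
    intro v hv
    rw [← hsup, Submodule.mem_sup] at hv
    obtain ⟨n, hn, p, hp, h⟩ := hv
    exact ⟨⟨n, hn⟩, p, hp, h⟩
  choose n p hp hnp using fun i ↦ hdec _ (hsM i)
  choose n' p' hp' hnp' using fun i ↦ hdec _ (htM i)
  have hcomm : ∀ i, t • n i = s • n' i := by
    intro i
    have h : t • (n i : Fin r → R) + (t • p i - s • p' i) = s • (n' i : Fin r → R) := by
      have : t • ((n i : Fin r → R) + p i) = s • ((n' i : Fin r → R) + p' i) := by
        rw [hnp, hnp', ← Pi.single_smul', ← Pi.single_smul', smul_eq_mul, smul_eq_mul, mul_comm]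
      rw [smul_add, smul_add] at this
      rw [← add_sub_assoc, this, add_sub_cancel_right]
    have h0 := huniq _ (N.smul_mem t (n i).2) _
      (P.sub_mem (P.smul_mem t (hp i)) (P.smul_mem s (hp' i)))
      (h ▸ N.smul_mem s (n' i).2)
    rw [h0, add_zero] at h
    exact Subtype.ext h
  have hdiv : ∀ i, s ∣ f (n i) := by
    intro i
    refine ht _ ⟨f (n' i), ?_⟩
    have := congrArg f (hcomm i)
    simpa using this
  choose c hc using hdiv
  let z : Fin r → R := b ι
  have hzM : z ∈ M := hsup ▸ Submodule.mem_sup_left (b ι).2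
  have hz : s • b ι = ∑ i, z i • n i := by
    have h : (∑ i, z i • (n i : Fin r → R)) + ∑ i, z i • p i = s • z := by
      rw [← Finset.sum_add_distrib]
      simp_rw [← smul_add, hnp]
      funext j
      simp [Finset.sum_apply, Pi.single_apply, mul_comm]
    have h0 := huniq _ (N.sum_mem fun i _ ↦ N.smul_mem (z i) (n i).2) _
      (P.sum_mem fun i _ ↦ P.smul_mem (z i) (hp i)) (h ▸ N.smul_mem s (b ι).2)
    rw [h0, add_zero] at h
    apply Subtype.ext
    simpa using h.symm
  have h1 : s * 1 = s * ∑ i, z i * c i := by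
    have := congrArg f hz
    simp only [map_smul, map_sum, smul_eq_mul, hf, hc] at this
    rw [this, Finset.mul_sum]
    exact Finset.sum_congr rfl fun i _ ↦ by ring
  rw [← sub_eq_zero, ← mul_sub] at h1
  have h2 := sub_eq_zero.1 (hs _ h1)
  refine hJ ((Ideal.eq_top_iff_one _).2 ?_)
  rw [h2]
  exact Ideal.sum_mem _ fun i _ ↦ J.mul_mem_right _ (hM z hzM i)

theorem dvd_of_dvd_pow_mul {x y : R} (hx : ∀ a, x * a = 0 → a = 0)
    (hy : ∀ a, x ∣ y * a → x ∣ a) (i j : ℕ) (a : R) (h : x ^ i ∣ y ^ j * a) : x ^ i ∣ a := by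
  induction i generalizing a with
  | zero => simp
  | succ i ih =>
    obtain ⟨b, rfl⟩ := dvd_of_dvd_pow_mul_left hy j a ((dvd_pow_self x i.succ_ne_zero).trans h)
    rw [pow_succ']
    refine mul_dvd_mul_left x (ih b ?_)
    obtain ⟨d, hd⟩ := h
    refine ⟨d, ?_⟩
    rw [← sub_eq_zero]
    apply hx
    rw [pow_succ'] at hd
    linear_combination hd

end FreeSummands

section Length

variable {R : Type*} [CommRing R]

theorem length_quotient_eq_length_comap_add {F : Type*} [AddCommGroup F] [Module R F]
    (φ : F →ₗ[R] R) {A B : Ideal R} (hA : A ≤ B) (hB : LinearMap.range φ = B) :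
    Module.length R (R ⧸ A) =
      Module.length R (F ⧸ Submodule.comap φ A) + Module.length R (R ⧸ B) := by
  subst hB
  refine Module.length_eq_add_of_exact (Submodule.mapQ (Submodule.comap φ A) A φ le_rfl)
    (Submodule.factor hA) ?_ (Submodule.factor_surjective hA) ?_
  · rw [← LinearMap.ker_eq_bot, Submodule.ker_mapQ, Submodule.mkQ_map_self]
  · intro z
    obtain ⟨z, rfl⟩ := Submodule.Quotient.mk_surjective _ z
    rw [show Submodule.factor hA (Submodule.Quotient.mk z) = Submodule.Quotient.mk z from rfl,
      Submodule.Quotient.mk_eq_zero]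
    constructor
    · rintro ⟨v, rfl⟩
      exact ⟨Submodule.Quotient.mk v, rfl⟩
    · rintro ⟨v, hv⟩
      obtain ⟨v, rfl⟩ := Submodule.Quotient.mk_surjective _ v
      rw [Submodule.mapQ_apply, Submodule.Quotient.eq] at hv
      have := sub_mem (show φ v ∈ LinearMap.range φ from ⟨v, rfl⟩) (hA hv)
      simpa using this

theorem length_quotient_maximalIdeal_pow [IsLocalRing R] {x y : R}
    (hm : maximalIdeal R = Ideal.span {x, y}) (hx : ∀ a, x * a = 0 → a = 0)
    (hy : ∀ a, x ∣ y * a → x ∣ a) (k : ℕ) :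
    Module.length R (R ⧸ maximalIdeal R ^ k) = (k * (k + 1) / 2 : ℕ) := by
  induction k with
  | zero =>
    rw [Module.length_eq_zero_iff.2]
    · simp
    · rw [pow_zero]
      exact Submodule.Quotient.subsingleton_iff.2 Ideal.one_eq_top
  | succ k ih =>
    rw [length_quotient_eq_length_comap_add (formEval k x y)
      (Ideal.pow_le_pow_right k.le_succ) (by rw [range_formEval, hm]), ih]
    have hpi : Submodule.comap (formEval k x y) (maximalIdeal R ^ (k + 1)) =
        Submodule.pi Set.univ fun _ ↦ maximalIdeal R := by
      ext v
      rw [Submodule.mem_comap, hm, formEval_mem_pow_succ_iff hx hy]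
      simp [Submodule.mem_pi]
    have hsimple : IsSimpleModule R (R ⧸ maximalIdeal R) :=
      isSimpleModule_iff_isCoatom.2 (IsLocalRing.maximalIdeal.isMaximal R).out
    rw [hpi, (Submodule.quotientPi _).length_eq, Module.length_pi_of_fintype]
    simp only [Module.length_eq_one, Finset.sum_const, Finset.card_univ, Fintype.card_fin]
    rw [nsmul_one, ← Nat.cast_add]
    congr 1
    rw [show (k + 1) * (k + 1 + 1) = k * (k + 1) + (k + 1) * 2 by ring,
      Nat.add_mul_div_right _ _ two_pos, add_comm]

end Length

/-- for an integrally closed `𝔪`-primary ideal `I` with `ord(I) = n ≥ r ≥ 2`,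
the module `M = M_r(I)` is extremal: it is integrally closed, has no free direct summand and
satisfies `λ(R/I(M)) = λ(F/M) + r(r−1)/2`. -/
theorem statement8 (R : Type*) [CommRing R] [IsLocalRing R]
    (hreg : IsTwoDimRegularLocal R) [Infinite (IsLocalRing.ResidueField R)]
    (I : Ideal R) (hIc : IdealIntClosed I) (hIp : IsMPrimary I)
    (r n : ℕ) (hr : 2 ≤ r) (hrn : r ≤ n) (hord : ordEQ I n)
    (m : ℕ) (x y : R) (a : Fin (m + 1) → R) (C : Fin (m + 1) → Fin r → R)
    (hpres : IsMrPresentation r I x y a C) :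
    IsExtremal (MrSpan r x y C) := by
  obtain ⟨hN, hdim, -⟩ := hreg
  obtain ⟨hm, ⟨ha, -⟩, hC⟩ := hpres
  obtain ⟨hx, hy⟩ := regular_sequence_of_maximalIdeal_eq_span_pair hdim hm
  obtain ⟨k, rfl⟩ : ∃ k, r = k + 1 := ⟨r - 1, by omega⟩
  have hIk1 : I ≤ Ideal.span {x, y} ^ (k + 1) := hm ▸ hord.1.trans (Ideal.pow_le_pow_right hrn)
  have hIk : I ≤ Ideal.span {x, y} ^ k := hIk1.trans (Ideal.pow_le_pow_right k.le_succ)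
  have hM : ∀ v, formEval k x y v ∈ I → ∀ i, v i ∈ Ideal.span {x, y} :=
    fun v hv ↦ (formEval_mem_pow_succ_iff hx hy).1 (hIk1 hv)
  rw [MrSpan_eq_comap hx hy ha fun j ↦ formEval_eq_of_expresses (hC j)]
  have hmax := maxMinors_comap_formEval hx hIc hIk hM
  obtain ⟨K, hK⟩ := Ideal.exists_pow_le_of_le_radical_of_fg hIp.ge
    (IsNoetherian.noetherian (maximalIdeal R))
  have hxK : x ^ K ∈ I := hK (Ideal.pow_mem_pow (hm ▸ Ideal.subset_span (by simp)) K)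
  have hyK : y ^ K ∈ I := hK (Ideal.pow_mem_pow (hm ▸ Ideal.subset_span (by simp)) K)
  have hlen := length_quotient_eq_length_comap_add (formEval k x y) hIk (range_formEval k x y)
  have hpowlen := length_quotient_maximalIdeal_pow hm hx hy
  rw [← hm, hpowlen] at hlen
  have hsingle : ∀ z ∈ I, ∀ i, Pi.single i z ∈ Submodule.comap (formEval k x y) I := by
    intro z hz i
    rw [Submodule.mem_comap, ← mul_one z, ← smul_eq_mul, Pi.single_smul', map_smul]
    exact I.mul_mem_right _ hz
  refine ⟨?_, modIntClosed_comap_formEval hx hIc hmax, ?_, ?_⟩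
  · rw [FinColength, ← Module.length_ne_top_iff]
    have hle := Module.length_le_of_surjective (Submodule.factor hK)
      (Submodule.factor_surjective hK)
    rw [hpowlen, hlen] at hle
    exact ne_top_of_le_ne_top (ENat.natCast_ne_top _) (le_self_add.trans hle)
  · refine not_hasFreeSummand_of_regular (J := maximalIdeal R) (s := x ^ K) (t := y ^ K)
      (IsLocalRing.maximalIdeal.isMaximal R).ne_top ?_
      (dvd_of_dvd_pow_mul hx hy K K) (fun v hv ↦ hm ▸ hM v hv) (hsingle _ hxK) (hsingle _ hyK)
    intro a ha
    exact pow_mul_eq_zero hx K a ha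
  · rw [hmax, modLength, modLength, ← Module.coe_length, ← Module.coe_length, hlen,
      Nat.add_sub_cancel, mul_comm (k + 1) k]
    rfl
end

section
/- Let (R, 𝔪) be a two-dimensional regular local ring with infinite residue field and let I be an integrally closed 𝔪-primary ideal of order n. If either (1) n > r, or (2) n = r and there do not exist 𝔪-primary integrally closed ideals I_1 and I_2 of orders r_1 and r_2 respectively such that I = I_1 I_2 and both (a) λ(R/I_1 I_2) = λ(R/I_1) + λ(R/I_2) + r_1 r_2 and (b) 𝔪^{r-1} = 𝔪^{r_2 − 1} I_1 + 𝔪^{r_1 − 1} I_2 hold, then I = I(M) for some indecomposable integrally closed R-module M of rank r. -/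
open IsLocalRing

/-- A pair of generators of the maximal ideal of a two-dimensional regular local ring, recorded
through the consequences used below: both elements are nonzero and `y` is regular modulo `x`. -/
structure IsRegularParam {R : Type*} [CommRing R] [IsLocalRing R] (x y : R) : Prop where
  max_eq : maximalIdeal R = Ideal.span {x, y}
  ne_left : x ≠ 0
  ne_right : y ≠ 0
  dvd_of_dvd_mul : ∀ c, x ∣ y * c → x ∣ c

section RegularParam

variable {R : Type*} [CommRing R] [IsLocalRing R]

lemma exists_eq_unit_mul_pow_of_not_dvd [IsNoetherianRing R] {x y : R}
    (hm : maximalIdeal R = Ideal.span {x, y}) {w : R} (hw : ¬ x ∣ w) :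
    ∃ (n : ℕ) (u a : R), IsUnit u ∧ w = a * x + u * y ^ n := by
  have hex : ∃ n, w ∉ Ideal.span {x, y ^ n} := by
    by_contra! hall
    apply hw
    have hx : x ∈ maximalIdeal R := hm ▸ Ideal.subset_span (by simp)
    have : w ∈ ⨅ i, (maximalIdeal R ^ i ⊔ Ideal.span {x}) := by
      rw [Ideal.mem_iInf]
      intro i
      have := hall i
      rw [Ideal.span_insert, sup_comm] at this
      have hle : Ideal.span {y ^ i} ≤ maximalIdeal R ^ i := by
        rw [Ideal.span_singleton_le_iff_mem]
        exact Ideal.pow_mem_pow (hm ▸ Ideal.subset_span (by simp)) i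
      have hle' : Ideal.span {y ^ i} ⊔ Ideal.span {x} ≤ maximalIdeal R ^ i ⊔ Ideal.span {x} :=
        sup_le_sup hle le_rfl
      exact hle' this
    have h2 : Ideal.Quotient.mk (Ideal.span {x}) w ∈
        ⨅ i, ((maximalIdeal R).map (Ideal.Quotient.mk (Ideal.span {x}))) ^ i := by
      rw [Ideal.mem_iInf] at this ⊢
      intro i
      rw [← Ideal.map_pow]
      obtain ⟨a, ha, b, hb, rfl⟩ := Submodule.mem_sup.1 (this i)
      rw [map_add, Ideal.Quotient.eq_zero_iff_mem.2 hb, add_zero]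
      exact Ideal.mem_map_of_mem _ ha
    have hxt : Ideal.span {x} ≠ ⊤ := by
      intro h
      rw [Ideal.span_singleton_eq_top] at h
      exact (IsLocalRing.mem_maximalIdeal x).1 hx h
    have : Nontrivial (R ⧸ Ideal.span {x}) := Ideal.Quotient.nontrivial_iff.2 hxt
    have : IsLocalRing (R ⧸ Ideal.span {x}) :=
      IsLocalRing.of_surjective' _ Ideal.Quotient.mk_surjective
    rw [Ideal.iInf_pow_eq_bot_of_isLocalRing, Ideal.mem_bot, Ideal.Quotient.eq_zero_iff_mem,
      Ideal.mem_span_singleton] at h2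
    · exact h2
    · intro h
      have h3 : Ideal.span {x} ⊔ maximalIdeal R = ⊤ := by
        have := congrArg (Ideal.comap (Ideal.Quotient.mk (Ideal.span {x}))) h
        rw [Ideal.comap_map_of_surjective _ Ideal.Quotient.mk_surjective, Ideal.comap_top,
          ← RingHom.ker_eq_comap_bot, Ideal.mk_ker, sup_comm] at this
        exact this
      rw [sup_eq_right.2 ((Ideal.span_singleton_le_iff_mem _).2 hx)] at h3
      exact (maximalIdeal.isMaximal R).ne_top h3
  classical
  have hn := Nat.find_spec hex
  set n := Nat.find hex with hndef
  have hn0 : n ≠ 0 := by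
    intro h
    rw [h] at hn
    apply hn
    have : Ideal.span {x, y ^ 0} = (⊤ : Ideal R) :=
      Ideal.eq_top_of_isUnit_mem _ (Ideal.subset_span (show (1 : R) ∈ _ by simp)) isUnit_one
    rw [this]; trivial
  obtain ⟨k, hk⟩ := Nat.exists_eq_succ_of_ne_zero hn0
  have hkm : w ∈ Ideal.span {x, y ^ k} := by
    by_contra h
    exact Nat.find_min hex (m := k) (by omega) h
  obtain ⟨a, b, hab⟩ := Ideal.mem_span_pair.1 hkm
  refine ⟨k, b, a, ?_, hab.symm⟩
  by_contra hb
  have hb' : b ∈ maximalIdeal R := (IsLocalRing.mem_maximalIdeal b).2 hb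
  rw [hm] at hb'
  obtain ⟨c, d, hcd⟩ := Ideal.mem_span_pair.1 hb'
  apply hn
  rw [hk]
  exact Ideal.mem_span_pair.2 ⟨a + c * y ^ k, d, by rw [← hab, ← hcd, pow_succ]; ring⟩

lemma IsTwoDimRegularLocal.not_dvd_pow (hreg : IsTwoDimRegularLocal R) {x y : R}
    (hm : maximalIdeal R = Ideal.span {x, y}) (n : ℕ) : ¬ x ∣ y ^ n := by
  obtain ⟨hN, hdim, -⟩ := hreg
  intro h
  have hmin : maximalIdeal R ∈ (Ideal.span {x}).minimalPrimes := by
    refine ⟨⟨inferInstance, ?_⟩, ?_⟩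
    · rw [Ideal.span_singleton_le_iff_mem, hm]
      exact Ideal.subset_span (by simp)
    · rintro q ⟨hq, hxq⟩ -
      rw [Ideal.span_singleton_le_iff_mem] at hxq
      rw [hm, Ideal.span_le, Set.insert_subset_iff, Set.singleton_subset_iff]
      exact ⟨hxq, hq.mem_of_pow_mem n (Ideal.mem_of_dvd _ h hxq)⟩
  have h1 := Ideal.height_le_one_of_isPrincipal_of_mem_minimalPrimes _ _ hmin
  have h2 : ((maximalIdeal R).height : WithBot ℕ∞) = 2 :=
    IsLocalRing.maximalIdeal_height_eq_ringKrullDim.trans hdim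
  have h3 : (maximalIdeal R).height = 2 := WithBot.coe_injective h2
  rw [h3] at h1
  exact absurd h1 (by decide)

lemma IsTwoDimRegularLocal.isDomain (hreg : IsTwoDimRegularLocal R) : IsDomain R := by
  obtain ⟨x, y, hm⟩ := hreg.2.2
  have hnd := hreg.not_dvd_pow hm
  have := hreg.1
  have hdim := hreg.2.1
  have hxm : x ∈ maximalIdeal R := hm ▸ Ideal.subset_span (by simp)
  obtain ⟨l, hl⟩ := Order.le_krullDim_iff (α := PrimeSpectrum R) (n := 2).1 hdim.ge
  let p0 := l ⟨0, by omega⟩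
  let p1 := l ⟨1, by omega⟩
  let p2 := l ⟨2, by omega⟩
  have h01 : p0.asIdeal < p1.asIdeal := l.strictMono (by simp [Fin.lt_def])
  have h12 : p1.asIdeal < p2.asIdeal := l.strictMono (by simp [Fin.lt_def])
  have h1m : p1.asIdeal < maximalIdeal R :=
    h12.trans_le (IsLocalRing.le_maximalIdeal p2.isPrime.ne_top)
  have := p0.isPrime
  have := p1.isPrime
  have hx0 : x ∉ p0.asIdeal := by
    intro hx
    obtain ⟨w, hw1, hw0⟩ := SetLike.exists_of_lt h01
    obtain ⟨n, u, a, hu, rfl⟩ := exists_eq_unit_mul_pow_of_not_dvd hm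
      (fun h => hw0 (Ideal.mem_of_dvd _ h hx))
    have : u * y ^ n ∈ p1.asIdeal :=
      (Ideal.add_mem_iff_right _ (Ideal.mul_mem_left _ a (h01.le hx))).1 hw1
    have hy := p1.isPrime.mem_of_pow_mem n (((p1.isPrime.mem_or_mem this).resolve_left
      (fun h => p1.isPrime.ne_top (Ideal.eq_top_of_isUnit_mem _ h hu))))
    apply h1m.not_ge
    rw [hm, Ideal.span_le, Set.insert_subset_iff, Set.singleton_subset_iff]
    exact ⟨h01.le hx, hy⟩
  have hp0x : ∀ z ∈ p0.asIdeal, x ∣ z := by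
    intro z hz
    by_contra hxz
    obtain ⟨n, u, a, hu, rfl⟩ := exists_eq_unit_mul_pow_of_not_dvd hm hxz
    have hrad : y ∈ (Ideal.span (insert x (p0.asIdeal : Set R))).radical := by
      refine ⟨n, ?_⟩
      obtain ⟨u, rfl⟩ := hu
      have h1 : (a * x + u * y ^ n) ∈ Ideal.span (insert x (p0.asIdeal : Set R)) :=
        Ideal.subset_span (Set.mem_insert_of_mem _ hz)
      have h2 := (Ideal.add_mem_iff_right _ (Ideal.mul_mem_left _ a
        (Ideal.subset_span (Set.mem_insert x _)))).1 h1
      have := Ideal.mul_mem_left _ (↑u⁻¹ : R) h2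
      rwa [← mul_assoc, Units.inv_mul, one_mul] at this
    have := Ideal.mem_minimalPrimes_span_of_mem_minimalPrimes_span_insert h1m x {y}
      (by rw [← hm, Ideal.minimalPrimes_eq_subsingleton_self]; rfl)
      (p0.asIdeal : Set R) h01.le (by simpa using hrad)
    rw [Ideal.span_eq, Ideal.minimalPrimes_eq_subsingleton_self] at this
    exact h01.ne' this
  have hbot : p0.asIdeal = ⊥ := by
    refine Submodule.eq_bot_of_le_smul_of_le_jacobson_bot (Ideal.span {x}) p0.asIdeal
      (IsNoetherian.noetherian _) ?_ ?_
    · intro z hz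
      obtain ⟨c, rfl⟩ := hp0x z hz
      exact Submodule.smul_mem_smul (Ideal.mem_span_singleton_self x)
        ((p0.isPrime.mem_or_mem hz).resolve_left hx0)
    · rw [IsLocalRing.jacobson_eq_maximalIdeal _ bot_ne_top,
        Ideal.span_singleton_le_iff_mem]
      exact hxm
  have : (⊥ : Ideal R).IsPrime := hbot ▸ p0.isPrime
  exact IsDomain.of_bot_isPrime R

lemma IsTwoDimRegularLocal.isRegularParam (hreg : IsTwoDimRegularLocal R) {x y : R}
    (hm : maximalIdeal R = Ideal.span {x, y}) : IsRegularParam x y := by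
  have := hreg.1
  have := hreg.isDomain
  have hnd := hreg.not_dvd_pow hm
  refine ⟨hm, ?_, ?_, ?_⟩
  · rintro rfl
    exact hreg.not_dvd_pow (hm.trans (by rw [Set.pair_comm])) 1 (dvd_zero y |>.trans (by simp))
  · rintro rfl
    exact hnd 1 (by simp)
  · intro c hc
    by_contra hxc
    obtain ⟨n, u, a, hu, rfl⟩ := exists_eq_unit_mul_pow_of_not_dvd hm hxc
    apply hnd (n + 1)
    have h1 : x ∣ y * (a * x) := ⟨y * a, by ring⟩
    rw [mul_add, dvd_add_right h1] at hc
    obtain ⟨u, rfl⟩ := hu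
    have := hc.mul_left (↑u⁻¹ : R)
    rwa [show (↑u⁻¹ : R) * (y * (↑u * y ^ n)) = (↑u⁻¹ * ↑u) * y ^ (n + 1) by ring,
      Units.inv_mul, one_mul] at this

end RegularParam

/-- The linear form `v ↦ v 0 * x^(r-1) + v 1 * x^(r-2) * y + ⋯ + v (r-1) * y^(r-1)`. -/
def monoForm {R : Type*} [CommRing R] (r : ℕ) (x y : R) : (Fin r → R) →ₗ[R] R :=
  ∑ i : Fin r, (x ^ (r - 1 - (i : ℕ)) * y ^ (i : ℕ)) • LinearMap.proj i

section MonoForm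

variable {R : Type*} [CommRing R]

lemma monoForm_apply (r : ℕ) (x y : R) (v : Fin r → R) :
    monoForm r x y v = ∑ i : Fin r, x ^ (r - 1 - (i : ℕ)) * y ^ (i : ℕ) * v i := by
  simp [monoForm]

lemma monoForm_single (r : ℕ) (x y : R) (i : Fin r) :
    monoForm r x y (Pi.single i 1) = x ^ (r - 1 - (i : ℕ)) * y ^ (i : ℕ) := by
  rw [monoForm_apply, Finset.sum_eq_single i]
  · simp
  · intro j _ hj
    simp [hj]
  · simp

lemma mul_pow_mem_range_monoForm (x y : R) {a b r : ℕ} (h : a + b + 1 = r) :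
    x ^ a * y ^ b ∈ LinearMap.range (monoForm r x y) := by
  subst h
  refine ⟨Pi.single ⟨b, by omega⟩ 1, ?_⟩
  rw [monoForm_single]
  congr 2
  simp

lemma map_monoForm_coeff [IsDomain R] {x : R} (hx : x ≠ 0) (y : R) {r : ℕ}
    {Q : Polynomial R} (hQ : Q.natDegree < r) :
    algebraMap R (FractionRing R) (monoForm r x y (fun i => Q.coeff i)) =
      algebraMap R (FractionRing R) x ^ (r - 1) *
        Polynomial.aeval (algebraMap R (FractionRing R) y / algebraMap R (FractionRing R) x) Q := by
  have hx' : algebraMap R (FractionRing R) x ≠ 0 := by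
    simpa using hx
  rw [Polynomial.aeval_eq_sum_range' hQ, monoForm_apply, map_sum, Finset.mul_sum, Finset.sum_range]
  refine Finset.sum_congr rfl fun i _ => ?_
  rw [Algebra.smul_def, map_mul, map_mul, map_pow, map_pow, div_pow]
  have : (r - 1) = (r - 1 - (i : ℕ)) + i := by have := i.2; omega
  conv_rhs => rw [this, pow_add]
  field_simp

variable [IsLocalRing R]

namespace IsRegularParam

variable {x y : R}

lemma left_mem (h : IsRegularParam x y) : x ∈ maximalIdeal R :=
  h.max_eq ▸ Ideal.subset_span (by simp)

lemma right_mem (h : IsRegularParam x y) : y ∈ maximalIdeal R :=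
  h.max_eq ▸ Ideal.subset_span (by simp)

lemma monomial_mem (h : IsRegularParam x y) {r : ℕ} (i : Fin r) :
    x ^ (r - 1 - (i : ℕ)) * y ^ (i : ℕ) ∈ maximalIdeal R ^ (r - 1) := by
  have : r - 1 = (r - 1 - (i : ℕ)) + i := by have := i.2; omega
  conv => rw [this, pow_add]
  simp only [add_tsub_cancel_right]
  exact Ideal.mul_mem_mul (Ideal.pow_mem_pow h.left_mem _) (Ideal.pow_mem_pow h.right_mem _)

lemma monoForm_mem (h : IsRegularParam x y) {r : ℕ} (v : Fin r → R) :
    monoForm r x y v ∈ maximalIdeal R ^ (r - 1) := by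
  rw [monoForm_apply]
  exact Ideal.sum_mem _ fun i _ => Ideal.mul_mem_right _ _ (h.monomial_mem i)

lemma pow_le_range_monoForm (h : IsRegularParam x y) (d : ℕ) :
    (maximalIdeal R ^ d : Ideal R) ≤ LinearMap.range (monoForm (d + 1) x y) := by
  induction d with
  | zero =>
    intro z _
    refine ⟨fun _ => z, ?_⟩
    rw [monoForm_apply]; simp
  | succ d ih =>
    rw [pow_succ']
    refine Ideal.mul_le.2 fun a ha b hb => ?_
    obtain ⟨v, rfl⟩ := ih hb
    rw [h.max_eq] at ha
    obtain ⟨s, t, rfl⟩ := Ideal.mem_span_pair.1 ha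
    rw [monoForm_apply, Finset.mul_sum]
    refine Submodule.sum_mem _ fun i _ => ?_
    have hi := i.2
    have h1 : x ^ (d + 1 - 1 - (i : ℕ) + 1) * y ^ (i : ℕ) ∈
      LinearMap.range (monoForm (d + 1 + 1) x y) := mul_pow_mem_range_monoForm x y (by omega)
    have h2 : x ^ (d + 1 - 1 - (i : ℕ)) * y ^ ((i : ℕ) + 1) ∈
      LinearMap.range (monoForm (d + 1 + 1) x y) := mul_pow_mem_range_monoForm x y (by omega)
    convert! Submodule.add_mem _ (Submodule.smul_mem _ (s * v i) h1)
      (Submodule.smul_mem _ (t * v i) h2) using 1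
    simp only [smul_eq_mul]
    ring

lemma range_monoForm (h : IsRegularParam x y) {r : ℕ} (hr : 1 ≤ r) :
    LinearMap.range (monoForm r x y) = (maximalIdeal R ^ (r - 1) : Ideal R) := by
  obtain ⟨d, rfl⟩ := Nat.exists_eq_add_of_le' hr
  refine le_antisymm ?_ (h.pow_le_range_monoForm d)
  rintro _ ⟨v, rfl⟩
  exact h.monoForm_mem v

lemma dvd_of_dvd_pow_mul (h : IsRegularParam x y) (n : ℕ) {c : R} (hc : x ∣ y ^ n * c) :
    x ∣ c := by
  induction n with
  | zero => simpa using hc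
  | succ n ih =>
    apply ih
    apply h.dvd_of_dvd_mul
    rwa [← mul_assoc, ← pow_succ']

lemma exists_monoForm_eq_of_mem_pow (h : IsRegularParam x y) {r : ℕ} (hr : 1 ≤ r) {z : R}
    (hz : z ∈ maximalIdeal R ^ r) : ∃ v, (∀ i, v i ∈ maximalIdeal R) ∧ monoForm r x y v = z := by
  obtain ⟨d, rfl⟩ := Nat.exists_eq_add_of_le' hr
  rw [pow_succ'] at hz
  refine Submodule.mul_induction_on hz ?_ ?_
  · intro a ha b hb
    obtain ⟨v, rfl⟩ := h.pow_le_range_monoForm d hb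
    exact ⟨a • v, fun i => Ideal.mul_mem_right _ _ ha, by rw [map_smul, smul_eq_mul]⟩
  · rintro _ _ ⟨v, hv, rfl⟩ ⟨w, hw, rfl⟩
    exact ⟨v + w, fun i => Ideal.add_mem _ (hv i) (hw i), map_add _ _ _⟩

lemma exists_polynomial_of_mem_pow (h : IsRegularParam x y) {s : ℕ} {a : R}
    (ha : a ∈ maximalIdeal R ^ s) :
    ∃ P : Polynomial R, P.natDegree < s + 1 ∧ monoForm (s + 1) x y (fun i => P.coeff i) = a := by
  obtain ⟨v, rfl⟩ := h.pow_le_range_monoForm s ha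
  refine ⟨∑ i : Fin (s + 1), Polynomial.monomial i (v i), ?_, ?_⟩
  · refine Nat.lt_succ_of_le (Polynomial.natDegree_sum_le_of_forall_le _ _ fun i _ => ?_)
    exact (Polynomial.natDegree_monomial_le _).trans (by have := i.2; omega)
  · congr 1
    ext i
    rw [Polynomial.finsetSum_coeff, Finset.sum_eq_single i]
    · simp
    · intro j _ hj
      rw [Polynomial.coeff_monomial, if_neg (fun hh => hj (Fin.ext hh))]
    · simp

variable [IsDomain R]

lemma pow_dvd_of_dvd_pow_mul (h : IsRegularParam x y) (m n : ℕ) {c : R}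
    (hc : x ^ m ∣ y ^ n * c) : x ^ m ∣ c := by
  induction m generalizing c with
  | zero => simp
  | succ m ih =>
    obtain ⟨e, rfl⟩ := h.dvd_of_dvd_pow_mul n ((dvd_pow_self x (by omega)).trans hc)
    rw [pow_succ', mul_left_comm] at hc
    rw [pow_succ']
    exact mul_dvd_mul_left x (ih ((mul_dvd_mul_iff_left h.ne_left).1 hc))

lemma coeff_mem_of_sum_eq_zero (h : IsRegularParam x y) (d : ℕ) (c : ℕ → R)
    (hc : ∑ i ∈ Finset.range (d + 1), x ^ (d - i) * y ^ i * c i = 0) :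
    ∀ i ≤ d, c i ∈ maximalIdeal R := by
  induction d generalizing c with
  | zero =>
    intro i hi
    obtain rfl : i = 0 := by omega
    simp at hc
    simp [hc]
  | succ d ih =>
    have hsum : ∑ i ∈ Finset.range (d + 1), x ^ (d + 1 - i) * y ^ i * c i =
        x * ∑ i ∈ Finset.range (d + 1), x ^ (d - i) * y ^ i * c i := by
      rw [Finset.mul_sum]
      refine Finset.sum_congr rfl fun i hi => ?_
      rw [Finset.mem_range] at hi
      rw [show d + 1 - i = (d - i) + 1 by omega, pow_succ]
      ring
    rw [Finset.sum_range_succ, hsum] at hc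
    obtain ⟨e, he⟩ : x ∣ c (d + 1) := by
      refine h.dvd_of_dvd_pow_mul (d + 1) ?_
      rw [← dvd_add_right (Dvd.intro _ rfl : x ∣ x * _)]
      simp only [Nat.sub_self, pow_zero, one_mul] at hc
      rw [hc]
      exact dvd_zero x
    have hc' : ∑ i ∈ Finset.range (d + 1), x ^ (d - i) * y ^ i *
        (c i + if i = d then y * e else 0) = 0 := by
      apply mul_left_cancel₀ h.ne_left
      rw [mul_zero]
      refine Eq.trans ?_ hc
      rw [he]
      simp only [mul_add, Finset.sum_add_distrib]
      congr 1
      rw [Finset.sum_eq_single d]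
      · simp only [if_true, Nat.sub_self]; ring
      · intro i _ hi; simp [hi]
      · simp
    have := ih _ hc'
    intro i hi
    rcases Nat.lt_or_ge d i with hlt | hle
    · obtain rfl : i = d + 1 := by omega
      rw [he]
      exact Ideal.mul_mem_right _ _ h.left_mem
    · have h1 := this i hle
      split_ifs at h1 with hid
      · exact (Ideal.add_mem_iff_left _ (Ideal.mul_mem_right _ _ h.right_mem)).1 h1
      · simpa using h1

lemma mem_of_monoForm_mem_pow (h : IsRegularParam x y) {r : ℕ} {v : Fin r → R}
    (hv : monoForm r x y v ∈ maximalIdeal R ^ r) (i : Fin r) : v i ∈ maximalIdeal R := by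
  have hr : 1 ≤ r := by have := i.2; omega
  obtain ⟨w, hw, hwv⟩ := h.exists_monoForm_eq_of_mem_pow hr hv
  obtain ⟨d, rfl⟩ := Nat.exists_eq_add_of_le' hr
  have h0 : monoForm (d + 1) x y (v - w) = 0 := by rw [map_sub, hwv, sub_self]
  have := h.coeff_mem_of_sum_eq_zero d
    (fun j => if hj : j < d + 1 then (v - w) ⟨j, hj⟩ else 0) (by
      refine Eq.trans ?_ h0
      rw [Finset.sum_range, monoForm_apply]
      refine Finset.sum_congr rfl fun j _ => ?_
      rw [dif_pos j.2, Nat.add_sub_cancel]) i (by have := i.2; omega)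
  simp only [Fin.is_lt, dite_true, Fin.eta, Pi.sub_apply] at this
  exact (sub_add_cancel (v i) (w i)) ▸ Ideal.add_mem _ this (hw i)

lemma monoForm_mem_pow_iff (h : IsRegularParam x y) {r : ℕ} (v : Fin r → R) (hr : 1 ≤ r) :
    monoForm r x y v ∈ maximalIdeal R ^ r ↔ ∀ i, v i ∈ maximalIdeal R := by
  refine ⟨fun hv i => h.mem_of_monoForm_mem_pow hv i, fun hv => ?_⟩
  rw [monoForm_apply]
  obtain ⟨d, rfl⟩ := Nat.exists_eq_add_of_le' hr
  rw [pow_succ]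
  exact Ideal.sum_mem _ fun i _ => Ideal.mul_mem_mul (h.monomial_mem i) (hv i)

lemma mem_pow_succ_of_mul_mem (h : IsRegularParam x y) {s t : ℕ} {a b : R}
    (ha : a ∈ maximalIdeal R ^ s) (hb : b ∈ maximalIdeal R ^ t)
    (hab : a * b ∈ maximalIdeal R ^ (s + t + 1)) :
    a ∈ maximalIdeal R ^ (s + 1) ∨ b ∈ maximalIdeal R ^ (t + 1) := by
  obtain ⟨P, hP, rfl⟩ := h.exists_polynomial_of_mem_pow ha
  obtain ⟨Q, hQ, rfl⟩ := h.exists_polynomial_of_mem_pow hb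
  have hPQ : (P * Q).natDegree < s + t + 1 := by
    have := Polynomial.natDegree_mul_le (p := P) (q := Q); omega
  have hmul : monoForm (s + t + 1) x y (fun i => (P * Q).coeff i) =
      monoForm (s + 1) x y (fun i => P.coeff i) * monoForm (t + 1) x y (fun i => Q.coeff i) := by
    apply IsFractionRing.injective R (FractionRing R)
    rw [map_mul, map_monoForm_coeff h.ne_left y hP, map_monoForm_coeff h.ne_left y hQ,
      map_monoForm_coeff h.ne_left y hPQ, map_mul]
    simp only [add_tsub_cancel_right, pow_add]
    ring
  rw [← hmul] at hab
  have hcoef := h.mem_of_monoForm_mem_pow hab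
  have hzero : (P * Q).map (residue R) = 0 := by
    ext i
    rw [Polynomial.coeff_map, Polynomial.coeff_zero, residue_eq_zero_iff]
    by_cases hi : i < s + t + 1
    · exact hcoef ⟨i, hi⟩
    · rw [Polynomial.coeff_eq_zero_of_natDegree_lt (by omega)]
      exact zero_mem _
  rw [Polynomial.map_mul, mul_eq_zero] at hzero
  have key : ∀ {n : ℕ} {T : Polynomial R}, T.map (residue R) = 0 →
      monoForm (n + 1) x y (fun i => T.coeff i) ∈ maximalIdeal R ^ (n + 1) := by
    intro n T hT
    rw [h.monoForm_mem_pow_iff _ (by omega)]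
    intro i
    rw [← residue_eq_zero_iff, ← Polynomial.coeff_map, hT, Polynomial.coeff_zero]
  exact hzero.imp key key

lemma pow_notMem (h : IsRegularParam x y) {k : ℕ} {u : R} (hu : u ∈ maximalIdeal R ^ k)
    (hu' : u ∉ maximalIdeal R ^ (k + 1)) (n : ℕ) : u ^ n ∉ maximalIdeal R ^ (k * n + 1) := by
  induction n with
  | zero =>
    simp
  | succ n ih =>
    intro hn
    refine (h.mem_pow_succ_of_mul_mem ?_ hu (s := k * n) ?_).elim ih hu'
    · rw [pow_mul]; exact Ideal.pow_mem_pow hu n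
    · rw [← pow_succ, show k * n + k + 1 = k * (n + 1) + 1 by ring]
      exact hn

lemma mem_pow_of_memIntClosure (h : IsRegularParam x y) {J : Ideal R} {s : ℕ}
    (hJ : J ≤ maximalIdeal R ^ s) {u : R} (hu : MemIntClosure J u) : u ∈ maximalIdeal R ^ s := by
  suffices H : ∀ k ≤ s, u ∈ maximalIdeal R ^ k from H s le_rfl
  intro k
  induction k with
  | zero => simp
  | succ k ih =>
    intro hk
    have huk := ih (by omega)
    by_contra hnot
    obtain ⟨n, hn, c, hc, heq⟩ := hu
    apply h.pow_notMem huk hnot n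
    rw [eq_neg_of_add_eq_zero_left heq]
    refine neg_mem (Ideal.sum_mem _ fun i hi => ?_)
    have h1 : c i ∈ maximalIdeal R ^ (s * i) := by
      rw [pow_mul]
      exact Ideal.pow_right_mono hJ i (hc i hi)
    have h2 : u ^ (n - i) ∈ maximalIdeal R ^ (k * (n - i)) := by
      rw [pow_mul]
      exact Ideal.pow_mem_pow huk _
    have h3 := Ideal.mul_mem_mul h1 h2
    rw [← pow_add] at h3
    refine Ideal.pow_le_pow_right ?_ h3
    rw [Finset.mem_Icc] at hi
    obtain ⟨j, rfl⟩ := Nat.exists_eq_add_of_le hi.2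
    rw [Nat.add_sub_cancel_left]
    nlinarith [Nat.mul_le_mul_right i hk]

end IsRegularParam

end MonoForm

section IntClosure

variable {R : Type*} [CommRing R]

lemma sup_span_pow_succ_le (J : Ideal R) (u : R) (k : ℕ) :
    (J ⊔ Ideal.span {u}) ^ (k + 1) ≤ J * (J ⊔ Ideal.span {u}) ^ k ⊔ Ideal.span {u ^ (k + 1)} := by
  induction k with
  | zero => simp
  | succ k ih =>
    set K := J ⊔ Ideal.span {u}
    have hu : Ideal.span {u ^ (k + 1)} ≤ K ^ (k + 1) := by
      rw [← Ideal.span_singleton_pow]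
      exact Ideal.pow_right_mono le_sup_right _
    calc K ^ (k + 1 + 1) = K * K ^ (k + 1) := pow_succ' _ _
      _ ≤ K * (J * K ^ k ⊔ Ideal.span {u ^ (k + 1)}) := Ideal.mul_mono_right ih
      _ = J * K ^ (k + 1) ⊔ (J * Ideal.span {u ^ (k + 1)} ⊔ Ideal.span {u ^ (k + 1 + 1)}) := by
        rw [Ideal.mul_sup, mul_left_comm, ← pow_succ' K, Ideal.sup_mul J,
          Ideal.span_singleton_mul_span_singleton, ← pow_succ']
      _ ≤ J * K ^ (k + 1) ⊔ Ideal.span {u ^ (k + 1 + 1)} :=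
        sup_le le_sup_left
          (sup_le (le_sup_of_le_left (Ideal.mul_mono_right hu)) le_sup_right)

lemma MemIntClosure.exists_span_mul_le [IsDomain R] {J : Ideal R} {u : R}
    (hu : MemIntClosure J u) :
    ∃ E : Ideal R, E ≠ ⊥ ∧ Ideal.span {u} * E ≤ J * E := by
  by_cases hu0 : u = 0
  · exact ⟨⊤, top_ne_bot, by simp [hu0]⟩
  obtain ⟨n, hn, c, hc, heq⟩ := hu
  obtain ⟨k, rfl⟩ := Nat.exists_eq_add_of_le' hn
  refine ⟨(J ⊔ Ideal.span {u}) ^ k, ?_, ?_⟩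
  · refine pow_ne_zero _ fun h => hu0 ?_
    have : u ∈ J ⊔ Ideal.span {u} := Ideal.mem_sup_right (Ideal.mem_span_singleton_self u)
    rw [h] at this
    exact this
  · refine (Ideal.mul_mono_left (le_sup_right (a := J))).trans ?_
    rw [← pow_succ']
    refine (sup_span_pow_succ_le J u k).trans (sup_le le_rfl ?_)
    rw [Ideal.span_singleton_le_iff_mem, eq_neg_of_add_eq_zero_left heq]
    refine neg_mem (Ideal.sum_mem _ fun i hi => ?_)
    have hci := hc i hi
    rw [Finset.mem_Icc] at hi
    obtain ⟨j, rfl⟩ := Nat.exists_eq_add_of_le' hi.1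
    obtain ⟨l, rfl⟩ := Nat.exists_eq_add_of_le' (Nat.le_of_succ_le_succ hi.2)
    rw [show l + j + 1 - (j + 1) = l by omega]
    rw [pow_succ'] at hci
    have h1 : J * J ^ j * Ideal.span {u} ^ l ≤ J * (J ⊔ Ideal.span {u}) ^ (l + j) := by
      rw [mul_assoc, add_comm l j, pow_add]
      exact Ideal.mul_mono_right (Ideal.mul_mono (Ideal.pow_right_mono le_sup_left _)
        (Ideal.pow_right_mono le_sup_right _))
    exact h1 (Ideal.mul_mem_mul hci (Ideal.pow_mem_pow (Ideal.mem_span_singleton_self u) l))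

lemma memIntClosure_of_span_mul_le [IsDomain R] [IsNoetherianRing R] {J E : Ideal R} {u : R}
    (hE : E ≠ ⊥) (h : Ideal.span {u} * E ≤ J * E) : MemIntClosure J u := by
  obtain ⟨p, hp, -, hcoef, hzero⟩ :=
    LinearMap.exists_monic_and_natDegree_eq_and_coeff_mem_pow_and_aeval_eq_zero R
      (algebraMap R (Module.End R E) u) J (by
      rintro _ ⟨e, rfl⟩
      have he : u * (e : R) ∈ J * E := h (Ideal.mul_mem_mul (Ideal.mem_span_singleton_self u) e.2)
      have : u • (e : R) ∈ Submodule.map E.subtype (J • (⊤ : Submodule R E)) := by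
        rw [Submodule.map_smul'', Submodule.map_top, Submodule.range_subtype]
        exact he
      obtain ⟨e', he', hee⟩ := this
      rwa [show algebraMap R (Module.End R E) u e = e' from Subtype.ext hee.symm])
  obtain ⟨e, heE, he0⟩ := Submodule.exists_mem_ne_zero_of_ne_bot hE
  rw [Polynomial.aeval_algebraMap_apply] at hzero
  have hroot : p.eval u = 0 := by
    have := congrArg Subtype.val (LinearMap.congr_fun hzero ⟨e, heE⟩)
    simpa [he0, Module.algebraMap_end_apply] using this
  have hdeg : 0 < p.natDegree := by
    rw [Nat.pos_iff_ne_zero]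
    intro h0
    rw [hp.natDegree_eq_zero.1 h0] at hroot
    simp at hroot
  refine ⟨p.natDegree, hdeg, fun i => p.coeff (p.natDegree - i), fun i hi => ?_, ?_⟩
  · have := hcoef (p.natDegree - i)
    rwa [Nat.sub_sub_self (Finset.mem_Icc.1 hi).2] at this
  · rw [Polynomial.eval_eq_sum_range, Finset.sum_range_succ, hp.coeff_natDegree, one_mul,
      add_comm, ← Finset.sum_range_reflect] at hroot
    refine Eq.trans ?_ hroot
    congr 1
    refine Finset.sum_nbij' (· - 1) (· + 1) ?_ ?_ ?_ ?_ ?_ <;>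
      simp only [Finset.mem_Icc, Finset.mem_range] <;> intro i hi
    · omega
    · omega
    · omega
    · omega
    · rw [show p.natDegree - 1 - (i - 1) = p.natDegree - i by omega]

end IntClosure

section Det

variable {R : Type*} [CommRing R]

lemma det_mem_pow_of_rows_mem {ι : Type*} [Fintype ι] [DecidableEq ι] (𝔞 : Ideal R)
    (A : Matrix ι ι R) (i₀ : ι) (hA : ∀ i ≠ i₀, ∀ j, A i j ∈ 𝔞) :
    A.det ∈ 𝔞 ^ (Fintype.card ι - 1) := by
  rw [Matrix.det_apply]
  refine Ideal.sum_mem _ fun σ _ => ?_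
  rw [Units.smul_def]
  refine Submodule.smul_of_tower_mem _ _ ?_
  rw [← Finset.prod_erase_mul Finset.univ _ (Finset.mem_univ (σ⁻¹ i₀))]
  refine Ideal.mul_mem_right _ _ ?_
  have := Ideal.prod_mem_prod (s := Finset.univ.erase (σ⁻¹ i₀)) (I := fun _ => 𝔞)
    (x := fun i => A (σ i) i)
    (fun i hi => hA _ (fun h => (Finset.mem_erase.1 hi).1 (by simp [← h])) _)
  rwa [Finset.prod_const, Finset.card_erase_of_mem (Finset.mem_univ _), Finset.card_univ] at this

lemma colDet_eq_det {r : ℕ} (w : Fin r → Fin r → R) : colDet w = Matrix.det w :=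
  Matrix.det_transpose (M := w)

lemma det_mul_monomial_eq_sum {r : ℕ} (x y : R) (w : Matrix (Fin r) (Fin r) R) (i : Fin r) :
    w.det * (x ^ (r - 1 - (i : ℕ)) * y ^ (i : ℕ)) =
      ∑ j, w.adjugate i j * monoForm r x y (w j) := by
  have h := congrFun (congrArg (fun B => B.mulVec fun k : Fin r => x ^ (r - 1 - (k : ℕ)) * y ^ (k : ℕ))
    (Matrix.adjugate_mul w)) i
  simp only [Matrix.smul_mulVec, Matrix.one_mulVec, Pi.smul_apply, smul_eq_mul,
    ← Matrix.mulVec_mulVec] at h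
  rw [← h]
  simp only [Matrix.mulVec, dotProduct, monoForm_apply]
  simp only [mul_comm]

lemma monoForm_stdRelCol {r : ℕ} (x y : R) {k : ℕ} (hk : k + 1 < r) :
    monoForm r x y (stdRelCol r x y k) = 0 := by
  have hk' : stdRelCol r x y k =
      y • Pi.single ⟨k, by omega⟩ 1 - x • Pi.single ⟨k + 1, hk⟩ 1 := by
    ext i
    simp only [stdRelCol, Pi.sub_apply, Pi.smul_apply, Pi.single_apply, Fin.ext_iff, smul_eq_mul]
    split_ifs <;> first | omega | simp
  rw [hk', map_sub, map_smul, map_smul, monoForm_single, monoForm_single]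
  simp only [smul_eq_mul]
  rw [show r - 1 - k = (r - 1 - (k + 1)) + 1 by omega]
  ring

lemma colDet_snoc_stdRelCol [IsDomain R] {x y : R} (hy : y ≠ 0) {d : ℕ} (v : Fin (d + 1) → R) :
    colDet (Fin.snoc (α := fun _ => Fin (d + 1) → R)
      (fun k : Fin d => stdRelCol (d + 1) x y k) v) = monoForm (d + 1) x y v := by
  rw [colDet_eq_det]
  set w : Matrix (Fin (d + 1)) (Fin (d + 1)) R := Fin.snoc (α := fun _ => Fin (d + 1) → R)
      (fun k : Fin d => stdRelCol (d + 1) x y k) v with hw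
  have hwc : ∀ k : Fin d, w k.castSucc = stdRelCol (d + 1) x y k := fun k => by simp [hw]
  have hwl : w (Fin.last d) = v := by simp [hw]
  have hadj : w.adjugate (Fin.last d) (Fin.last d) = y ^ d := by
    rw [Matrix.adjugate_apply, Matrix.det_of_isUpperTriangular, Fin.prod_univ_castSucc]
    · simp [hwc, stdRelCol]
    · intro i j hij
      simp only [id] at hij
      rcases Fin.eq_castSucc_or_eq_last i with ⟨k, rfl⟩ | rfl
      · rw [Matrix.updateRow_ne (Fin.castSucc_lt_last _).ne, hwc]
        rw [Fin.lt_def, Fin.val_castSucc] at hij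
        simp only [stdRelCol]
        rw [if_neg (by omega), if_neg (by omega)]
      · rw [Matrix.updateRow_self, Pi.single_eq_of_ne hij.ne]
  have h := det_mul_monomial_eq_sum x y w (Fin.last d)
  rw [Fin.sum_univ_castSucc, Finset.sum_eq_zero, hwl, hadj] at h
  · apply mul_right_cancel₀ (pow_ne_zero d hy)
    simpa [mul_comm] using h
  · intro k _
    rw [hwc, monoForm_stdRelCol x y (by omega), mul_zero]

lemma IsRegularParam.span_det_mul_le [IsLocalRing R] {x y : R}
    (h : IsRegularParam x y) {r : ℕ} (hr : 1 ≤ r) (J : Ideal R) (w : Matrix (Fin r) (Fin r) R)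
    (hw : ∀ i j, w i j ∈ maximalIdeal R) (hJ : ∀ i, monoForm r x y (w i) ∈ J) :
    Ideal.span {w.det} * maximalIdeal R ^ (r - 1) ≤ J * maximalIdeal R ^ (r - 1) := by
  rw [Ideal.span_singleton_mul_le_iff]
  intro z hz
  have hz' : z ∈ LinearMap.range (monoForm r x y) := by
    rw [h.range_monoForm hr]; exact hz
  obtain ⟨v, rfl⟩ := hz'
  rw [monoForm_apply, Finset.mul_sum]
  refine Ideal.sum_mem _ fun i _ => ?_
  rw [← mul_assoc, det_mul_monomial_eq_sum]
  refine Ideal.mul_mem_right _ _ (Ideal.sum_mem _ fun j _ => ?_)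
  rw [mul_comm J]
  refine Ideal.mul_mem_mul ?_ (hJ j)
  rw [Matrix.adjugate_apply]
  convert det_mem_pow_of_rows_mem (maximalIdeal R) _ j fun k hk l => ?_
  · simp
  · rw [Matrix.updateRow_ne hk]
    exact hw k l

lemma det_mem_of_laplace {m n : Type*} [Fintype m] [Fintype n] [DecidableEq m] [DecidableEq n]
    (H : Ideal R) (A : Matrix (m ⊕ n) (m ⊕ n) R)
    (hA : ∀ e : Equiv.Perm (m ⊕ n),
      Matrix.det (Matrix.of fun i j => A (e (Sum.inl i)) (Sum.inl j)) *
        Matrix.det (Matrix.of fun i j => A (e (Sum.inr i)) (Sum.inr j)) ∈ H) :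
    A.det ∈ H := by
  classical
  set f : Equiv.Perm (m ⊕ n) → R := fun σ => (Equiv.Perm.sign σ : ℤ) * ∏ i, A (σ i) i with hf
  rw [Matrix.det_apply']
  change ∑ σ, f σ ∈ H
  set G := (Equiv.Perm.sumCongrHom m n).range
  rw [← Finset.sum_fiberwise Finset.univ (fun σ => (QuotientGroup.mk σ : Equiv.Perm (m ⊕ n) ⧸ G))]
  refine Ideal.sum_mem _ fun c _ => ?_
  obtain ⟨e, rfl⟩ := QuotientGroup.mk_surjective c
  have key : ∑ σ with (QuotientGroup.mk σ : Equiv.Perm (m ⊕ n) ⧸ G) = QuotientGroup.mk e, f σ =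
      ∑ p : Equiv.Perm m × Equiv.Perm n, f (e * Equiv.Perm.sumCongr p.1 p.2) := by
    symm
    refine Finset.sum_bij (fun p _ => e * Equiv.Perm.sumCongr p.1 p.2) ?_ ?_ ?_ ?_
    · intro p _
      simp only [Finset.mem_filter, Finset.mem_univ, true_and]
      symm
      rw [QuotientGroup.eq]
      exact ⟨p, by simp⟩
    · intro p _ q _ hpq
      exact Equiv.Perm.sumCongrHom_injective (mul_left_cancel hpq)
    · intro σ hσ
      simp only [Finset.mem_filter, Finset.mem_univ, true_and] at hσ
      obtain ⟨p, hp⟩ := (QuotientGroup.eq.1 hσ.symm)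
      exact ⟨p, Finset.mem_univ _, by
        rw [show Equiv.Perm.sumCongr p.1 p.2 = e⁻¹ * σ from hp]; simp⟩
    · intros; rfl
  rw [key]
  have : ∑ p : Equiv.Perm m × Equiv.Perm n, f (e * Equiv.Perm.sumCongr p.1 p.2) =
      (Equiv.Perm.sign e : ℤ) * (Matrix.det (Matrix.of fun i j => A (e (Sum.inl i)) (Sum.inl j)) *
        Matrix.det (Matrix.of fun i j => A (e (Sum.inr i)) (Sum.inr j))) := by
    rw [Matrix.det_apply', Matrix.det_apply', Finset.sum_mul_sum, Finset.mul_sum,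
      Fintype.sum_prod_type]
    refine Finset.sum_congr rfl fun α _ => ?_
    rw [Finset.mul_sum]
    refine Finset.sum_congr rfl fun β _ => ?_
    simp only [hf, Fintype.prod_sum_type, Equiv.Perm.sign_mul, Equiv.Perm.sign_sumCongr,
      Units.val_mul, Int.cast_mul, Equiv.Perm.coe_mul, Function.comp_apply,
      Equiv.Perm.sumCongr_apply, Sum.map_inl, Sum.map_inr, Matrix.of_apply]
    ring
  rw [this]
  exact Ideal.mul_mem_left _ _ (hA e)

end Det

section ComapMonoForm

lemma stdRelCol_mem_comap {R : Type*} [CommRing R] (x y : R) {r k : ℕ} (I : Ideal R)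
    (hk : k + 1 < r) :
    stdRelCol r x y k ∈ Submodule.comap (monoForm r x y) I := by
  rw [Submodule.mem_comap, monoForm_stdRelCol x y hk]
  exact zero_mem I

variable {R : Type*} [CommRing R] [IsLocalRing R]

lemma IsMPrimary.exists_pow_le [IsNoetherianRing R] {I : Ideal R} (hI : IsMPrimary I) :
    ∃ k, maximalIdeal R ^ k ≤ I :=
  hI ▸ Ideal.exists_radical_pow_le_of_fg I (IsNoetherian.noetherian _)

lemma IsMPrimary.isFiniteLength_quotient [IsNoetherianRing R] {I : Ideal R} (hI : IsMPrimary I) :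
    IsFiniteLength R (R ⧸ I) := by
  have hmin : maximalIdeal R ∈ I.minimalPrimes :=
    ⟨⟨inferInstance, hI ▸ Ideal.le_radical⟩, fun q hq _ =>
      hI ▸ (hq.1.radical_le_iff.2 hq.2)⟩
  have : IsArtinianRing (R ⧸ I) :=
    quotient_artinian_of_mem_minimalPrimes_of_isLocalRing I hmin
  rw [isFiniteLength_iff_isNoetherian_isArtinian]
  exact ⟨inferInstance, isArtinian_of_surjective_algebraMap
    (Ideal.Quotient.mk_surjective : Function.Surjective (Ideal.Quotient.mk I))⟩

lemma IsMPrimary.finColength_comap [IsNoetherianRing R] {x y : R} {r : ℕ} {I : Ideal R}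
    (hI : IsMPrimary I) : FinColength (Submodule.comap (monoForm r x y) I) := by
  refine hI.isFiniteLength_quotient.of_injective
    (f := Submodule.mapQ (Submodule.comap (monoForm r x y) I) I (monoForm r x y) le_rfl) ?_
  rw [← LinearMap.ker_eq_bot, Submodule.ker_mapQ, Submodule.mkQ_map_self]

lemma pow_smul_mem_comap {x y : R} {r k : ℕ} {I : Ideal R} (hk : maximalIdeal R ^ k ≤ I) {z : R}
    (hz : z ∈ maximalIdeal R) (v : Fin r → R) :
    z ^ k • v ∈ Submodule.comap (monoForm r x y) I := by
  rw [Submodule.mem_comap, map_smul]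
  exact Ideal.mul_mem_right _ _ (hk (Ideal.pow_mem_pow hz k))

namespace IsRegularParam

variable [IsDomain R] {x y : R}

lemma maximalIdeal_pow_ne_bot (h : IsRegularParam x y) (k : ℕ) : maximalIdeal R ^ k ≠ ⊥ :=
  pow_ne_zero _ fun h0 => h.ne_left (by simpa [h0] using h.left_mem)

lemma mem_of_mem_comap (h : IsRegularParam x y) {r : ℕ} {I : Ideal R}
    (hI : I ≤ maximalIdeal R ^ r) {v : Fin r → R}
    (hv : v ∈ Submodule.comap (monoForm r x y) I) (i : Fin r) : v i ∈ maximalIdeal R :=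
  h.mem_of_monoForm_mem_pow (hI hv) i

lemma maxMinors_comap [IsNoetherianRing R] (h : IsRegularParam x y) {r : ℕ} (hr : 1 ≤ r)
    {I : Ideal R} (hIc : IdealIntClosed I) (hI : I ≤ maximalIdeal R ^ r) :
    maxMinors (Submodule.comap (monoForm r x y) I) = I := by
  refine le_antisymm (Ideal.span_le.2 ?_) fun z hz => ?_
  · rintro _ ⟨w, hw, rfl⟩
    rw [colDet_eq_det]
    exact hIc _ (memIntClosure_of_span_mul_le (h.maximalIdeal_pow_ne_bot (r - 1))
      (h.span_det_mul_le hr I w (fun i => h.mem_of_mem_comap hI (hw i)) hw))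
  · obtain ⟨v, -, rfl⟩ := h.exists_monoForm_eq_of_mem_pow hr (hI hz)
    obtain ⟨d, rfl⟩ := Nat.exists_eq_add_of_le' hr
    rw [← colDet_snoc_stdRelCol h.ne_right]
    refine Ideal.subset_span ⟨_, fun j => ?_, rfl⟩
    refine Fin.lastCases ?_ (fun k => ?_) j
    · rw [Fin.snoc_last]; exact hz
    · rw [Fin.snoc_castSucc]
      exact stdRelCol_mem_comap x y I (by omega)

lemma modIntClosed_comap [IsNoetherianRing R] (h : IsRegularParam x y) {r : ℕ} (hr : 1 ≤ r)
    {I : Ideal R} (hIc : IdealIntClosed I) (hI : I ≤ maximalIdeal R ^ r) :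
    ModIntClosed (Submodule.comap (monoForm r x y) I) := by
  intro v hv
  obtain ⟨d, rfl⟩ := Nat.exists_eq_add_of_le' hr
  have := hv (Fin.snoc (α := fun _ => Fin (d + 1) → R)
      (fun k : Fin d => stdRelCol (d + 1) x y k) v) (Fin.last d) (Fin.snoc_last _ _) (by
        intro j hj
        rcases Fin.eq_castSucc_or_eq_last j with ⟨k, rfl⟩ | rfl
        · rw [Fin.snoc_castSucc]
          exact stdRelCol_mem_comap x y I (by omega)
        · exact absurd rfl hj)
  rw [h.maxMinors_comap hr hIc hI, colDet_snoc_stdRelCol h.ne_right] at this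
  exact hIc _ this

lemma comap_ne_bot (h : IsRegularParam x y) {r k : ℕ} (hr : 1 ≤ r) {I : Ideal R}
    (hk : maximalIdeal R ^ k ≤ I) : Submodule.comap (monoForm r x y) I ≠ ⊥ := by
  intro hbot
  have := pow_smul_mem_comap (x := x) (y := y) hk h.left_mem (fun _ : Fin r => 1)
  rw [hbot, Submodule.mem_bot] at this
  have := congrFun this ⟨0, hr⟩
  simp [h.ne_left] at this

end IsRegularParam

end ComapMonoForm

section Decomposition

variable {R : Type*} [CommRing R] [IsLocalRing R]

lemma IsRegularParam.exists_isCompl [IsDomain R] {x y : R} (h : IsRegularParam x y)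
    {ι : Type*} {M N P : Submodule R (ι → R)} (s : ℕ)
    (hx : ∀ v, x ^ s • v ∈ M) (hy : ∀ v, y ^ s • v ∈ M)
    (hsup : N ⊔ P = M) (hinf : N ⊓ P = ⊥) :
    ∃ F₁ F₂ : Submodule R (ι → R), IsCompl F₁ F₂ ∧ N ≤ F₁ ∧ P ≤ F₂ := by
  have hxs : x ^ s ≠ 0 := pow_ne_zero s h.ne_left
  refine ⟨N.comap (LinearMap.lsmul R (ι → R) (x ^ s)), P.comap (LinearMap.lsmul R (ι → R) (x ^ s)),
    ⟨?_, ?_⟩, fun v hv => N.smul_mem _ hv, fun v hv => P.smul_mem _ hv⟩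
  · rw [disjoint_iff, ← Submodule.comap_inf, hinf, eq_bot_iff]
    intro v hv
    exact (smul_eq_zero_iff_right hxs).1 hv
  · rw [codisjoint_iff, eq_top_iff]
    intro v _
    obtain ⟨n, hn, p, hp, hnp⟩ := Submodule.mem_sup.1 (hsup ▸ hx v)
    obtain ⟨n', hn', p', hp', hnp'⟩ := Submodule.mem_sup.1 (hsup ▸ hy v)
    have hkey : y ^ s • n - x ^ s • n' = x ^ s • p' - y ^ s • p := by
      rw [sub_eq_sub_iff_add_eq_add, ← smul_add, ← smul_add, add_comm p', hnp', hnp,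
        smul_comm]
    have hz : y ^ s • n - x ^ s • n' = 0 := by
      have : y ^ s • n - x ^ s • n' ∈ N ⊓ P :=
        ⟨N.sub_mem (N.smul_mem _ hn) (N.smul_mem _ hn'),
          hkey ▸ P.sub_mem (P.smul_mem _ hp') (P.smul_mem _ hp)⟩
      rwa [hinf, Submodule.mem_bot] at this
    have hdiv : ∀ {a b : ι → R}, y ^ s • a = x ^ s • b → ∃ c : ι → R, a = x ^ s • c := by
      intro a b hab
      choose c hc using fun i => h.pow_dvd_of_dvd_pow_mul s s (Dvd.intro (b i) (congrFun hab i).symm)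
      exact ⟨c, funext hc⟩
    obtain ⟨f, hf⟩ := hdiv (sub_eq_zero.1 hz)
    obtain ⟨g, hg⟩ := hdiv (sub_eq_zero.1 (hkey ▸ hz)).symm
    refine Submodule.mem_sup.2 ⟨f, ?_, g, ?_, ?_⟩
    · change x ^ s • f ∈ N
      rwa [← hf]
    · change x ^ s • g ∈ P
      rwa [← hg]
    · refine smul_right_injective (ι → R) hxs ?_
      change x ^ s • (f + g) = x ^ s • v
      rw [smul_add, ← hf, ← hg, hnp]

lemma IsCompl.free_of_isLocalRing {ι : Type*} [Finite ι] {F₁ F₂ : Submodule R (ι → R)}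
    (hc : IsCompl F₁ F₂) : Module.Finite R F₁ ∧ Module.Free R F₁ := by
  have h1 : Module.Finite R F₁ :=
    Module.Finite.of_surjective _ (Submodule.projectionOnto_surjective hc)
  have h2 : Module.Projective R F₁ :=
    Module.Projective.of_split F₁.subtype (F₁.projectionOnto F₂ hc)
      (Submodule.projectionOnto_comp_subtype hc)
  exact ⟨h1, Module.free_of_flat_of_isLocalRing⟩

open Polynomial in
lemma exists_monic_forall_dvd_eq_zero {k : Type*} [Field k] [Infinite k] (m : ℕ) :
    ∀ (V : Submodule k k[X]) [FiniteDimensional k V], Module.finrank k V ≤ m →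
      ∃ G : k[X], G.Monic ∧ G.natDegree = m ∧ ∀ q ∈ V, G ∣ q → q = 0 := by
  induction m with
  | zero =>
    intro V _ hV
    refine ⟨1, monic_one, natDegree_one, fun q hq _ => ?_⟩
    rw [Nat.le_zero, Submodule.finrank_eq_zero] at hV
    rwa [hV, Submodule.mem_bot] at hq
  | succ m ih =>
    intro V _ hV
    by_cases hbot : V = ⊥
    · exact ⟨X ^ (m + 1), monic_X_pow _, natDegree_X_pow _, fun q hq _ => by
        rwa [hbot, Submodule.mem_bot] at hq⟩
    obtain ⟨q₀, hq₀, hne⟩ := Submodule.exists_mem_ne_zero_of_ne_bot hbot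
    obtain ⟨a, ha⟩ : ∃ a, q₀.eval a ≠ 0 := by
      by_contra! hall
      exact hne (Polynomial.funext fun a => by simp [hall a])
    set V' := V ⊓ LinearMap.ker (leval a)
    have hlt : V' < V := lt_of_le_of_ne inf_le_left fun h => ha (by
      have : q₀ ∈ V' := h ▸ hq₀
      exact this.2)
    have : FiniteDimensional k V' := Submodule.finiteDimensional_of_le inf_le_left
    obtain ⟨G, hG, hdeg, hdvd⟩ := ih V' (by have := Submodule.finrank_lt_finrank_of_lt hlt; omega)
    refine ⟨(X - C a) * G, (monic_X_sub_C a).mul hG, ?_, fun q hq hGq => ?_⟩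
    · rw [(monic_X_sub_C a).natDegree_mul hG, natDegree_X_sub_C, hdeg, add_comm]
    · exact hdvd q ⟨hq, (dvd_iff_isRoot.1 ((Dvd.intro _ rfl).trans hGq))⟩
        ((Dvd.intro_left _ rfl).trans hGq)

end Decomposition

section AdaptedBasis

open Polynomial

variable {R : Type*} [CommRing R]

/-- The vector of the first `r` coefficients of a polynomial. -/
noncomputable def coeffVec (r : ℕ) : R[X] →ₗ[R] (Fin r → R) :=
  LinearMap.pi fun i => lcoeff R i

lemma coeffVec_apply (r : ℕ) (Q : R[X]) (i : Fin r) : coeffVec r Q i = Q.coeff i := rfl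

variable [IsLocalRing R]

/-- The polynomial over the residue field whose coefficients are the residues of a vector. -/
noncomputable def residuePoly (r : ℕ) : (Fin r → R) →ₗ[R] (ResidueField R)[X] :=
  ∑ i : Fin r, (monomial i).restrictScalars R ∘ₗ Algebra.linearMap R (ResidueField R) ∘ₗ
    LinearMap.proj i

lemma residuePoly_coeff (r : ℕ) (v : Fin r → R) (i : Fin r) :
    (residuePoly r v).coeff i = residue R (v i) := by
  simp only [residuePoly, LinearMap.sum_apply, LinearMap.comp_apply, finsetSum_coeff]
  rw [Finset.sum_eq_single i]
  · simp
  · intro j _ hj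
    simp [coeff_monomial, Fin.val_ne_iff.2 hj]
  · simp

lemma residuePoly_coeffVec {r : ℕ} {Q : R[X]} (hQ : Q.natDegree < r) :
    residuePoly r (coeffVec r Q) = Q.map (residue R) := by
  ext i
  by_cases hi : i < r
  · rw [residuePoly_coeff r _ ⟨i, hi⟩, coeff_map, coeffVec_apply]
  · rw [coeff_map, coeff_eq_zero_of_natDegree_lt (p := Q) (by omega), map_zero]
    simp only [residuePoly, LinearMap.sum_apply, LinearMap.comp_apply, finsetSum_coeff]
    refine Finset.sum_eq_zero fun j _ => ?_
    have := j.2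
    simp [coeff_monomial, show (j : ℕ) ≠ i by omega]

lemma residuePoly_eq_zero {r : ℕ} {v : Fin r → R} (hv : ∀ i, v i ∈ maximalIdeal R) :
    residuePoly r v = 0 := by
  simp only [residuePoly, LinearMap.sum_apply, LinearMap.comp_apply]
  refine Finset.sum_eq_zero fun i _ => ?_
  have : algebraMap R (ResidueField R) (v i) = 0 := (residue_eq_zero_iff _).2 (hv i)
  simp only [LinearMap.proj_apply, Algebra.linearMap_apply, this, map_zero]

lemma monoForm_smul_coeffVec [IsDomain R] {x y : R} (hx : x ≠ 0) {r : ℕ} {Q : R[X]}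
    (hQ : Q.natDegree + 1 < r) :
    monoForm r x y (y • coeffVec r Q - x • coeffVec r (X * Q)) = 0 := by
  apply IsFractionRing.injective R (FractionRing R)
  have hx' : algebraMap R (FractionRing R) x ≠ 0 := by simpa using hx
  have h1 : algebraMap R (FractionRing R) (monoForm r x y (coeffVec r Q)) = _ :=
    map_monoForm_coeff hx y (Q := Q) (by omega)
  have h2 : algebraMap R (FractionRing R) (monoForm r x y (coeffVec r (X * Q))) = _ :=
    map_monoForm_coeff hx y (Q := X * Q) (by
      have := natDegree_mul_le (p := X) (q := Q); have := natDegree_X_le (R := R); omega)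
  rw [map_sub, map_smul, map_smul, map_sub, smul_eq_mul, smul_eq_mul, map_mul, map_mul, h1, h2,
    map_mul, aeval_X, map_zero]
  field_simp
  ring

theorem IsRegularParam.exists_adapted_basis [IsDomain R] [Infinite (ResidueField R)] {x y : R}
    (h : IsRegularParam x y) {r r₁ r₂ : ℕ} (hr : r₁ + r₂ = r)
    {N F₁ F₂ : Submodule R (Fin r → R)} (hc : IsCompl F₁ F₂)
    (b₁ : Module.Basis (Fin r₁) R F₁) (b₂ : Module.Basis (Fin r₂) R F₂)
    (hN : ∀ v, monoForm r x y v = 0 → (F₁.projectionOnto F₂ hc v : Fin r → R) ∈ N) :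
    ∃ b : Module.Basis (Fin r₁) R F₁, ∀ (k : ℕ) (hk : k + 1 < r₁),
      y • (b ⟨k, by omega⟩ : Fin r → R) - x • (b ⟨k + 1, hk⟩ : Fin r → R) ∈ N := by
  set V : Submodule (ResidueField R) (ResidueField R)[X] :=
    Submodule.span _ (Set.range fun j => residuePoly r (b₂ j))
  have hfin : FiniteDimensional (ResidueField R) V :=
    FiniteDimensional.span_of_finite _ (Set.finite_range _)
  have hmemV : ∀ v ∈ F₂, residuePoly r v ∈ V := by
    intro v hv
    have hsum := congrArg Subtype.val (b₂.sum_repr ⟨v, hv⟩)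
    rw [Submodule.coe_sum] at hsum
    rw [← show _ = v from hsum, map_sum]
    refine V.sum_mem fun j _ => ?_
    rw [Submodule.coe_smul, map_smul]
    exact V.smul_of_tower_mem _ (Submodule.subset_span ⟨j, rfl⟩)
  obtain ⟨G₀, hG₀, hdeg₀, hdvd⟩ := exists_monic_forall_dvd_eq_zero r₂ V
    ((finrank_range_le_card _).trans (Fintype.card_fin _).le)
  obtain ⟨G, rfl, hdeg, hG⟩ := lifts_and_natDegree_eq_and_monic
    ((mem_lifts _).2 (map_surjective _ residue_surjective G₀)) hG₀
  have hdegX : ∀ i : ℕ, (X ^ i * G).natDegree = i + r₂ := fun i => by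
    rw [(monic_X_pow i).natDegree_mul hG, natDegree_X_pow, hdeg, hdeg₀]
  set e : Fin r₁ → F₁ := fun i => F₁.projectionOnto F₂ hc (coeffVec r (X ^ (i : ℕ) * G)) with he
  have hunit : IsUnit (b₁.det e) := by
    by_contra hnot
    rw [Module.Basis.det_apply, ← mem_nonunits_iff, ← mem_maximalIdeal, ← residue_eq_zero_iff,
      RingHom.map_det, ← Matrix.exists_mulVec_eq_zero_iff] at hnot
    obtain ⟨a', ha', hzero⟩ := hnot
    choose a ha using fun i => residue_surjective (a' i)
    set u : F₁ := ∑ i, a i • e i with hu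
    have hucoord : ∀ j, b₁.repr u j ∈ maximalIdeal R := by
      intro j
      have := congrFun hzero j
      rw [← residue_eq_zero_iff, hu, map_sum, Finsupp.finsetSum_apply, map_sum]
      rw [← show _ = (0 : ResidueField R) from this]
      refine Finset.sum_congr rfl fun i _ => ?_
      simp [ha, Module.Basis.toMatrix_apply, mul_comm]
    have hu0 : residuePoly r (u : Fin r → R) = 0 := by
      refine residuePoly_eq_zero fun l => ?_
      rw [← b₁.sum_repr u, Submodule.coe_sum, Finset.sum_apply]
      exact Ideal.sum_mem _ fun j _ => Ideal.mul_mem_right _ _ (hucoord j)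
    set A : R[X] := ∑ i : Fin r₁, C (a i) * X ^ (i : ℕ) with hA
    have hAcoeff : ∀ i : Fin r₁, A.coeff i = a i := by
      intro i
      rw [hA, finsetSum_coeff, Finset.sum_eq_single i]
      · simp
      · intro j _ hj
        rw [coeff_C_mul_X_pow, if_neg (fun hh => hj (Fin.ext hh.symm))]
      · simp
    have hAG : A * G = ∑ i : Fin r₁, a i • (X ^ (i : ℕ) * G) := by
      rw [hA, Finset.sum_mul]
      refine Finset.sum_congr rfl fun i _ => ?_
      rw [smul_eq_C_mul, mul_assoc]
    have hproj : F₁.projectionOnto F₂ hc (coeffVec r (A * G)) = u := by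
      simp only [hAG, map_sum, map_smul, hu, he]
    have hpoly : residuePoly r (coeffVec r (A * G)) = A.map (residue R) * G.map (residue R) := by
      rw [hAG]
      simp only [map_sum, map_smul]
      rw [← Polynomial.map_mul, hAG, Polynomial.map_sum]
      refine Finset.sum_congr rfl fun i _ => ?_
      rw [residuePoly_coeffVec (by rw [hdegX]; have := i.2; omega), Polynomial.map_smul]
      rfl
    have hmem : residuePoly r (coeffVec r (A * G)) ∈ V := by
      have h1 := Submodule.sub_projection_mem hc (coeffVec r (A * G))
      rw [← Submodule.coe_projectionOnto_apply, hproj] at h1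
      have h2 := hmemV _ h1
      rwa [map_sub, hu0, sub_zero] at h2
    have h0 := hdvd _ hmem (hpoly ▸ Dvd.intro_left _ rfl)
    rw [hpoly, mul_eq_zero, or_iff_left hG₀.ne_zero] at h0
    refine ha' (funext fun i => ?_)
    rw [← ha, ← hAcoeff, ← coeff_map, h0]
    simp
  obtain ⟨hli, hsp⟩ := b₁.is_basis_iff_det.2 hunit
  refine ⟨Module.Basis.mk hli hsp.ge, fun k hk => ?_⟩
  rw [Module.Basis.mk_apply, Module.Basis.mk_apply]
  have hker := monoForm_smul_coeffVec h.ne_left (y := y) (r := r) (Q := X ^ k * G)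
    (by rw [hdegX]; omega)
  have := hN _ hker
  rw [map_sub, map_smul, map_smul, ← mul_assoc, ← pow_succ'] at this
  exact this

end AdaptedBasis

section Splitting

variable {R : Type*} [CommRing R]

open Sum

/-- In the coordinates given by the basis `b`, the preimage of `I` under the linear form
`monoForm r x y` is the product `N₁ × N₂`, and `N₁`, `N₂` contain the Koszul columns. -/
structure IsSplitting (x y : R) (I : Ideal R) {r r₁ r₂ : ℕ}
    (b : Module.Basis (Fin r₁ ⊕ Fin r₂) R (Fin r → R))
    (N₁ : Submodule R (Fin r₁ → R)) (N₂ : Submodule R (Fin r₂ → R)) : Prop where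
  one_le_left : 1 ≤ r₁
  one_le_right : 1 ≤ r₂
  add_eq : r₁ + r₂ = r
  mem_iff : ∀ v, monoForm r x y (b.equivFun.symm v) ∈ I ↔ v ∘ inl ∈ N₁ ∧ v ∘ inr ∈ N₂
  stdRelCol_left : ∀ k, k + 1 < r₁ → stdRelCol r₁ x y k ∈ N₁
  stdRelCol_right : ∀ k, k + 1 < r₂ → stdRelCol r₂ x y k ∈ N₂

lemma exists_isUnit_det_equivFun_symm {ι : Type*} [Fintype ι] [DecidableEq ι] {r : ℕ}
    (b : Module.Basis ι R (Fin r → R)) (e : ι ≃ Fin r) :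
    ∃ c : R, IsUnit c ∧ ∀ A : Matrix ι ι R,
      Matrix.det (Matrix.of fun j => b.equivFun.symm (A (e.symm j))) = A.det * c := by
  refine ⟨Matrix.det (Matrix.of fun j => b (e.symm j)), ?_, fun A => ?_⟩
  · have := (Pi.basisFun R (Fin r)).isUnit_det (b.reindex e)
    rw [Module.Basis.det_apply, ← Matrix.det_transpose] at this
    convert this using 2
    ext i j
    simp [Module.Basis.toMatrix_apply]
  · rw [← Matrix.det_submatrix_equiv_self e.symm A, ← Matrix.det_mul]
    congr 1
    ext j l
    simp only [Matrix.of_apply, Matrix.mul_apply, Matrix.submatrix_apply,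
      Module.Basis.equivFun_symm_apply, Finset.sum_apply, Pi.smul_apply, smul_eq_mul]
    exact (Equiv.sum_comp e.symm (fun i => A (e.symm j) i * b i l)).symm

lemma Matrix.det_eq_zero_of_row_zero {n : Type*} [Fintype n] [DecidableEq n]
    (A : Matrix n n R) (i : n) (h : A i = 0) : A.det = 0 :=
  Matrix.det_eq_zero_of_row_eq_zero i (fun j => congrFun h j)

lemma memIntClosure_of_mem {J : Ideal R} {z : R} (hz : z ∈ J) : MemIntClosure J z :=
  ⟨1, one_pos, fun _ => -z, by simpa using hz, by simp⟩

namespace IsSplitting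

variable {x y : R} {I : Ideal R} {r r₁ r₂ : ℕ} {b : Module.Basis (Fin r₁ ⊕ Fin r₂) R (Fin r → R)}
  {N₁ : Submodule R (Fin r₁ → R)} {N₂ : Submodule R (Fin r₂ → R)}

lemma symm (S : IsSplitting x y I b N₁ N₂) :
    IsSplitting x y I (b.reindex (Equiv.sumComm _ _)) N₂ N₁ where
  one_le_left := S.one_le_right
  one_le_right := S.one_le_left
  add_eq := (add_comm _ _).trans S.add_eq
  mem_iff v := by
    rw [show (b.reindex (Equiv.sumComm (Fin r₁) (Fin r₂))).equivFun.symm v =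
      b.equivFun.symm (v ∘ Sum.swap) by
        simp [Module.Basis.equivFun_symm_apply, add_comm], S.mem_iff, and_comm]
    rfl
  stdRelCol_left := S.stdRelCol_right
  stdRelCol_right := S.stdRelCol_left

lemma monoForm_mem_of_laplace [IsDomain R] (S : IsSplitting x y I b N₁ N₂) (hy : y ≠ 0)
    (H : Ideal R) (v : Fin r₁ ⊕ Fin r₂ → R)
    (h₁ : ∀ (n : Matrix (Fin r₁) (Fin r₁) R) (p : Matrix (Fin r₂) (Fin r₂) R) (j : Fin r₁),
      n j = v ∘ inl → (∀ i ≠ j, n i ∈ N₁) → (∀ i, p i ∈ N₂) → n.det * p.det ∈ H)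
    (h₂ : ∀ (n : Matrix (Fin r₁) (Fin r₁) R) (p : Matrix (Fin r₂) (Fin r₂) R) (j : Fin r₂),
      (∀ i, n i ∈ N₁) → p j = v ∘ inr → (∀ i ≠ j, p i ∈ N₂) → n.det * p.det ∈ H) :
    monoForm r x y (b.equivFun.symm v) ∈ H := by
  obtain ⟨d, rfl⟩ := Nat.exists_eq_add_of_le'
    (S.one_le_left.trans (S.add_eq ▸ Nat.le_add_right _ _))
  set e : Fin r₁ ⊕ Fin r₂ ≃ Fin (d + 1) := finSumFinEquiv.trans (finCongr S.add_eq)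
  obtain ⟨c, -, hc⟩ := exists_isUnit_det_equivFun_symm b e
  set w : Fin (d + 1) → Fin (d + 1) → R := Fin.snoc (α := fun _ => Fin (d + 1) → R)
      (fun k : Fin d => stdRelCol (d + 1) x y k) (b.equivFun.symm v) with hw
  set K : Matrix (Fin r₁ ⊕ Fin r₂) (Fin r₁ ⊕ Fin r₂) R := fun i => b.equivFun (w (e i)) with hK
  have hKlast : K (e.symm (Fin.last d)) = v := by
    simp only [hK, Equiv.apply_symm_apply, hw, Fin.snoc_last]
    exact LinearEquiv.apply_symm_apply _ _
  have hKmem : ∀ i ≠ e.symm (Fin.last d), K i ∘ inl ∈ N₁ ∧ K i ∘ inr ∈ N₂ := by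
    intro i hi
    rw [← S.mem_iff]
    simp only [hK, LinearEquiv.symm_apply_apply]
    obtain ⟨k, hk⟩ := Fin.eq_castSucc_of_ne_last (x := e i) (fun hh => hi (by simp [← hh]))
    rw [← hk, hw, Fin.snoc_castSucc, monoForm_stdRelCol x y (by omega)]
    exact zero_mem I
  have hdet : monoForm (d + 1) x y (b.equivFun.symm v) = K.det * c := by
    rw [← hc, ← colDet_snoc_stdRelCol hy, colDet_eq_det]
    congr 1
    ext j
    simp [hK, hw]
  rw [hdet]
  refine Ideal.mul_mem_right _ _ (det_mem_of_laplace H K fun σ => ?_)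
  rcases h : σ⁻¹ (e.symm (Fin.last d)) with j | j
  · have hj : σ (inl j) = e.symm (Fin.last d) := by rw [← h]; simp
    refine h₁ _ _ j ?_ (fun i hi => (hKmem _ ?_).1) (fun i => (hKmem _ ?_).2)
    · ext l
      simp [hj, hKlast]
    · rw [← hj]; simpa using hi
    · rw [← hj]; simp
  · have hj : σ (inr j) = e.symm (Fin.last d) := by rw [← h]; simp
    refine h₂ _ _ j (fun i => (hKmem _ ?_).1) ?_ (fun i hi => (hKmem _ ?_).2)
    · rw [← hj]; simp
    · ext l
      simp [hj, hKlast]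
    · rw [← hj]; simpa using hi

variable [IsLocalRing R]

lemma mem_of_equivFun_symm_mem {v : Fin r₁ ⊕ Fin r₂ → R}
    (hv : ∀ i, b.equivFun.symm v i ∈ maximalIdeal R) (j : Fin r₁ ⊕ Fin r₂) :
    v j ∈ maximalIdeal R := by
  have : v = b.equivFun (b.equivFun.symm v) := (LinearEquiv.apply_symm_apply _ _).symm
  rw [this]
  generalize b.equivFun.symm v = w at hv
  rw [pi_eq_sum_univ w, map_sum, Finset.sum_apply]
  refine Ideal.sum_mem _ fun i _ => ?_
  rw [map_smul]
  exact Ideal.mul_mem_right _ _ (hv i)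

variable [IsDomain R]

lemma mem_maximalIdeal (S : IsSplitting x y I b N₁ N₂) (h : IsRegularParam x y)
    (hI : I ≤ maximalIdeal R ^ r) {v : Fin r₁ → R} (hv : v ∈ N₁) (i : Fin r₁) :
    v i ∈ maximalIdeal R := by
  have : monoForm r x y (b.equivFun.symm (Sum.elim v 0)) ∈ I := by
    rw [S.mem_iff]
    exact ⟨hv, zero_mem N₂⟩
  exact mem_of_equivFun_symm_mem (v := Sum.elim v 0)
    (h.mem_of_monoForm_mem_pow (hI this)) (inl i)

lemma map_le_pow (S : IsSplitting x y I b N₁ N₂) (h : IsRegularParam x y)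
    (hI : I ≤ maximalIdeal R ^ r) : N₁.map (monoForm r₁ x y) ≤ maximalIdeal R ^ r₁ := by
  rintro _ ⟨v, hv, rfl⟩
  exact (h.monoForm_mem_pow_iff v S.one_le_left).2 (S.mem_maximalIdeal h hI hv)

lemma span_det_mul_le (S : IsSplitting x y I b N₁ N₂) (h : IsRegularParam x y)
    (hI : I ≤ maximalIdeal R ^ r) (n : Matrix (Fin r₁) (Fin r₁) R) (hn : ∀ i, n i ∈ N₁) :
    Ideal.span {n.det} * maximalIdeal R ^ (r₁ - 1) ≤
      N₁.map (monoForm r₁ x y) * maximalIdeal R ^ (r₁ - 1) :=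
  h.span_det_mul_le S.one_le_left _ n (fun i => S.mem_maximalIdeal h hI (hn i))
    (fun i => Submodule.mem_map_of_mem (hn i))

variable [IsNoetherianRing R]

lemma map_mul_map_le (S : IsSplitting x y I b N₁ N₂) (h : IsRegularParam x y)
    (hIc : IdealIntClosed I) (hI : I ≤ maximalIdeal R ^ r) :
    (N₁.map (monoForm r₁ x y) * N₂.map (monoForm r₂ x y) : Ideal R) ≤ I := by
  rw [Ideal.mul_le]
  rintro _ ⟨v₁, hv₁, rfl⟩ _ ⟨v₂, hv₂, rfl⟩
  have hrow : ∀ {s : ℕ} {N : Submodule R (Fin s → R)} (hs : 1 ≤ s) (v : Fin s → R),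
      v ∈ N → (∀ k, k + 1 < s → stdRelCol s x y k ∈ N) →
      ∃ w : Matrix (Fin s) (Fin s) R, (∀ i, w i ∈ N) ∧ w.det = monoForm s x y v := by
    intro s N hs v hv hN
    obtain ⟨d, rfl⟩ := Nat.exists_eq_add_of_le' hs
    refine ⟨Fin.snoc (α := fun _ => Fin (d + 1) → R)
      (fun k : Fin d => stdRelCol (d + 1) x y k) v, fun i => ?_, ?_⟩
    · refine Fin.lastCases ?_ (fun k => ?_) i
      · rwa [Fin.snoc_last]
      · rw [Fin.snoc_castSucc]
        exact hN _ (by omega)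
    · rw [← colDet_snoc_stdRelCol h.ne_right, colDet_eq_det]
  obtain ⟨A, hA, hAdet⟩ := hrow S.one_le_left v₁ hv₁ S.stdRelCol_left
  obtain ⟨B, hB, hBdet⟩ := hrow S.one_le_right v₂ hv₂ S.stdRelCol_right
  obtain ⟨c, hcu, hc⟩ := exists_isUnit_det_equivFun_symm b
    (finSumFinEquiv.trans (finCongr S.add_eq))
  have key := hc (Matrix.fromBlocks A 0 0 B)
  rw [Matrix.det_fromBlocks_zero₂₁, hAdet, hBdet] at key
  rw [← Ideal.mul_unit_mem_iff_mem I hcu, ← key]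
  refine (h.maxMinors_comap (S.one_le_left.trans (S.add_eq ▸ Nat.le_add_right _ _)) hIc hI).le
    (Ideal.subset_span ⟨_, fun j => ?_, (colDet_eq_det _).symm⟩)
  refine (S.mem_iff _).2 ?_
  rcases (finSumFinEquiv.trans (finCongr S.add_eq)).symm j with i | i
  · exact ⟨hA i, zero_mem N₂⟩
  · exact ⟨zero_mem N₁, hB i⟩

lemma mem_of_memIntClosure (S : IsSplitting x y I b N₁ N₂) (h : IsRegularParam x y)
    (hIc : IdealIntClosed I) (hI : I ≤ maximalIdeal R ^ r) {v : Fin r₁ → R}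
    (hvm : ∀ i, v i ∈ maximalIdeal R)
    (hv : MemIntClosure (N₁.map (monoForm r₁ x y)) (monoForm r₁ x y v)) : v ∈ N₁ := by
  obtain ⟨E, hE, hEle⟩ := hv.exists_span_mul_le
  set I₁ : Ideal R := N₁.map (monoForm r₁ x y)
  set I₂ : Ideal R := N₂.map (monoForm r₂ x y)
  set J := I₁ ⊔ Ideal.span {monoForm r₁ x y v}
  have hJE : J * E ≤ I₁ * E := by
    rw [Ideal.sup_mul]
    exact sup_le le_rfl hEle
  suffices hmem : monoForm r x y (b.equivFun.symm (Sum.elim v 0)) ∈ I from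
    ((S.mem_iff _).1 hmem).1
  refine S.monoForm_mem_of_laplace h.ne_right I _ ?_ ?_
  · intro n p j hj hn hp
    apply hIc
    refine memIntClosure_of_span_mul_le
      (E := maximalIdeal R ^ (r₁ - 1) * maximalIdeal R ^ (r₂ - 1) * E)
      (mul_ne_zero (mul_ne_zero (h.maximalIdeal_pow_ne_bot _) (h.maximalIdeal_pow_ne_bot _)) hE) ?_
    have h1 : Ideal.span {n.det} * maximalIdeal R ^ (r₁ - 1) ≤ J * maximalIdeal R ^ (r₁ - 1) := by
      refine h.span_det_mul_le S.one_le_left J n (fun i => ?_) (fun i => ?_)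
      · rcases eq_or_ne i j with rfl | hij
        · rw [hj]; exact hvm
        · exact S.mem_maximalIdeal h hI (hn i hij)
      · rcases eq_or_ne i j with rfl | hij
        · rw [hj]; exact Ideal.mem_sup_right (Ideal.mem_span_singleton_self _)
        · exact Ideal.mem_sup_left (Submodule.mem_map_of_mem (hn i hij))
    have h2 := S.symm.span_det_mul_le h hI p hp
    rw [← Ideal.span_singleton_mul_span_singleton]
    calc _ = (Ideal.span {n.det} * maximalIdeal R ^ (r₁ - 1)) *
          (Ideal.span {p.det} * maximalIdeal R ^ (r₂ - 1)) * E := by ring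
      _ ≤ (J * maximalIdeal R ^ (r₁ - 1)) * (I₂ * maximalIdeal R ^ (r₂ - 1)) * E :=
        Ideal.mul_mono_left (Ideal.mul_mono h1 h2)
      _ = (J * E) * (I₂ * (maximalIdeal R ^ (r₁ - 1) * maximalIdeal R ^ (r₂ - 1))) := by ring
      _ ≤ (I₁ * E) * (I₂ * (maximalIdeal R ^ (r₁ - 1) * maximalIdeal R ^ (r₂ - 1))) :=
        Ideal.mul_mono_left hJE
      _ = (I₁ * I₂) * (maximalIdeal R ^ (r₁ - 1) * maximalIdeal R ^ (r₂ - 1) * E) := by ring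
      _ ≤ _ := Ideal.mul_mono_left (S.map_mul_map_le h hIc hI)
  · intro n p j _ hj _
    rw [Matrix.det_eq_zero_of_row_zero p j hj, mul_zero]
    exact zero_mem I

lemma idealIntClosed_map (S : IsSplitting x y I b N₁ N₂) (h : IsRegularParam x y)
    (hIc : IdealIntClosed I) (hI : I ≤ maximalIdeal R ^ r) :
    IdealIntClosed (N₁.map (monoForm r₁ x y) : Ideal R) := by
  intro z hz
  obtain ⟨v, hv, rfl⟩ := h.exists_monoForm_eq_of_mem_pow S.one_le_left
    (h.mem_pow_of_memIntClosure (S.map_le_pow h hI) hz)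
  exact Submodule.mem_map_of_mem (S.mem_of_memIntClosure h hIc hI hv hz)

lemma comap_map (S : IsSplitting x y I b N₁ N₂) (h : IsRegularParam x y)
    (hIc : IdealIntClosed I) (hI : I ≤ maximalIdeal R ^ r) :
    (N₁.map (monoForm r₁ x y)).comap (monoForm r₁ x y) = N₁ := by
  refine le_antisymm (fun v hv => ?_) (Submodule.le_comap_map _ _)
  exact S.mem_of_memIntClosure h hIc hI
    (h.mem_of_monoForm_mem_pow (S.map_le_pow h hI hv)) (memIntClosure_of_mem hv)

lemma det_mem_map (S : IsSplitting x y I b N₁ N₂) (h : IsRegularParam x y)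
    (hIc : IdealIntClosed I) (hI : I ≤ maximalIdeal R ^ r) (n : Matrix (Fin r₁) (Fin r₁) R)
    (hn : ∀ i, n i ∈ N₁) : n.det ∈ N₁.map (monoForm r₁ x y) :=
  S.idealIntClosed_map h hIc hI _ (memIntClosure_of_span_mul_le (h.maximalIdeal_pow_ne_bot _)
    (S.span_det_mul_le h hI n hn))

lemma eq_map_mul_map (S : IsSplitting x y I b N₁ N₂) (h : IsRegularParam x y)
    (hIc : IdealIntClosed I) (hI : I ≤ maximalIdeal R ^ r) :
    I = (N₁.map (monoForm r₁ x y) * N₂.map (monoForm r₂ x y) : Ideal R) := by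
  refine le_antisymm (fun z hz => ?_) (S.map_mul_map_le h hIc hI)
  obtain ⟨w, -, rfl⟩ := h.exists_monoForm_eq_of_mem_pow
    (S.one_le_left.trans (S.add_eq ▸ Nat.le_add_right _ _)) (hI hz)
  obtain ⟨v, rfl⟩ := b.equivFun.symm.surjective w
  obtain ⟨hv₁, hv₂⟩ := (S.mem_iff v).1 hz
  refine S.monoForm_mem_of_laplace h.ne_right _ v ?_ ?_
  · intro n p j hj hn hp
    refine Ideal.mul_mem_mul (S.det_mem_map h hIc hI n fun i => ?_)
      (S.symm.det_mem_map h hIc hI p hp)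
    rcases eq_or_ne i j with rfl | hij
    · rwa [hj]
    · exact hn i hij
  · intro n p j hn hj hp
    refine Ideal.mul_mem_mul (S.det_mem_map h hIc hI n hn)
      (S.symm.det_mem_map h hIc hI p fun i => ?_)
    rcases eq_or_ne i j with rfl | hij
    · rwa [hj]
    · exact hp i hij

lemma monoForm_elim_zero_mem (S : IsSplitting x y I b N₁ N₂) (h : IsRegularParam x y)
    (hIc : IdealIntClosed I) (hI : I ≤ maximalIdeal R ^ r) (v : Fin r₁ → R) :
    monoForm r x y (b.equivFun.symm (Sum.elim v 0)) ∈
      (maximalIdeal R ^ (r₁ - 1) * N₂.map (monoForm r₂ x y) : Ideal R) := by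
  refine S.monoForm_mem_of_laplace h.ne_right _ _ ?_ ?_
  · intro n p j _ hn hp
    refine Ideal.mul_mem_mul ?_ (S.symm.det_mem_map h hIc hI p hp)
    have := det_mem_pow_of_rows_mem (maximalIdeal R) n j
      fun i hi => S.mem_maximalIdeal h hI (hn i hi)
    rwa [Fintype.card_fin] at this
  · intro n p j _ hj _
    rw [Matrix.det_eq_zero_of_row_zero p j hj, mul_zero]
    exact zero_mem _

lemma monoForm_zero_elim_mem (S : IsSplitting x y I b N₁ N₂) (h : IsRegularParam x y)
    (hIc : IdealIntClosed I) (hI : I ≤ maximalIdeal R ^ r) (v : Fin r₂ → R) :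
    monoForm r x y (b.equivFun.symm (Sum.elim 0 v)) ∈
      (maximalIdeal R ^ (r₂ - 1) * N₁.map (monoForm r₁ x y) : Ideal R) := by
  convert S.symm.monoForm_elim_zero_mem h hIc hI v using 2
  simp [Module.Basis.equivFun_symm_apply]

lemma pow_eq (S : IsSplitting x y I b N₁ N₂) (h : IsRegularParam x y)
    (hIc : IdealIntClosed I) (hI : I ≤ maximalIdeal R ^ r) :
    maximalIdeal R ^ (r - 1) = (maximalIdeal R ^ (r₂ - 1) * N₁.map (monoForm r₁ x y) +
      maximalIdeal R ^ (r₁ - 1) * N₂.map (monoForm r₂ x y) : Ideal R) := by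
  have hr₁ := S.one_le_left
  have hr₂ := S.one_le_right
  have hr := S.add_eq
  refine le_antisymm (fun z hz => ?_) (sup_le ?_ ?_)
  · have hz' : z ∈ LinearMap.range (monoForm r x y) := by
      rw [h.range_monoForm (by omega)]; exact hz
    obtain ⟨w, rfl⟩ := hz'
    obtain ⟨v, rfl⟩ := b.equivFun.symm.surjective w
    have hv : v = Sum.elim (0 : Fin r₁ → R) (v ∘ inr) + Sum.elim (v ∘ inl) (0 : Fin r₂ → R) := by
      ext (i | i) <;> simp
    rw [hv, map_add, map_add]
    exact Submodule.add_mem_sup (S.monoForm_zero_elim_mem h hIc hI _)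
      (S.monoForm_elim_zero_mem h hIc hI _)
  · rw [show r - 1 = r₂ - 1 + r₁ by omega, pow_add]
    exact Ideal.mul_mono_right (S.map_le_pow h hI)
  · rw [show r - 1 = r₁ - 1 + r₂ by omega, pow_add]
    exact Ideal.mul_mono_right (S.symm.map_le_pow h hI)

lemma ordEQ_map (S : IsSplitting x y I b N₁ N₂) (h : IsRegularParam x y)
    (hIc : IdealIntClosed I) (hI : I ≤ maximalIdeal R ^ r) :
    ordEQ (N₁.map (monoForm r₁ x y) : Ideal R) r₁ := by
  refine ⟨S.map_le_pow h hI, fun hle => ?_⟩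
  have hr₂ := S.one_le_right
  have hr := S.add_eq
  have h1 := S.monoForm_zero_elim_mem h hIc hI 1
  have h2 : monoForm r x y (b.equivFun.symm (Sum.elim 0 1)) ∈ maximalIdeal R ^ r := by
    have := Ideal.mul_mono_right hle h1
    rwa [← pow_add, show r₂ - 1 + (r₁ + 1) = r by omega] at this
  have h3 := mem_of_equivFun_symm_mem (v := Sum.elim 0 1)
    (h.mem_of_monoForm_mem_pow h2) (inr ⟨0, hr₂⟩)
  exact (Ideal.ne_top_iff_one _).1 (maximalIdeal.isMaximal R).ne_top h3

lemma isMPrimary_map (S : IsSplitting x y I b N₁ N₂) (h : IsRegularParam x y)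
    (hIc : IdealIntClosed I) (hI : I ≤ maximalIdeal R ^ r) (hIp : IsMPrimary I) :
    IsMPrimary (N₁.map (monoForm r₁ x y) : Ideal R) := by
  refine le_antisymm ?_ ?_
  · refine (maximalIdeal.isMaximal R).isPrime.radical_le_iff.2 ((S.map_le_pow h hI).trans ?_)
    exact Ideal.pow_le_self (Nat.one_le_iff_ne_zero.1 S.one_le_left)
  · rw [← hIp]
    exact Ideal.radical_mono ((S.eq_map_mul_map h hIc hI).le.trans Ideal.mul_le_left)

end IsSplitting

end Splitting

section Length

lemma Nat.choose_two_add (m n : ℕ) :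
    (m + n).choose 2 = m.choose 2 + n.choose 2 + m * n := by
  induction n with
  | zero => simp
  | succ n ih =>
    rw [← add_assoc, Nat.choose_succ_succ' (m + n) 1, Nat.choose_succ_succ' n 1, ih]
    simp
    ring

variable {R : Type*} [CommRing R]

namespace IsSplitting

variable {x y : R} {I : Ideal R} {r r₁ r₂ : ℕ} {b : Module.Basis (Fin r₁ ⊕ Fin r₂) R (Fin r → R)}
  {N₁ : Submodule R (Fin r₁ → R)} {N₂ : Submodule R (Fin r₂ → R)}

lemma length_quotient_comap (S : IsSplitting x y I b N₁ N₂) :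
    Module.length R ((Fin r → R) ⧸ Submodule.comap (monoForm r x y) I) =
      Module.length R ((Fin r₁ → R) ⧸ N₁) + Module.length R ((Fin r₂ → R) ⧸ N₂) := by
  let f : (Fin r → R) →ₗ[R] ((Fin r₁ → R) ⧸ N₁) × ((Fin r₂ → R) ⧸ N₂) :=
    ((N₁.mkQ ∘ₗ LinearMap.funLeft R R Sum.inl).prod (N₂.mkQ ∘ₗ LinearMap.funLeft R R Sum.inr)) ∘ₗ
      b.equivFun.toLinearMap
  have hker : LinearMap.ker f = Submodule.comap (monoForm r x y) I := by
    ext v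
    obtain ⟨w, rfl⟩ := b.equivFun.symm.surjective v
    rw [Submodule.mem_comap, S.mem_iff, LinearMap.mem_ker]
    simp only [f, LinearMap.comp_apply, LinearEquiv.coe_coe, LinearEquiv.apply_symm_apply,
      LinearMap.prod_apply, Function.prod_apply, Prod.mk_eq_zero, Submodule.mkQ_apply,
      Submodule.Quotient.mk_eq_zero]
    rfl
  have hsurj : Function.Surjective f := by
    rintro ⟨⟨v⟩, ⟨w⟩⟩
    refine ⟨b.equivFun.symm (Sum.elim v w), ?_⟩
    simp only [f, LinearMap.comp_apply, LinearEquiv.coe_coe, LinearEquiv.apply_symm_apply]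
    rfl
  rw [← Module.length_prod, ← hker]
  exact (LinearMap.quotKerEquivOfSurjective f hsurj).length_eq

end IsSplitting

variable [IsLocalRing R]

namespace IsRegularParam

variable {x y : R}

lemma length_quotient_eq_add (h : IsRegularParam x y) {r : ℕ} (hr : 1 ≤ r) {J : Ideal R}
    (hJ : J ≤ maximalIdeal R ^ (r - 1)) :
    Module.length R (R ⧸ J) = Module.length R ((Fin r → R) ⧸ Submodule.comap (monoForm r x y) J) +
      Module.length R (R ⧸ maximalIdeal R ^ (r - 1)) := by
  refine Module.length_eq_add_of_exact
    ((Submodule.comap (monoForm r x y) J).mapQ J (monoForm r x y) le_rfl) (Submodule.factor hJ) ?_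
    (Submodule.factor_surjective hJ) ?_
  · rw [← LinearMap.ker_eq_bot, LinearMap.ker_eq_bot']
    rintro ⟨v⟩ hv
    have hv' : monoForm r x y v ∈ J := (Submodule.Quotient.mk_eq_zero J).1 hv
    exact (Submodule.Quotient.mk_eq_zero _).2 hv'
  · rintro ⟨z⟩
    refine ⟨fun hz => ?_, ?_⟩
    · have hz' : z ∈ maximalIdeal R ^ (r - 1) := (Submodule.Quotient.mk_eq_zero _).1 hz
      rw [← h.range_monoForm hr] at hz'
      obtain ⟨v, rfl⟩ := hz'
      exact ⟨Submodule.Quotient.mk v, rfl⟩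
    · rintro ⟨⟨v⟩, hv⟩
      rw [← hv]
      refine (Submodule.Quotient.mk_eq_zero _).2 ?_
      rw [← h.range_monoForm hr]
      exact ⟨v, rfl⟩

lemma length_quotient_pow [IsDomain R] (h : IsRegularParam x y) (k : ℕ) :
    Module.length R (R ⧸ maximalIdeal R ^ k) = ((k + 1).choose 2 : ℕ) := by
  induction k with
  | zero =>
    have : Subsingleton (R ⧸ maximalIdeal R ^ 0) :=
      Submodule.Quotient.subsingleton_iff.2 (by rw [pow_zero, Ideal.one_eq_top])
    rw [Module.length_eq_zero]
    rfl
  | succ k ih =>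
    have hcomap : Submodule.comap (monoForm (k + 1) x y) (maximalIdeal R ^ (k + 1)) =
        Submodule.pi Set.univ fun _ => maximalIdeal R := by
      ext v
      rw [Submodule.mem_comap, h.monoForm_mem_pow_iff v (by omega)]
      simp [Submodule.mem_pi]
    have : IsSimpleModule R (R ⧸ maximalIdeal R) :=
      isSimpleModule_iff_isCoatom.2 (maximalIdeal.isMaximal R).out
    rw [h.length_quotient_eq_add (r := k + 1) (by omega) (Ideal.pow_le_pow_right (by omega)),
      hcomap, (Submodule.quotientPi fun _ : Fin (k + 1) => maximalIdeal R).length_eq,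
      Module.length_pi_of_fintype, Nat.add_sub_cancel, ih, Nat.choose_succ_succ' (k + 1) 1]
    simp [Module.length_eq_one]

end IsRegularParam

variable [IsDomain R] [IsNoetherianRing R]

namespace IsSplitting

variable {x y : R} {I : Ideal R} {r r₁ r₂ : ℕ} {b : Module.Basis (Fin r₁ ⊕ Fin r₂) R (Fin r → R)}
  {N₁ : Submodule R (Fin r₁ → R)} {N₂ : Submodule R (Fin r₂ → R)}

lemma length_quotient_map (S : IsSplitting x y I b N₁ N₂) (h : IsRegularParam x y)
    (hIc : IdealIntClosed I) (hI : I ≤ maximalIdeal R ^ r) :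
    Module.length R (R ⧸ (N₁.map (monoForm r₁ x y) : Ideal R)) =
      Module.length R ((Fin r₁ → R) ⧸ N₁) + (r₁.choose 2 : ℕ) := by
  rw [h.length_quotient_eq_add S.one_le_left
    ((S.map_le_pow h hI).trans (Ideal.pow_le_pow_right (Nat.sub_le _ _))),
    S.comap_map h hIc hI, h.length_quotient_pow, Nat.sub_add_cancel S.one_le_left]

lemma modLength_eq (S : IsSplitting x y I b N₁ N₂) (h : IsRegularParam x y)
    (hIc : IdealIntClosed I) (hI : I ≤ maximalIdeal R ^ r) :
    modLength R (R ⧸ I) = modLength R (R ⧸ (N₁.map (monoForm r₁ x y) : Ideal R)) +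
      modLength R (R ⧸ (N₂.map (monoForm r₂ x y) : Ideal R)) +
        ((r₁ * r₂ : ℕ) : WithBot ℕ∞) := by
  have hr : 1 ≤ r := S.one_le_left.trans (S.add_eq ▸ Nat.le_add_right _ _)
  have key : Module.length R (R ⧸ I) =
      Module.length R (R ⧸ (N₁.map (monoForm r₁ x y) : Ideal R)) +
      Module.length R (R ⧸ (N₂.map (monoForm r₂ x y) : Ideal R)) + ((r₁ * r₂ : ℕ) : ℕ∞) := by
    rw [h.length_quotient_eq_add hr (hI.trans (Ideal.pow_le_pow_right (Nat.sub_le _ _))),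
      S.length_quotient_map h hIc hI, S.symm.length_quotient_map h hIc hI,
      S.length_quotient_comap, h.length_quotient_pow, Nat.sub_add_cancel hr, ← S.add_eq,
      Nat.choose_two_add]
    push_cast
    ring
  simp only [modLength, ← Module.coe_length, key]
  norm_cast

end IsSplitting

end Length

section Indecomposable

variable {R : Type*} [CommRing R]

lemma Submodule.projectionOnto_mem_of_mem_sup {E : Type*} [AddCommGroup E] [Module R E]
    {F₁ F₂ N P : Submodule R E} (hc : IsCompl F₁ F₂) (hN : N ≤ F₁) (hP : P ≤ F₂) {v : E}
    (hv : v ∈ N ⊔ P) : (F₁.projectionOnto F₂ hc v : E) ∈ N := by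
  obtain ⟨n, hn, p, hp, rfl⟩ := Submodule.mem_sup.1 hv
  rw [map_add, (Submodule.projectionOnto_apply_eq_zero_iff hc).2 (hP hp), add_zero,
    Submodule.projectionOnto_apply_left hc ⟨n, hN hn⟩]
  exact hn

lemma IsCompl.coe_add_coe_mem_sup_iff {E : Type*} [AddCommGroup E] [Module R E]
    {F₁ F₂ N P : Submodule R E} (hc : IsCompl F₁ F₂) (hN : N ≤ F₁) (hP : P ≤ F₂)
    (f₁ : F₁) (f₂ : F₂) : (f₁ + f₂ : E) ∈ N ⊔ P ↔ (f₁ : E) ∈ N ∧ (f₂ : E) ∈ P := by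
  refine ⟨fun hf => ⟨?_, ?_⟩, fun hf => Submodule.add_mem_sup hf.1 hf.2⟩
  · simpa [Submodule.projectionOnto_apply_left] using
      Submodule.projectionOnto_mem_of_mem_sup hc hN hP hf
  · rw [sup_comm] at hf
    simpa [Submodule.projectionOnto_apply_left] using
      Submodule.projectionOnto_mem_of_mem_sup hc.symm hP hN hf

lemma stdRelCol_eq_single {r : ℕ} (x y : R) {k : ℕ} (hk : k + 1 < r) :
    stdRelCol r x y k = y • Pi.single (⟨k, by omega⟩ : Fin r) (1 : R) -
      x • Pi.single (⟨k + 1, hk⟩ : Fin r) (1 : R) := by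
  ext i
  simp only [stdRelCol, Pi.sub_apply, Pi.smul_apply, Pi.single_apply, Fin.ext_iff, smul_eq_mul]
  split_ifs <;> first | omega | simp

lemma Module.Basis.equivFun_symm_stdRelCol {F : Type*} [AddCommGroup F] [Module R F] {r : ℕ}
    (b : Module.Basis (Fin r) R F) (x y : R) {k : ℕ} (hk : k + 1 < r) :
    b.equivFun.symm (stdRelCol r x y k) = y • b ⟨k, by omega⟩ - x • b ⟨k + 1, hk⟩ := by
  rw [stdRelCol_eq_single x y hk, map_sub, map_smul, map_smul]
  simp [Module.Basis.equivFun_symm_apply, Pi.single_apply]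

variable [IsLocalRing R] [IsDomain R] [Infinite (ResidueField R)]

lemma IsRegularParam.exists_isSplitting {x y : R} (h : IsRegularParam x y) {r k : ℕ} {I : Ideal R}
    (hk : maximalIdeal R ^ k ≤ I)
    (hdec : DecomposableSub (Submodule.comap (monoForm r x y) I)) :
    ∃ (r₁ r₂ : ℕ) (b : Module.Basis (Fin r₁ ⊕ Fin r₂) R (Fin r → R))
      (N₁ : Submodule R (Fin r₁ → R)) (N₂ : Submodule R (Fin r₂ → R)),
      IsSplitting x y I b N₁ N₂ := by
  obtain ⟨N, P, hsup, hinf, hN, hP⟩ := hdec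
  obtain ⟨F₁, F₂, hc, hNF, hPF⟩ := h.exists_isCompl k (pow_smul_mem_comap hk h.left_mem)
    (pow_smul_mem_comap hk h.right_mem) hsup hinf
  have ⟨_, _⟩ := hc.free_of_isLocalRing
  have ⟨_, _⟩ := hc.symm.free_of_isLocalRing
  have hr : Module.finrank R F₁ + Module.finrank R F₂ = r := by
    rw [← Module.finrank_prod, (Submodule.prodEquivOfIsCompl F₁ F₂ hc).finrank_eq,
      Module.finrank_fin_fun]
  have hker : ∀ v, monoForm r x y v = 0 → v ∈ N ⊔ P := fun v hv => by
    rw [hsup, Submodule.mem_comap, hv]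
    exact zero_mem I
  obtain ⟨b₁, hb₁⟩ := h.exists_adapted_basis hr hc (Module.finBasis R F₁) (Module.finBasis R F₂)
    fun v hv => Submodule.projectionOnto_mem_of_mem_sup hc hNF hPF (hker v hv)
  obtain ⟨b₂, hb₂⟩ := h.exists_adapted_basis ((add_comm _ _).trans hr) hc.symm
    (Module.finBasis R F₂) (Module.finBasis R F₁)
    fun v hv => Submodule.projectionOnto_mem_of_mem_sup hc.symm hPF hNF
      (by rw [sup_comm]; exact hker v hv)
  have hpos : ∀ {F Q : Submodule R (Fin r → R)} [Module.Finite R F] [Module.Free R F],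
      Q ≤ F → Q ≠ ⊥ → 1 ≤ Module.finrank R F := by
    intro F Q _ _ hQF hQ
    rw [Nat.one_le_iff_ne_zero]
    intro h0
    refine hQ (le_bot_iff.1 (hQF.trans (le_bot_iff.2 ?_)))
    rw [← Submodule.subsingleton_iff_eq_bot]
    exact Module.finrank_zero_iff.1 h0
  refine ⟨_, _, (b₁.prod b₂).map (Submodule.prodEquivOfIsCompl F₁ F₂ hc),
    N.comap (F₁.subtype ∘ₗ b₁.equivFun.symm.toLinearMap),
    P.comap (F₂.subtype ∘ₗ b₂.equivFun.symm.toLinearMap),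
    hpos hNF hN, hpos hPF hP, hr, fun v => ?_, fun k hk => ?_, fun k hk => ?_⟩
  · have hv : ((b₁.prod b₂).map (Submodule.prodEquivOfIsCompl F₁ F₂ hc)).equivFun.symm v =
        (b₁.equivFun.symm (v ∘ Sum.inl) : Fin r → R) + b₂.equivFun.symm (v ∘ Sum.inr) := by
      simp [Module.Basis.equivFun_symm_apply, Prod.fst_sum, Prod.snd_sum]
    rw [hv, ← Submodule.mem_comap, ← hsup]
    exact hc.coe_add_coe_mem_sup_iff hNF hPF _ _
  · rw [Submodule.mem_comap]
    simp only [LinearMap.comp_apply, LinearEquiv.coe_coe,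
      Module.Basis.equivFun_symm_stdRelCol _ x y hk]
    exact hb₁ k hk
  · rw [Submodule.mem_comap]
    simp only [LinearMap.comp_apply, LinearEquiv.coe_coe,
      Module.Basis.equivFun_symm_stdRelCol _ x y hk]
    exact hb₂ k hk

end Indecomposable

/-- existence theorem: if `I` is an integrally closed `𝔪`-primary ideal of
order `n` and either (1) `n > r`, or (2) `n = r` and `I` admits no factorisation
`I = I₁ I₂` into `𝔪`-primary integrally closed ideals of orders `r₁, r₂` satisfying
(a) `λ(R/I₁I₂) = λ(R/I₁) + λ(R/I₂) + r₁r₂` and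
(b) `𝔪^(r-1) = 𝔪^(r₂-1) I₁ + 𝔪^(r₁-1) I₂`, then `I = I(M)` for some indecomposable
integrally closed module `M` of rank `r`. -/
theorem statement11 (R : Type*) [CommRing R] [IsLocalRing R]
    (hreg : IsTwoDimRegularLocal R) [Infinite (IsLocalRing.ResidueField R)]
    (r : ℕ) (hr : 1 ≤ r)
    (I : Ideal R) (hIc : IdealIntClosed I) (hIp : IsMPrimary I)
    (n : ℕ) (hord : ordEQ I n)
    (hcond : r < n ∨ (n = r ∧
      ¬ ∃ (I₁ I₂ : Ideal R) (r₁ r₂ : ℕ),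
        IdealIntClosed I₁ ∧ IsMPrimary I₁ ∧ ordEQ I₁ r₁ ∧
        IdealIntClosed I₂ ∧ IsMPrimary I₂ ∧ ordEQ I₂ r₂ ∧
        I = I₁ * I₂ ∧
        modLength R (R ⧸ (I₁ * I₂)) =
          modLength R (R ⧸ I₁) + modLength R (R ⧸ I₂) + ((r₁ * r₂ : ℕ) : WithBot ℕ∞) ∧
        maximalIdeal R ^ (r - 1) =
          maximalIdeal R ^ (r₂ - 1) * I₁ + maximalIdeal R ^ (r₁ - 1) * I₂)) :
    ∃ M : Submodule R (Fin r → R),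
      FinColength M ∧ ModIntClosed M ∧ IndecomposableSub M ∧ maxMinors M = I := by
  have := hreg.1
  have := hreg.isDomain
  obtain ⟨x, y, hm⟩ := hreg.2.2
  have h := hreg.isRegularParam hm
  have hrn : r ≤ n := by omega
  have hI : I ≤ maximalIdeal R ^ r := hord.1.trans (Ideal.pow_le_pow_right hrn)
  obtain ⟨k, hk⟩ := hIp.exists_pow_le
  refine ⟨Submodule.comap (monoForm r x y) I, hIp.finColength_comap,
    h.modIntClosed_comap hr hIc hI, ⟨h.comap_ne_bot hr hk, fun hdec => ?_⟩,
    h.maxMinors_comap hr hIc hI⟩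
  obtain ⟨r₁, r₂, b, N₁, N₂, S⟩ := h.exists_isSplitting hk hdec
  have ho₁ := S.ordEQ_map h hIc hI
  have ho₂ := S.symm.ordEQ_map h hIc hI
  have hmul := S.eq_map_mul_map h hIc hI
  rcases hcond with hlt | ⟨-, hfac⟩
  · obtain ⟨a, ha, ha'⟩ := SetLike.not_le_iff_exists.1 ho₁.2
    obtain ⟨c, hc, hc'⟩ := SetLike.not_le_iff_exists.1 ho₂.2
    have hac : a * c ∈ maximalIdeal R ^ (r₁ + r₂ + 1) := by
      rw [S.add_eq]
      exact Ideal.pow_le_pow_right hlt (hord.1 (hmul.ge (Ideal.mul_mem_mul ha hc)))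
    rcases h.mem_pow_succ_of_mul_mem (ho₁.1 ha) (ho₂.1 hc) hac with hh | hh
    · exact ha' hh
    · exact hc' hh
  · refine hfac ⟨_, _, r₁, r₂, S.idealIntClosed_map h hIc hI, S.isMPrimary_map h hIc hI hIp, ho₁,
      S.symm.idealIntClosed_map h hIc hI, S.symm.isMPrimary_map h hIc hI hIp, ho₂, hmul, ?_,
      S.pow_eq h hIc hI⟩
    rw [← hmul]
    exact S.modLength_eq h hIc hI
end
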